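/- There exists a map f : ω₁ → ω₁ such that for every countable ordinal ξ, every separable Banach space X with φ_NU(X) ≤ ξ embeds isometrically into a Banach space Y with a Schauder basis satisfying φ_NU(Y) ≤ f(ξ). -/

import Mathlib

open Filter Topology MeasureTheory

noncomputable section

/-! ### The Cantor set and the space `C(2^ℕ)` -/

/-- The Cantor set `2^ℕ`. -/
abbrev CantorSet : Type := ℕ → Bool

/-- The Banach space `C(2^ℕ)` of continuous real-valued functions on the Cantor set. -/
abbrev CantorC : Type := C(CantorSet, ℝ)

/-! ### The standard Borel space `SB` of separable Banach spaces -/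

/-- `SB`: the set of closed linear subspaces of `C(2^ℕ)`. -/
def SB : Type := {Y : Submodule ℝ CantorC // IsClosed (Y : Set CantorC)}

/-- The Effros-Borel σ-algebra on `SB`, generated by the sets
`{Y : Y ∩ U ≠ ∅}` for `U` open in `C(2^ℕ)`. -/
instance : MeasurableSpace SB :=
  MeasurableSpace.generateFrom
    {A : Set SB | ∃ U : Set CantorC, IsOpen U ∧ A = {Y : SB | ((Y.1 : Set CantorC) ∩ U).Nonempty}}

/-- A subset of a standard Borel space is analytic if it is the image of a Borel map
from the Baire space `ℕ^ℕ`. -/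
def IsAnalyticIn {α : Type*} [MeasurableSpace α] (A : Set α) : Prop :=
  ∃ f : (ℕ → ℕ) → α, Measurable f ∧ A = Set.range f

/-! ### Embeddings, isomorphisms, universality -/

/-- `X` embeds isomorphically into `Y`: there is a bounded linear map which is
bounded below, i.e. an isomorphism onto its range. -/
def Embeds (X Y : Type*) [SeminormedAddCommGroup X] [NormedSpace ℝ X]
    [SeminormedAddCommGroup Y] [NormedSpace ℝ Y] : Prop :=
  ∃ (T : X →L[ℝ] Y) (c : ℝ), 0 < c ∧ ∀ x : X, c * ‖x‖ ≤ ‖T x‖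

/-- `X` embeds isometrically into `Y` (i.e. `Y` contains an isometric copy of `X`). -/
def EmbedsIsometrically (X Y : Type*) [SeminormedAddCommGroup X] [NormedSpace ℝ X]
    [SeminormedAddCommGroup Y] [NormedSpace ℝ Y] : Prop :=
  Nonempty (X →ₗᵢ[ℝ] Y)

/-- `X` and `Y` are isomorphic Banach spaces (linearly homeomorphic). -/
def IsomorphicTo (X Y : Type*) [SeminormedAddCommGroup X] [NormedSpace ℝ X]
    [SeminormedAddCommGroup Y] [NormedSpace ℝ Y] : Prop :=
  Nonempty (X ≃L[ℝ] Y)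

/-- The class `NU ⊆ SB` of non-universal spaces: those `X ∈ SB` which do not contain
an isomorphic copy of `C(2^ℕ)` (equivalently, are not universal for all separable
Banach spaces). -/
def NU : Set SB := {Y : SB | ¬ Embeds CantorC Y.1}

/-- The class `NC_X ⊆ SB` of all `Y ∈ SB` containing no isomorphic copy of `X`. -/
def NCin (X : Type*) [SeminormedAddCommGroup X] [NormedSpace ℝ X] : Set SB :=
  {Y : SB | ¬ Embeds X Y.1}

/-! ### Schauder bases -/

/-- `x` is a Schauder basis of `E`: every vector has a unique representation as a
norm convergent series `Σ aₙ • xₙ`. -/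
def IsSchauderBasis {E : Type*} [SeminormedAddCommGroup E] [NormedSpace ℝ E]
    (x : ℕ → E) : Prop :=
  ∀ y : E, ∃! a : ℕ → ℝ,
    Tendsto (fun m => ∑ n ∈ Finset.range m, a n • x n) atTop (𝓝 y)

/-- `E` has a Schauder basis. -/
def HasSchauderBasis (E : Type*) [SeminormedAddCommGroup E] [NormedSpace ℝ E] : Prop :=
  ∃ x : ℕ → E, IsSchauderBasis x

/-- `x` is a monotone basis sequence: initial-segment projections have norm at most 1. -/
def IsMonotoneSeq {E : Type*} [SeminormedAddCommGroup E] [NormedSpace ℝ E]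
    (x : ℕ → E) : Prop :=
  ∀ (a : ℕ → ℝ) (k m : ℕ), k ≤ m →
    ‖∑ n ∈ Finset.range k, a n • x n‖ ≤ ‖∑ n ∈ Finset.range m, a n • x n‖

/-- `x` is a bi-monotone sequence: interval projections have norm at most 1. -/
def IsBimonotoneSeq {E : Type*} [SeminormedAddCommGroup E] [NormedSpace ℝ E]
    (x : ℕ → E) : Prop :=
  ∀ (a : ℕ → ℝ) (j k m : ℕ), j ≤ k → k ≤ m →
    ‖∑ n ∈ Finset.Ico j k, a n • x n‖ ≤ ‖∑ n ∈ Finset.range m, a n • x n‖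

/-- `x` is a Schauder basic sequence: it is a Schauder basis of its closed linear span. -/
def IsSchauderBasicSeq {E : Type*} [NormedAddCommGroup E] [NormedSpace ℝ E]
    (x : ℕ → E) : Prop :=
  ∀ y ∈ (Submodule.span ℝ (Set.range x)).topologicalClosure,
    ∃! a : ℕ → ℝ,
      Tendsto (fun m => ∑ n ∈ Finset.range m, a n • x n) atTop (𝓝 y)

/-! ### Trees, ordinal ranks and Bourgain's index -/

/-- A tree on `Λ`: a set of finite sequences closed under initial segments. -/
def IsTree {Λ : Type*} (T : Set (List Λ)) : Prop :=
  ∀ s t : List Λ, s <+: t → t ∈ T → s ∈ T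

/-- A pruned tree: every node has a proper extension in the tree. -/
def IsPruned {Λ : Type*} (T : Set (List Λ)) : Prop :=
  ∀ t ∈ T, ∃ a : Λ, t ++ [a] ∈ T

/-- `σ` is an infinite branch of `T`. -/
def IsBranch {Λ : Type*} (T : Set (List Λ)) (σ : ℕ → Λ) : Prop :=
  ∀ n : ℕ, (List.ofFn fun i : Fin n => σ i) ∈ T

/-- `T` is ill-founded: it has an infinite branch. -/
def TreeIllFounded {Λ : Type*} (T : Set (List Λ)) : Prop :=
  ∃ σ : ℕ → Λ, IsBranch T σ

/-- The derivative of a tree: its non-maximal nodes, i.e. nodes having a proper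
extension in the tree. -/
def treeDeriv {Λ : Type*} (T : Set (List Λ)) : Set (List Λ) :=
  {l | l ∈ T ∧ ∃ a : Λ, l ++ [a] ∈ T}

/-- The iterated derivatives `T^(ξ)` of a tree, defined by transfinite recursion. -/
def treeDerivIter {Λ : Type*} (T : Set (List Λ)) (ξ : Ordinal.{0}) : Set (List Λ) :=
  Ordinal.limitRecOn ξ T (fun _ S => treeDeriv S)
    (fun o _ ih => ⋂ (o' : Ordinal.{0}) (h : o' < o), ih o' h)

/-- The ordinal rank `o(T)` of a (well-founded) tree: the least `ξ` with `T^(ξ) = ∅`. -/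
def treeRank {Λ : Type*} (T : Set (List Λ)) : Ordinal.{0} :=
  sInf {ξ : Ordinal.{0} | treeDerivIter T ξ = ∅}

/-- The first uncountable ordinal `ω₁`. -/
def omega1 : Ordinal.{0} := (Cardinal.aleph 1).ord

/-- Bourgain's tree `T(Y, (e_n), δ)`: all finite sequences `(y_0, …, y_k)` in `Y`
which are `δ`-equivalent to `(e_0, …, e_k)`. -/
def bourgainTree {W : Type*} [SeminormedAddCommGroup W] [NormedSpace ℝ W] (e : ℕ → W)
    (δ : ℝ) (Y : Type*) [SeminormedAddCommGroup Y] [NormedSpace ℝ Y] : Set (List Y) :=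
  {l : List Y | ∀ a : ℕ → ℝ,
    δ * ‖∑ i ∈ Finset.range l.length, a i • e i‖ ≤
        ‖∑ i ∈ Finset.range l.length, a i • l.getD i 0‖ ∧
    ‖∑ i ∈ Finset.range l.length, a i • l.getD i 0‖ ≤
        δ⁻¹ * ‖∑ i ∈ Finset.range l.length, a i • e i‖}

open Classical in
/-- Bourgain's ordinal index of `Y` relative to a (normalized Schauder) basis `(e_n)`
of a space `W`: it equals `ω₁` if some tree `T(Y, (e_n), δ)` is ill-founded, and
otherwise `sup_{0 < δ ≤ 1} o(T(Y, (e_n), δ))`.  With `W = C(2^ℕ)` this is `φ_NU`,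
and with `W = Z` it is `φ_{NC_Z}`. -/
def bourgainIndex {W : Type*} [SeminormedAddCommGroup W] [NormedSpace ℝ W] (e : ℕ → W)
    (Y : Type*) [SeminormedAddCommGroup Y] [NormedSpace ℝ Y] : Ordinal.{0} :=
  if ∃ δ ∈ Set.Ioc (0:ℝ) 1, TreeIllFounded (bourgainTree e δ Y) then omega1
  else ⨆ δ : Set.Ioc (0:ℝ) 1, treeRank (bourgainTree e δ.1 Y)

/-! ### The Schur property and the Radon-Nikodym property -/

/-- `X` has the Schur property: weakly convergent sequences are norm convergent. -/
def HasSchurProperty (X : Type*) [SeminormedAddCommGroup X] [NormedSpace ℝ X] : Prop :=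
  ∀ (f : ℕ → X) (x : X),
    (∀ φ : X →L[ℝ] ℝ, Tendsto (fun n => φ (f n)) atTop (𝓝 (φ x))) →
    Tendsto f atTop (𝓝 x)

/-- `X` has the Radon-Nikodym property: on every finite measure space, every
`X`-valued vector measure of bounded variation which is absolutely continuous
with respect to the measure has a Bochner-integrable density. -/
def HasRNP (X : Type*) [NormedAddCommGroup X] [NormedSpace ℝ X] : Prop :=
  ∀ (Ω : Type) [MeasurableSpace Ω] (μ : Measure Ω), IsFiniteMeasure μ →
    ∀ τ : VectorMeasure Ω X,
      (∀ s : Set Ω, MeasurableSet s → μ s = 0 → τ s = 0) →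
      (∃ C : ℝ, ∀ P : Finset (Set Ω), (∀ s ∈ P, MeasurableSet s) →
        ((P : Set (Set Ω)).Pairwise fun s t => Disjoint s t) →
        ∑ s ∈ P, ‖τ s‖ ≤ C) →
      ∃ g : Ω → X, Integrable g μ ∧
        ∀ s : Set Ω, MeasurableSet s → τ s = ∫ x in s, g x ∂μ

/-! ### `𝓛_{∞,λ}`-spaces -/

/-- The Banach-Mazur distance from `G` to `ℓ∞^n` is at most `θ`, witnessed by an
isomorphism `e` with `‖e‖ ⬝ ‖e⁻¹‖ ≤ θ'` for every `θ' > θ`. -/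
def BMdistToLinftyLE (G : Type*) [SeminormedAddCommGroup G] [NormedSpace ℝ G]
    (n : ℕ) (θ : ℝ) : Prop :=
  ∀ θ' : ℝ, θ < θ' → ∃ e : G ≃L[ℝ] (Fin n → ℝ),
    ‖(e : G →L[ℝ] (Fin n → ℝ))‖ * ‖(e.symm : (Fin n → ℝ) →L[ℝ] G)‖ ≤ θ'

/-- `X` is an (infinite-dimensional) `𝓛_{∞,λ}`-space: every finite-dimensional subspace
`F` of `X` is contained in a finite-dimensional subspace `G` with `d(G, ℓ∞^(dim G)) ≤ λ`. -/
def IsLinftyLam (lam : ℝ) (X : Type*) [NormedAddCommGroup X] [NormedSpace ℝ X] : Prop :=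
  (¬ FiniteDimensional ℝ X) ∧
  ∀ F : Submodule ℝ X, FiniteDimensional ℝ F →
    ∃ G : Submodule ℝ X, F ≤ G ∧ FiniteDimensional ℝ G ∧
      BMdistToLinftyLE G (Module.finrank ℝ G) lam

/-- `X` is an `𝓛_{∞,λ+}`-space: it is an `𝓛_{∞,θ}`-space for every `θ > λ`. -/
def IsLinftyPlus (lam : ℝ) (X : Type*) [NormedAddCommGroup X] [NormedSpace ℝ X] : Prop :=
  ∀ θ : ℝ, lam < θ → IsLinftyLam θ X

/-! ### Minimal spaces and `ℓ₁` -/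

/-- The space `ℓ₁`. -/
abbrev EllOne : Type := lp (fun _ : ℕ => ℝ) 1

/-- `X` is a minimal Banach space: it is infinite-dimensional and embeds isomorphically
into every infinite-dimensional (closed) subspace of itself. -/
def IsMinimal (X : Type*) [NormedAddCommGroup X] [NormedSpace ℝ X] : Prop :=
  (¬ FiniteDimensional ℝ X) ∧
  ∀ Z : Submodule ℝ X, IsClosed (Z : Set X) → ¬ FiniteDimensional ℝ Z → Embeds X Z

end

open Filter Topology MeasureTheory

/-! ## Tree lemmas -/

theorem tdi_zero {Λ : Type*} (T : Set (List Λ)) : treeDerivIter T 0 = T := by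
  simp [treeDerivIter]

theorem tdi_succ {Λ : Type*} (T : Set (List Λ)) (o : Ordinal.{0}) :
    treeDerivIter T (Order.succ o) = treeDeriv (treeDerivIter T o) := by
  unfold treeDerivIter
  rw [Order.succ_eq_add_one, Ordinal.limitRecOn_add_one]

theorem tdi_limit {Λ : Type*} (T : Set (List Λ)) (o : Ordinal.{0}) (ho : Order.IsSuccLimit o) :
    treeDerivIter T o = ⋂ (o' : Ordinal.{0}) (_ : o' < o), treeDerivIter T o' := by
  unfold treeDerivIter
  rw [Ordinal.limitRecOn_limit _ _ _ _ ho]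

theorem tdi_subset {Λ : Type*} (T : Set (List Λ)) (o : Ordinal.{0}) : treeDerivIter T o ⊆ T := by
  induction o using Ordinal.limitRecOn with
  | zero => rw [tdi_zero]
  | add_one o ih => 
    rw [← Order.succ_eq_add_one, tdi_succ]
    intro l hl
    exact ih hl.1
  | limit o ho ih =>
    rw [tdi_limit _ _ ho]
    intro l hl
    simp only [Set.mem_iInter] at hl
    have h0 : (0 : Ordinal.{0}) < o := bot_lt_iff_ne_bot.2 ho.ne_bot
    exact ih 0 h0 (hl 0 h0)

theorem tdi_le_rank {Λ : Type*} (T : Set (List Λ)) (r : List Λ → Ordinal.{0})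
    (hr : ∀ l a, l ++ [a] ∈ T → r (l ++ [a]) < r l) (o : Ordinal.{0}) :
    ∀ l ∈ treeDerivIter T o, o ≤ r l := by
  induction o using Ordinal.limitRecOn with
  | zero => intro l _; exact zero_le
  | add_one o ih =>
    rw [← Order.succ_eq_add_one, tdi_succ]
    rintro l ⟨_, a, ha⟩
    exact Order.succ_le_of_lt ((ih _ ha).trans_lt (hr _ _ (tdi_subset _ _ ha)))
  | limit o ho ih =>
    rw [tdi_limit _ _ ho]
    intro l hl
    simp only [Set.mem_iInter] at hl
    refine le_of_forall_lt fun c hc => ?_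
    have h1 := ho.succ_lt hc
    exact (Order.lt_succ c).trans_le (ih _ h1 l (hl _ h1))

theorem treeRank_le_of_rank {Λ : Type*} (T : Set (List Λ)) (r : List Λ → Ordinal.{0})
    (hr : ∀ l a, l ++ [a] ∈ T → r (l ++ [a]) < r l) (η : Ordinal.{0}) (hη : ∀ l ∈ T, r l < η) :
    treeRank T ≤ η := by
  apply csInf_le'
  rw [Set.mem_ofPred_eq, Set.eq_empty_iff_forall_notMem]
  intro l hl
  exact absurd (tdi_le_rank T r hr η l hl) (not_le.2 (hη l (tdi_subset _ _ hl)))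

theorem ofFn_succ_snoc {Λ : Type*} (σ : ℕ → Λ) (n : ℕ) :
    (List.ofFn fun i : Fin (n+1) => σ i) = (List.ofFn fun i : Fin n => σ i) ++ [σ n] := by
  rw [List.ofFn_succ_last]; simp

theorem not_ill_of_rank {Λ : Type*} {β : Type*} (T : Set (List Λ)) (R : β → β → Prop)
    (hR : WellFounded R) (r : List Λ → β)
    (hr : ∀ l a, l ++ [a] ∈ T → R (r (l ++ [a])) (r l)) : ¬ TreeIllFounded T := by
  rintro ⟨σ, hσ⟩
  have := wellFounded_iff_isEmpty_descending_chain.1 hR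
  refine this.elim ⟨fun n => r (List.ofFn fun i : Fin n => σ i), fun n => ?_⟩
  have h := hσ (n+1)
  simp only [ofFn_succ_snoc] at h ⊢
  exact hr _ _ h

def treeRel {Λ : Type*} (T : Set (List Λ)) (l' l : List Λ) : Prop := ∃ a, l' = l ++ [a] ∧ l' ∈ T

theorem treeRel_wf {Λ : Type*} (T : Set (List Λ)) (hT : IsTree T) (h : ¬ TreeIllFounded T) :
    WellFounded (treeRel T) := by
  rw [wellFounded_iff_isEmpty_descending_chain]
  refine ⟨fun ⟨f, hf⟩ => h ?_⟩
  choose a ha hT' using hf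
  have hlen : ∀ n, n ≤ (f n).length := by
    intro n
    induction n with
    | zero => simp
    | succ n ih => rw [ha]; simp; exact ih
  have hpre : ∀ n m, n ≤ m → f n <+: f m := by
    intro n m hnm
    induction m, hnm using Nat.le_induction with
    | base => exact List.prefix_refl _
    | succ m _ ih => rw [ha m]; exact ih.trans (List.prefix_append _ _)
  refine ⟨fun i => (f (i+1))[i]'(hlen (i+1)), fun n => ?_⟩
  have key : (List.ofFn fun i : Fin n => (f (i+1))[(i:ℕ)]'(hlen (i+1))) = (f (n+1)).take n := by
    apply List.ext_getElem
    · simp; exact (Nat.le_succ n).trans (hlen (n+1))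
    · intro i h1 h2
      simp only [List.length_ofFn] at h1
      simp only [List.getElem_ofFn, List.getElem_take]
      exact (hpre (i+1) (n+1) (by omega)).getElem _
  rw [key]
  exact hT _ _ ⟨_, List.take_append_drop _ _⟩ (hT' n)

theorem exists_rank_of_wf {Λ : Type} (T : Set (List Λ)) (h : WellFounded (treeRel T)) :
    ∃ r : List Λ → Ordinal.{0}, ∀ l a, l ++ [a] ∈ T → r (l ++ [a]) < r l := by
  have : IsWellFounded _ (treeRel T) := ⟨h⟩
  exact ⟨IsWellFounded.rank (treeRel T), fun l a hla =>
    IsWellFounded.rank_lt_of_rel ⟨a, rfl, hla⟩⟩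

theorem exists_rank_le {Λ : Type} (T : Set (List Λ)) (hT : IsTree T) (h : ¬ TreeIllFounded T)
    (ξ : Ordinal.{0}) (hξ : treeRank T ≤ ξ) :
    ∃ ρ : List Λ → Ordinal.{0}, (∀ l, ρ l ≤ ξ) ∧ ∀ l a, l ++ [a] ∈ T → ρ (l ++ [a]) < ρ l := by
  obtain ⟨r, hr⟩ := exists_rank_of_wf T (treeRel_wf T hT h)
  have hne : {ξ : Ordinal.{0} | treeDerivIter T ξ = ∅}.Nonempty := by
    refine ⟨Order.succ (⨆ l, r l), ?_⟩
    rw [Set.mem_ofPred_eq, Set.eq_empty_iff_forall_notMem]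
    intro l hl
    have h1 := tdi_le_rank T r hr _ l hl
    exact absurd (Order.succ_le_iff.1 h1) (not_lt.2 (Ordinal.le_iSup r l))
  have hemp : treeDerivIter T (treeRank T) = ∅ := csInf_mem hne
  have hin : ∀ l, treeRank T ∈ {α | l ∉ treeDerivIter T α} := by
    intro l; simp [hemp]
  refine ⟨fun l => sInf {α | l ∉ treeDerivIter T α}, fun l => (csInf_le' (hin l)).trans hξ, ?_⟩
  intro l a hla
  change sInf {α | l ++ [a] ∉ treeDerivIter T α} < sInf {α | l ∉ treeDerivIter T α}
  have hmem : sInf {α | l ∉ treeDerivIter T α} ∈ {α | l ∉ treeDerivIter T α} :=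
    csInf_mem ⟨_, hin l⟩
  have hmin : ∀ β < sInf {α | l ∉ treeDerivIter T α}, l ∈ treeDerivIter T β := by
    intro β hβ
    by_contra hc
    exact absurd hβ (not_lt.2 (csInf_le' hc))
  generalize sInf {α | l ∉ treeDerivIter T α} = α at hmem hmin
  induction α using Ordinal.limitRecOn with
  | zero =>
    exfalso
    apply hmem
    rw [tdi_zero]
    exact hT _ _ (List.prefix_append _ _) hla
  | add_one β _ =>
    have hlt : β < β + 1 := Order.lt_succ β
    refine lt_of_le_of_lt (csInf_le' ?_) hlt
    intro hc
    apply hmem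
    rw [← Order.succ_eq_add_one, tdi_succ]
    exact ⟨hmin β hlt, a, hc⟩
  | limit o ho _ =>
    exfalso
    apply hmem
    rw [tdi_limit _ _ ho]
    simp only [Set.mem_iInter]
    exact hmin

theorem omega1_eq : omega1 = Ordinal.omega 1 := by
  simp [omega1]

theorem countable_Iic (ξ : Ordinal.{0}) (h : ξ < omega1) : (Set.Iic ξ).Countable := by
  rw [← Set.countable_coe_iff, ← Cardinal.mk_le_aleph0_iff]
  have h1 : Set.Iic ξ = Set.Iio (Order.succ ξ) := by ext; simp
  rw [h1, Cardinal.mk_Iio_ordinal]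
  have h2 : Order.succ ξ < omega1 := (Cardinal.isSuccLimit_ord (Cardinal.aleph0_le_aleph 1)).succ_lt h
  have h3 : (Order.succ ξ).card < Cardinal.aleph 1 := Cardinal.lt_ord.1 h2
  rw [← Cardinal.succ_aleph0, Order.lt_succ_iff] at h3
  rw [← Cardinal.lift_aleph0.{1,0}]
  exact Cardinal.lift_le.2 h3

theorem exists_enc (ξ : Ordinal.{0}) (h : ξ < omega1) :
    ∃ (R : ℕ → ℕ → Prop) (enc : Ordinal.{0} → ℕ), WellFounded R ∧
      ∀ α β, α ≤ ξ → β ≤ ξ → α < β → R (enc α) (enc β) := by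
  classical
  obtain ⟨enc, henc⟩ := Set.countable_iff_exists_injOn.1 (countable_Iic ξ h)
  refine ⟨fun m n => ∃ α β, α ≤ ξ ∧ β ≤ ξ ∧ α < β ∧ enc α = m ∧ enc β = n, enc, ?_, ?_⟩
  · let dec : ℕ → Ordinal.{0} := fun m => if h : ∃ α ≤ ξ, enc α = m then h.choose else 0
    have hdec : ∀ α ≤ ξ, dec (enc α) = α := by
      intro α hα
      have hex : ∃ β ≤ ξ, enc β = enc α := ⟨α, hα, rfl⟩
      have : dec (enc α) = hex.choose := dif_pos hex
      rw [this]
      exact henc hex.choose_spec.1 hα hex.choose_spec.2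
    refine Subrelation.wf (r := InvImage (· < ·) dec) ?_ (InvImage.wf _ wellFounded_lt)
    rintro m n ⟨α, β, hα, hβ, hlt, rfl, rfl⟩
    simpa [InvImage, hdec α hα, hdec β hβ] using hlt
  · intro α β hα hβ hlt
    exact ⟨α, β, hα, hβ, hlt, rfl, rfl⟩

theorem countable_rank_bound {β : Type} [Countable β] (r : β → Ordinal.{0})
    (hr : ∀ b, r b < omega1) : ∃ η < omega1, ∀ b, r b < η := by
  have h := Ordinal.iSup_lt_omega_one (f := r) (by rw [← omega1_eq]; exact hr)
  rw [← omega1_eq] at h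
  exact ⟨Order.succ (⨆ b, r b), (Cardinal.isSuccLimit_ord (Cardinal.aleph0_le_aleph 1)).succ_lt h,
    fun b => Order.lt_succ_of_le (Ordinal.le_iSup r b)⟩

theorem rank_lt_omega1 {β : Type} [Countable β] (R : β → β → Prop) [IsWellFounded β R] (b : β) :
    IsWellFounded.rank R b < omega1 := by
  induction b using IsWellFounded.induction R with
  | _ b ih =>
    rw [IsWellFounded.rank_eq]
    rw [omega1_eq]
    apply Ordinal.iSup_lt_omega_one
    rintro ⟨c, hc⟩
    rw [← omega1_eq]
    exact (Cardinal.isSuccLimit_ord (Cardinal.aleph0_le_aleph 1)).succ_lt (ih c hc)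

open Filter Topology MeasureTheory

/-! ## Boundedness -/

theorem bounded_ranks {P : Type} [TopologicalSpace P] [PolishSpace P] {Λ : Type} [Countable Λ]
    (A : Set P) (T : P → Set (List Λ)) (hT : ∀ a ∈ A, IsTree (T a))
    (H : ∀ (p : P) (a : ℕ → P), (∀ n, a n ∈ A) → Tendsto a atTop (𝓝 p) →
      ∀ σ : ℕ → Λ, (∀ n, (List.ofFn fun i : Fin n => σ i) ∈ T (a n)) → False) :
    ∃ η < omega1, ∀ a ∈ A, ∃ r : List Λ → Ordinal.{0}, (∀ l, r l < η) ∧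
      ∀ l x, l ++ [x] ∈ T a → r (l ++ [x]) < r l := by
  let _ := TopologicalSpace.upgradeIsCompletelyMetrizable P
  rcases A.eq_empty_or_nonempty with rfl | ⟨a0, ha0⟩
  · obtain ⟨η, h, _⟩ := countable_rank_bound (β := Empty) (fun x => x.elim) (fun x => x.elim)
    exact ⟨η, h, fun a ha => ha.elim⟩
  have : Nonempty P := ⟨a0⟩
  let d := TopologicalSpace.denseSeq P
  let S : Set (List (ℕ × Λ)) := {t | ∃ a ∈ A, t.map Prod.snd ∈ T a ∧
    ∀ j (h : j < t.length), dist (d t[j].1) a ≤ (1/2 : ℝ) ^ j}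
  have hS : IsTree S := by
    rintro s t hst ⟨a, ha, h1, h2⟩
    refine ⟨a, ha, hT a ha _ _ (hst.map _) h1, fun j hj => ?_⟩
    have hj' : j < t.length := hj.trans_le hst.length_le
    rw [hst.getElem hj]
    exact h2 j hj'
  have hSw : ¬ TreeIllFounded S := by
    rintro ⟨τ, hτ⟩
    have h0 := fun n => hτ (n+1)
    choose a ha h1 h2 using h0
    have h3 : ∀ n j, j ≤ n → dist (d (τ j).1) (a n) ≤ (1/2 : ℝ)^j := by
      intro n j hj
      have := h2 n j (by simp; omega)
      simpa only [List.getElem_ofFn] using this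
    have hc : CauchySeq a := by
      refine cauchySeq_of_le_geometric (1/2) 2 (by norm_num) fun n => ?_
      have e1 := h3 n n le_rfl
      have e2 := h3 (n+1) n (by omega)
      have := dist_triangle_left (a n) (a (n+1)) (d (τ n).1)
      linarith
    obtain ⟨p, hp⟩ := cauchySeq_tendsto_of_complete hc
    refine H p a ha hp (fun i => (τ i).2) fun n => ?_
    refine hT _ (ha n) _ _ ?_ (h1 n)
    rw [ofFn_succ_snoc, List.map_append, List.map_ofFn]
    exact List.prefix_append _ _
  have hwf : IsWellFounded _ (treeRel S) := ⟨treeRel_wf S hS hSw⟩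
  obtain ⟨η, hη, hlt⟩ := countable_rank_bound (IsWellFounded.rank (treeRel S))
    (rank_lt_omega1 (treeRel S))
  refine ⟨η, hη, fun a ha => ?_⟩
  have hcj : ∀ j : ℕ, ∃ c, dist (d c) a ≤ (1/2 : ℝ)^j := by
    intro j
    obtain ⟨c, hc⟩ := (TopologicalSpace.denseRange_denseSeq P).exists_dist_lt a
      (ε := (1/2 : ℝ)^j) (by positivity)
    exact ⟨c, by rw [dist_comm]; exact hc.le⟩
  choose c hc using hcj
  refine ⟨fun l => IsWellFounded.rank (treeRel S) (l.mapIdx fun j x => (c j, x)),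
    fun l => hlt _, fun l x hlx => ?_⟩
  apply IsWellFounded.rank_lt_of_rel
  refine ⟨(c l.length, x), by simp, a, ha, ?_, ?_⟩
  · have : (List.map Prod.snd (List.mapIdx (fun j x => (c j, x)) (l ++ [x]))) = l ++ [x] := by
      apply List.ext_getElem
      · simp
      · intro i h1 h2
        simp only [List.getElem_map, List.getElem_mapIdx]
    rw [this]; exact hlx
  · intro j hj
    simp only [List.getElem_mapIdx]
    exact hc j

open Filter Topology MeasureTheory

/-! ## Basic Banach space lemmas -/

theorem sum_trunc {Z : Type*} [AddCommGroup Z] [Module ℝ Z] {m n : ℕ} (hm : m ≤ n)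
    {a : ℕ → ℝ} {z : ℕ → Z} :
    ∑ i ∈ Finset.range n, (if i < m then a i else 0) • z i = ∑ i ∈ Finset.range m, a i • z i := by
  rw [← Finset.sum_subset (Finset.range_mono hm)]
  · apply Finset.sum_congr rfl
    intro j hj
    rw [if_pos (Finset.mem_range.1 hj)]
  · intro j _ hj
    rw [if_neg (by simpa using hj), zero_smul]

theorem basis_const {E : Type*} [NormedAddCommGroup E] [NormedSpace ℝ E] [CompleteSpace E]
    (x : ℕ → E) (hx : IsSchauderBasis x) (hn : ∀ n, ‖x n‖ = 1) :
    ∃ b : ℝ, 0 < b ∧ ∀ (n : ℕ) (a : ℕ → ℝ), ∀ i < n,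
      |a i| ≤ b * ‖∑ j ∈ Finset.range n, a j • x j‖ := by
  let V : Submodule ℝ C(OnePoint ℕ, E) :=
    { carrier := {F | F ((0:ℕ) : OnePoint ℕ) = 0 ∧ ∀ m : ℕ,
        F ((m+1 : ℕ) : OnePoint ℕ) - F ((m : ℕ) : OnePoint ℕ) ∈ Submodule.span ℝ {x m}}
      add_mem' := by
        rintro F G ⟨h1, h2⟩ ⟨h3, h4⟩
        refine ⟨by simp [h1, h3], fun m => ?_⟩
        have := Submodule.add_mem _ (h2 m) (h4 m)
        convert this using 1
        simp only [ContinuousMap.add_apply]; abel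
      zero_mem' := by
        refine ⟨by simp, fun m => by simp⟩
      smul_mem' := by
        rintro c F ⟨h1, h2⟩
        refine ⟨by simp [h1], fun m => ?_⟩
        have := Submodule.smul_mem _ c (h2 m)
        convert this using 1
        simp only [ContinuousMap.smul_apply, smul_sub] }
  have hVc : IsClosed (V : Set C(OnePoint ℕ, E)) := by
    have : (V : Set C(OnePoint ℕ, E)) = {F | F ((0:ℕ) : OnePoint ℕ) = 0} ∩ ⋂ m : ℕ,
        {F | F ((m+1 : ℕ) : OnePoint ℕ) - F ((m : ℕ) : OnePoint ℕ) ∈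
          (Submodule.span ℝ {x m} : Set E)} := by
      ext F
      simp only [Set.mem_inter_iff, Set.mem_iInter]
      rfl
    rw [this]
    refine IsClosed.inter ?_ (isClosed_iInter fun m => ?_)
    · exact isClosed_eq (continuous_eval_const _) continuous_const
    · exact IsClosed.preimage ((continuous_eval_const _).sub
        (continuous_eval_const _)) (Submodule.closed_of_finiteDimensional _)
  have : CompleteSpace V := hVc.completeSpace_coe
  let L : V →L[ℝ] E := (ContinuousMap.evalCLM ℝ (OnePoint.infty : OnePoint ℕ)).comp V.subtypeL
  have hL : Function.Surjective L := by
    intro y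
    obtain ⟨a, ha, -⟩ := hx y
    refine ⟨⟨OnePoint.continuousMapMkNat _ y ha, ?_, fun m => ?_⟩, ?_⟩
    · show (∑ n ∈ Finset.range 0, a n • x n) = 0
      simp
    · show (∑ n ∈ Finset.range (m+1), a n • x n) - (∑ n ∈ Finset.range m, a n • x n) ∈ _
      rw [Finset.sum_range_succ, add_sub_cancel_left]
      exact Submodule.smul_mem _ _ (Submodule.mem_span_singleton_self _)
    · rfl
  obtain ⟨C, hC, hpre⟩ := L.exists_preimage_norm_le hL
  refine ⟨2 * C, by positivity, fun n a i hi => ?_⟩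
  obtain ⟨F, hF, hFn⟩ := hpre (∑ j ∈ Finset.range n, a j • x j)
  have h2 := F.2.2
  simp only [Submodule.mem_span_singleton] at h2
  choose c hc using h2
  have hFc : ∀ m : ℕ, F.1 (m : OnePoint ℕ) = ∑ j ∈ Finset.range m, c j • x j := by
    intro m
    induction m with
    | zero => rw [F.2.1]; simp
    | succ m ih => rw [Finset.sum_range_succ, ← ih, hc]; abel
  have hlim : Tendsto (fun m => ∑ j ∈ Finset.range m, c j • x j) atTop
      (𝓝 (∑ j ∈ Finset.range n, a j • x j)) := by
    have h := (OnePoint.continuous_iff_from_nat F.1).1 F.1.continuous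
    simp only [hFc] at h
    have e : F.1 OnePoint.infty = ∑ j ∈ Finset.range n, a j • x j := hF
    rwa [e] at h
  have hlim2 : Tendsto (fun m => ∑ j ∈ Finset.range m, (if j < n then a j else 0) • x j) atTop
      (𝓝 (∑ j ∈ Finset.range n, a j • x j)) := by
    apply tendsto_const_nhds.congr'
    filter_upwards [eventually_ge_atTop n] with m hm
    exact (sum_trunc hm).symm
  have hca := (hx _).unique hlim hlim2
  have hci : c i = a i := by
    rw [hca]; simp [hi]
  have hd := hc i
  have h3 : |a i| = ‖F.1 ((i+1 : ℕ) : OnePoint ℕ) - F.1 ((i : ℕ) : OnePoint ℕ)‖ := by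
    rw [← hd, norm_smul, hn, mul_one, hci, Real.norm_eq_abs]
  rw [h3]
  have h4 := norm_sub_le (F.1 ((i+1 : ℕ) : OnePoint ℕ)) (F.1 ((i : ℕ) : OnePoint ℕ))
  have h5 := F.1.norm_coe_le_norm ((i+1 : ℕ) : OnePoint ℕ)
  have h6 := F.1.norm_coe_le_norm ((i : ℕ) : OnePoint ℕ)
  have h7 : ‖F.1‖ = ‖F‖ := rfl
  linarith

/-- `(y_i)_{i<n}` is `δ`-equivalent to `(e_i)_{i<n}`. -/
def EqU {W Y : Type*} [SeminormedAddCommGroup W] [NormedSpace ℝ W]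
    [SeminormedAddCommGroup Y] [NormedSpace ℝ Y] (e : ℕ → W) (δ : ℝ) (n : ℕ) (y : ℕ → Y) : Prop :=
  ∀ a : ℕ → ℝ, δ * ‖∑ i ∈ Finset.range n, a i • e i‖ ≤ ‖∑ i ∈ Finset.range n, a i • y i‖ ∧
    ‖∑ i ∈ Finset.range n, a i • y i‖ ≤ δ⁻¹ * ‖∑ i ∈ Finset.range n, a i • e i‖

section
variable {W Y : Type*} [SeminormedAddCommGroup W] [NormedSpace ℝ W]
    [SeminormedAddCommGroup Y] [NormedSpace ℝ Y]

theorem mem_bt (e : ℕ → W) (δ : ℝ) (l : List Y) :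
    l ∈ bourgainTree e δ Y ↔ EqU e δ l.length (fun i => l.getD i 0) := Iff.rfl

theorem EqU.congr {e : ℕ → W} {δ : ℝ} {n : ℕ} {y z : ℕ → Y} (h : EqU e δ n y)
    (hyz : ∀ i < n, y i = z i) : EqU e δ n z := by
  intro a
  have : ∑ i ∈ Finset.range n, a i • z i = ∑ i ∈ Finset.range n, a i • y i :=
    Finset.sum_congr rfl fun i hi => by rw [hyz i (Finset.mem_range.1 hi)]
  rw [this]; exact h a

theorem EqU.mono_n {e : ℕ → W} {δ : ℝ} {n m : ℕ} {y : ℕ → Y} (h : EqU e δ n y)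
    (hm : m ≤ n) : EqU e δ m y := by
  intro a
  have := h (fun i => if i < m then a i else 0)
  rwa [sum_trunc hm, sum_trunc hm] at this

theorem EqU.mono_δ {e : ℕ → W} {δ δ' : ℝ} {n : ℕ} {y : ℕ → Y} (h : EqU e δ n y)
    (hδ' : 0 < δ') (hδ : δ' ≤ δ) : EqU e δ' n y := by
  intro a
  have h1 := h a
  have h0 := norm_nonneg (∑ i ∈ Finset.range n, a i • e i)
  refine ⟨(mul_le_mul_of_nonneg_right hδ h0).trans h1.1, h1.2.trans ?_⟩
  exact mul_le_mul_of_nonneg_right (inv_anti₀ hδ' hδ) h0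

theorem bt_isTree (e : ℕ → W) (δ : ℝ) : IsTree (bourgainTree e δ Y) := by
  intro s t hst ht
  rw [mem_bt] at *
  refine (ht.mono_n hst.length_le).congr fun i hi => ?_
  have hi' : i < t.length := hi.trans_le hst.length_le
  rw [List.getD_eq_getElem _ _ hi, List.getD_eq_getElem _ _ hi', hst.getElem hi]

theorem ofFn_mem_bt (e : ℕ → W) (δ : ℝ) (n : ℕ) (y : ℕ → Y) :
    (List.ofFn fun i : Fin n => y i) ∈ bourgainTree e δ Y ↔ EqU e δ n y := by
  rw [mem_bt, List.length_ofFn]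
  constructor
  · intro h
    refine h.congr fun i hi => ?_
    rw [List.getD_eq_getElem _ _ (by simpa using hi), List.getElem_ofFn]
  · intro h
    refine h.congr fun i hi => ?_
    rw [List.getD_eq_getElem _ _ (by simpa using hi), List.getElem_ofFn]

theorem EqU.map {Z : Type*} [SeminormedAddCommGroup Z] [NormedSpace ℝ Z] {e : ℕ → W} {δ : ℝ} {n : ℕ}
    {y : ℕ → Y} (f : Y →ₗᵢ[ℝ] Z) : EqU e δ n (fun i => f (y i)) ↔ EqU e δ n y := by
  unfold EqU
  apply forall_congr'
  intro a
  have : ∑ i ∈ Finset.range n, a i • f (y i) = f (∑ i ∈ Finset.range n, a i • y i) := by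
    rw [map_sum]; simp
  rw [this, f.norm_map]

theorem perturb {e : ℕ → W} {b : ℝ} (hb : 0 < b)
    (he : ∀ (n : ℕ) (a : ℕ → ℝ), ∀ i < n, |a i| ≤ b * ‖∑ j ∈ Finset.range n, a j • e j‖)
    {δ : ℝ} (hδ : 0 < δ) (hδ1 : δ ≤ 1) {n : ℕ} {y z : ℕ → Y} (h : EqU e δ n y)
    (hz : ∀ i < n, ‖y i - z i‖ ≤ δ / (4 * b) * (1/2)^i) : EqU e (δ/2) n z := by
  intro a
  obtain ⟨h1, h2⟩ := h a
  set S := ‖∑ i ∈ Finset.range n, a i • e i‖ with hS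
  have hS0 : 0 ≤ S := norm_nonneg _
  have hdiff : ‖∑ i ∈ Finset.range n, a i • y i - ∑ i ∈ Finset.range n, a i • z i‖ ≤ δ/2 * S := by
    rw [← Finset.sum_sub_distrib]
    calc ‖∑ i ∈ Finset.range n, (a i • y i - a i • z i)‖
        ≤ ∑ i ∈ Finset.range n, (δ / 4 * S) * (1/2)^i := by
          apply norm_sum_le_of_le
          intro i hi
          have hi := Finset.mem_range.1 hi
          rw [← smul_sub, norm_smul, Real.norm_eq_abs]
          calc |a i| * ‖y i - z i‖ ≤ (b * S) * (δ / (4 * b) * (1/2)^i) := by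
                gcongr
                · exact he n a i hi
                · exact hz i hi
            _ = (δ / 4 * S) * (1/2)^i := by field_simp
      _ = (δ / 4 * S) * ∑ i ∈ Finset.range n, (1/2 : ℝ)^i := by rw [Finset.mul_sum]
      _ ≤ (δ / 4 * S) * 2 := by
          gcongr
          exact sum_geometric_two_le n
      _ = δ/2 * S := by ring
  have h3 := norm_sub_norm_le (∑ i ∈ Finset.range n, a i • y i) (∑ i ∈ Finset.range n, a i • z i)
  have h4 := norm_sub_norm_le (∑ i ∈ Finset.range n, a i • z i) (∑ i ∈ Finset.range n, a i • y i)
  rw [norm_sub_rev] at h4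
  have h5 : (δ/2)⁻¹ = 2 * δ⁻¹ := by rw [inv_div]; ring
  have h6 : 1 ≤ δ⁻¹ := (one_le_inv₀ hδ).2 hδ1
  constructor
  · linarith
  · rw [h5]
    have : δ/2 * S ≤ δ⁻¹ * S := by gcongr; linarith
    linarith
end

theorem extend_clm {ι X F : Type*} [NormedAddCommGroup X] [NormedSpace ℝ X]
    [NormedAddCommGroup F] [NormedSpace ℝ F] [CompleteSpace F] (x : ι → X) (y : ι → F)
    (hd : Dense (Submodule.span ℝ (Set.range x) : Set X)) (M : ℝ)
    (h : ∀ c : ι →₀ ℝ, ‖Finsupp.linearCombination ℝ y c‖ ≤ M * ‖Finsupp.linearCombination ℝ x c‖) :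
    ∃ T : X →L[ℝ] F, ∀ i, T (x i) = y i := by
  have hd' : DenseRange (Finsupp.linearCombination ℝ x) := by
    have : Set.range (Finsupp.linearCombination ℝ x) = (Submodule.span ℝ (Set.range x) : Set X) := by
      rw [← Finsupp.range_linearCombination]; rfl
    unfold DenseRange
    rw [this]; exact hd
  refine ⟨(Finsupp.linearCombination ℝ y).extendOfNorm (Finsupp.linearCombination ℝ x), fun i => ?_⟩
  have := LinearMap.extendOfNorm_eq hd' ⟨M, h⟩ (Finsupp.single i 1)
  simpa using this

theorem lincomb_clm {ι X F : Type*} [NormedAddCommGroup X] [NormedSpace ℝ X]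
    [NormedAddCommGroup F] [NormedSpace ℝ F] (T : X →L[ℝ] F) (x : ι → X) (c : ι →₀ ℝ) :
    T (Finsupp.linearCombination ℝ x c) = Finsupp.linearCombination ℝ (fun i => T (x i)) c := by
  simp [Finsupp.linearCombination_apply, Finsupp.sum, map_sum]

/-- rational linear combinations -/
noncomputable def ev {ι X : Type*} [AddCommGroup X] [Module ℝ X] (z : ι → X) (c : ι →₀ ℚ) : X :=
  c.sum fun i q => (q : ℝ) • z i

section
variable {ι X : Type*} [AddCommGroup X] [Module ℝ X] (z : ι → X)
theorem ev_zero : ev z 0 = 0 := by simp [ev]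
theorem ev_add (c d : ι →₀ ℚ) : ev z (c + d) = ev z c + ev z d := by
  classical
  unfold ev
  rw [Finsupp.sum_add_index']
  · simp
  · intro i a b; push_cast; rw [add_smul]
theorem ev_smul (q : ℚ) (c : ι →₀ ℚ) : ev z (q • c) = (q : ℝ) • ev z c := by
  unfold ev
  rw [Finsupp.sum_smul_index' (by simp), Finsupp.smul_sum]
  simp [mul_smul]
theorem ev_neg (c : ι →₀ ℚ) : ev z (-c) = - ev z c := by
  have := ev_smul z (-1) c
  simpa using this
theorem ev_sub (c d : ι →₀ ℚ) : ev z (c - d) = ev z c - ev z d := by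
  rw [sub_eq_add_neg, ev_add, ev_neg, sub_eq_add_neg]
theorem ev_single (i : ι) (q : ℚ) : ev z (Finsupp.single i q) = (q : ℝ) • z i := by
  simp [ev]
theorem ev_mem_span (c : ι →₀ ℚ) : ev z c ∈ Submodule.span ℝ (Set.range z) := by
  unfold ev
  exact Submodule.sum_mem _ fun i _ => Submodule.smul_mem _ _ (Submodule.subset_span ⟨i, rfl⟩)
theorem ev_map {F : Type*} [AddCommGroup F] [Module ℝ F] (T : X →ₗ[ℝ] F) (c : ι →₀ ℚ) :
    T (ev z c) = ev (fun i => T (z i)) c := by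
  simp [ev, Finsupp.sum, map_sum]
theorem ev_mapDomain {κ : Type*} (g : κ → ι) (c : κ →₀ ℚ) :
    ev z (c.mapDomain g) = ev (fun k => z (g k)) c := by
  unfold ev
  rw [Finsupp.sum_mapDomain_index] <;> simp [add_smul]
end

theorem span_le_closure_ev {ι X : Type*} [SeminormedAddCommGroup X] [NormedSpace ℝ X] (z : ι → X) :
    (Submodule.span ℝ (Set.range z) : Set X) ⊆ closure (Set.range (ev z)) := by
  intro y hy
  induction hy using Submodule.span_induction with
  | mem x hx =>
    obtain ⟨i, rfl⟩ := hx
    exact subset_closure ⟨Finsupp.single i 1, by simp [ev_single]⟩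
  | zero => exact subset_closure ⟨0, ev_zero z⟩
  | add x y _ _ hx hy =>
    refine map_mem_closure₂ continuous_add hx hy ?_
    rintro _ ⟨c, rfl⟩ _ ⟨d, rfl⟩
    exact ⟨c + d, ev_add z c d⟩
  | smul a x _ hx =>
    refine map_mem_closure₂ (s := Set.range ((↑) : ℚ → ℝ)) continuous_smul
      (Rat.denseRange_cast a) hx ?_
    rintro _ ⟨q, rfl⟩ _ ⟨d, rfl⟩
    exact ⟨q • d, ev_smul z q d⟩

theorem closure_ev_eq {ι X : Type*} [SeminormedAddCommGroup X] [NormedSpace ℝ X] (z : ι → X) :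
    closure (Set.range (ev z)) = ((Submodule.span ℝ (Set.range z)).topologicalClosure : Set X) := by
  apply Set.Subset.antisymm
  · apply closure_mono
    rintro _ ⟨c, rfl⟩
    exact ev_mem_span z c
  · exact closure_minimal (span_le_closure_ev z) isClosed_closure

open Filter Topology MeasureTheory

/-! ## Core, part A -/

/-- coefficients vectors living on `inl` and `inr i`, `i < N n` -/
def InL (N : ℕ → ℕ) (n : ℕ) (c : (ℕ ⊕ ℕ) →₀ ℚ) : Prop := ∀ i, N n ≤ i → c (Sum.inr i) = 0

def SkolemP {E : Type*} [SeminormedAddCommGroup E] [NormedSpace ℝ E] (z : ℕ ⊕ ℕ → E) (N : ℕ → ℕ)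
    (ω : ℕ × ℕ × ((ℕ ⊕ ℕ) →₀ ℚ) → ((ℕ ⊕ ℕ) →₀ ℚ)) : Prop :=
  ∀ n q y, InL N n (ω (n, q, y)) ∧ ∀ w, InL N n w →
    ‖ev z w‖ + 1/4 * (‖ev z (y - ω (n, q, y))‖ - (1/2 : ℝ)^q) ≤ max ‖ev z (w + y)‖ ‖ev z (w - y)‖

theorem exists_InL (N : ℕ → ℕ) (hN : ∀ n, n ≤ N n) (c : (ℕ ⊕ ℕ) →₀ ℚ) : ∃ n, InL N n c := by
  classical
  obtain ⟨B, hB⟩ := (c.support.image (fun s => Sum.elim (fun _ => 0) (fun i => i) s)).bddAbove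
  refine ⟨B + 1, fun i hi => ?_⟩
  by_contra h
  have h1 : i ≤ B := by
    apply hB
    simp only [Finset.coe_image, Set.mem_image, Finset.mem_coe, Finsupp.mem_support_iff]
    exact ⟨Sum.inr i, h, rfl⟩
  have := hN (B+1)
  omega

theorem claimC {E : Type*} [NormedAddCommGroup E] [NormedSpace ℝ E] (z : ℕ ⊕ ℕ → E) (N : ℕ → ℕ)
    (ω : ℕ × ℕ × ((ℕ ⊕ ℕ) →₀ ℚ) → ((ℕ ⊕ ℕ) →₀ ℚ)) (hω : SkolemP z N ω) (hN : ∀ n, n ≤ N n)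
    (Xp : Submodule ℝ E) (hXp : IsClosed (Xp : Set E)) (hXz : ∀ j, z (Sum.inl j) ∈ Xp)
    (u : ℕ → E) (hu : ∀ k, u k ∈ closure (Set.range (ev z))) (M : ℝ)
    (hM : ∀ (F : Finset ℕ) (s : ℕ → ℝ), (∀ k, |s k| ≤ 1) → ‖∑ k ∈ F, s k • u k‖ ≤ M)
    (ε : ℝ) (hε : 0 < ε) : ∃ k, ∃ x ∈ Xp, ‖u k - x‖ < ε := by
  classical
  by_contra hcon
  push Not at hcon
  -- approximations
  have hap : ∀ k : ℕ, ∃ y, ‖u k - ev z y‖ ≤ ε/16 * (1/2)^k := by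
    intro k
    obtain ⟨_, ⟨y, rfl⟩, hy⟩ := Metric.mem_closure_iff.1 (hu k) (ε/16 * (1/2)^k) (by positivity)
    exact ⟨y, by rw [← dist_eq_norm]; exact hy.le⟩
  choose y hy using hap
  have hy8 : ∀ k, ‖u k - ev z (y k)‖ ≤ ε/16 := fun k => (hy k).trans (by
    have : (1/2 : ℝ)^k ≤ 1 := pow_le_one₀ (by norm_num) (by norm_num)
    nlinarith)
  have hMy : ∀ (F : Finset ℕ) (s : ℕ → ℝ), (∀ k, |s k| ≤ 1) →
      ‖∑ k ∈ F, s k • ev z (y k)‖ ≤ M + ε/8 := by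
    intro F s hs
    have h1 : ∑ k ∈ F, s k • ev z (y k) = ∑ k ∈ F, s k • u k - ∑ k ∈ F, s k • (u k - ev z (y k)) := by
      simp [smul_sub, Finset.sum_sub_distrib]
    have h2 : ‖∑ k ∈ F, s k • (u k - ev z (y k))‖ ≤ ε/8 := by
      calc _ ≤ ∑ k ∈ F, ε/16 * (1/2:ℝ)^k := by
            apply norm_sum_le_of_le
            intro k _
            rw [norm_smul, Real.norm_eq_abs]
            calc |s k| * ‖u k - ev z (y k)‖ ≤ 1 * (ε/16 * (1/2)^k) := by
                  gcongr
                  · exact hs k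
                  · exact hy k
              _ = _ := one_mul _
        _ = ε/16 * ∑ k ∈ F, (1/2:ℝ)^k := by rw [Finset.mul_sum]
        _ ≤ ε/16 * 2 := by
            gcongr
            have := summable_geometric_two.sum_le_tsum F (fun _ _ => by positivity)
            rwa [tsum_geometric_two] at this
        _ = ε/8 := by ring
    rw [h1]
    exact (norm_sub_le _ _).trans (add_le_add (hM F s hs) h2)
  obtain ⟨q, hq⟩ : ∃ q : ℕ, (1/2 : ℝ)^q < ε/8 := exists_pow_lt_of_lt_one (by positivity) (by norm_num)
  by_cases hA : ∀ n K, ∃ k ≥ K, ε/4 ≤ ‖ev z (y k - ω (n, q, y k))‖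
  · -- growth
    have grow : ∀ j : ℕ, ∃ (K : ℕ) (s : ℕ → ℚ), (∀ k, |s k| ≤ 1) ∧
        j * (ε/32) ≤ ‖ev z (∑ k ∈ Finset.range K, s k • y k)‖ := by
      intro j
      induction j with
      | zero => exact ⟨0, 0, by simp, by simp⟩
      | succ j ih =>
        obtain ⟨K, s, hs, hj⟩ := ih
        set w := ∑ k ∈ Finset.range K, s k • y k with hw
        obtain ⟨n, hn⟩ := exists_InL N hN w
        obtain ⟨k, hk, hk'⟩ := hA n K
        have hmx := (hω n q (y k)).2 w hn
        have ext : ∀ t : ℚ, |t| ≤ 1 → ∃ (K' : ℕ) (s' : ℕ → ℚ), (∀ k, |s' k| ≤ 1) ∧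
            ∑ k ∈ Finset.range K', s' k • y k = w + t • y k := by
          intro t ht
          refine ⟨k+1, fun i => if i < K then s i else if i = k then t else 0, fun i => ?_, ?_⟩
          · dsimp only
            split_ifs
            · exact hs i
            · exact ht
            · simp
          · dsimp only
            rw [Finset.sum_range_succ, if_neg (by omega), if_pos rfl]
            congr 1
            rw [hw, ← Finset.sum_subset (Finset.range_mono hk)]
            · apply Finset.sum_congr rfl
              intro i hi
              rw [if_pos (Finset.mem_range.1 hi)]
            · intro i hi hi'
              simp only [Finset.mem_range] at hi hi'
              rw [if_neg hi', if_neg (by omega), zero_smul]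
        have hgain : (j+1) * (ε/32) ≤ max ‖ev z (w + y k)‖ ‖ev z (w - y k)‖ := by
          refine le_trans ?_ hmx
          nlinarith
        rcases le_max_iff.1 hgain with h | h
        · obtain ⟨K', s', h1, h2⟩ := ext 1 (by simp)
          refine ⟨K', s', h1, ?_⟩
          rw [h2, one_smul]; push_cast; exact h
        · obtain ⟨K', s', h1, h2⟩ := ext (-1) (by simp)
          refine ⟨K', s', h1, ?_⟩
          rw [h2, neg_one_smul, ← sub_eq_add_neg]; push_cast; exact h
    obtain ⟨j, hj⟩ := exists_nat_gt ((M + ε/8) / (ε/32))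
    rw [div_lt_iff₀ (by positivity)] at hj
    obtain ⟨K, s, hs, hb⟩ := grow j
    have h1 : ev z (∑ k ∈ Finset.range K, s k • y k) =
        ∑ k ∈ Finset.range K, ((s k : ℝ)) • ev z (y k) := by
      generalize Finset.range K = F
      induction F using Finset.induction_on with
      | empty => simp [ev_zero]
      | insert a F ha ih => rw [Finset.sum_insert ha, Finset.sum_insert ha, ev_add, ih, ev_smul]
    have h2 := hMy (Finset.range K) (fun k => (s k : ℝ)) (fun k => by exact_mod_cast hs k)
    rw [h1] at hb
    linarith
  · push Not at hA
    obtain ⟨n, K, hK⟩ := hA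
    have : IsClosed (Xp : Set E) := hXp
    let G : Submodule ℝ (E ⧸ Xp) :=
      Submodule.span ℝ ((fun i => Xp.mkQ (z (Sum.inr i))) '' (Set.Iio (N n)))
    have hG : FiniteDimensional ℝ G := FiniteDimensional.span_of_finite ℝ ((Set.finite_Iio _).image _)
    have hmem : ∀ c, InL N n c → Xp.mkQ (ev z c) ∈ G := by
      intro c hc
      unfold ev Finsupp.sum
      rw [map_sum]
      apply Submodule.sum_mem
      intro i _
      rw [map_smul]
      apply Submodule.smul_mem
      · rcases i with j | i
        · have : Xp.mkQ (z (Sum.inl j)) = 0 := by simpa using hXz j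
          rw [this]; exact Submodule.zero_mem _
        · apply Submodule.subset_span
          refine ⟨i, ?_, rfl⟩
          by_contra hi
          have := hc i (by simpa using hi)
          rw [Finsupp.mem_support_iff] at *
          contradiction
    have hmk : ∀ x : E, ‖Xp.mkQ x‖ ≤ ‖x‖ := fun x => Submodule.Quotient.norm_mk_le Xp x
    have hbd : ∀ k, ‖ev z (y k)‖ ≤ M + ε/8 := by
      intro k
      have := hMy {k} (fun _ => 1) (by simp)
      simpa using this
    let g : ℕ → G := fun j => ⟨Xp.mkQ (ev z (ω (n, q, y (K + j)))), hmem _ (hω n q _).1⟩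
    have hclose : ∀ j, ‖ev z (y (K+j)) - ev z (ω (n, q, y (K + j)))‖ < ε/4 := by
      intro j
      rw [← ev_sub]
      exact hK (K+j) (by omega)
    have hgb : ∀ j, g j ∈ Metric.closedBall (0 : G) (M + ε/8 + ε/4) := by
      intro j
      rw [mem_closedBall_zero_iff]
      refine (hmk _).trans ?_
      have h1 := hclose j
      have h2 := norm_sub_norm_le (ev z (ω (n, q, y (K + j)))) (ev z (y (K+j)))
      rw [norm_sub_rev] at h2
      linarith [hbd (K+j)]
    have : ProperSpace G := FiniteDimensional.proper_real G
    obtain ⟨c, -, φ, hφ, hlim⟩ := tendsto_subseq_of_bounded Metric.isBounded_closedBall hgb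
    obtain ⟨J, hJ⟩ := (Metric.tendsto_atTop.1 hlim) (ε/16) (by positivity)
    have hnear : ∀ j ≥ J, ‖Xp.mkQ (u (K + φ j)) - (c : E ⧸ Xp)‖ ≤ 7/16 * ε := by
      intro j hj
      have h1 := hJ j hj
      rw [Subtype.dist_eq, dist_eq_norm] at h1
      have h2 : ‖Xp.mkQ (u (K + φ j)) - Xp.mkQ (ev z (ω (n, q, y (K + φ j))))‖ ≤ ε/16 + ε/4 := by
        rw [← map_sub]
        refine (hmk _).trans ?_
        have := norm_sub_le_norm_sub_add_norm_sub (u (K + φ j)) (ev z (y (K + φ j)))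
          (ev z (ω (n, q, y (K + φ j))))
        linarith [hy8 (K + φ j), hclose (φ j)]
      have h3 := norm_sub_le_norm_sub_add_norm_sub (Xp.mkQ (u (K + φ j)))
        (Xp.mkQ (ev z (ω (n, q, y (K + φ j))))) (c : E ⧸ Xp)
      have h4 : ‖Xp.mkQ (ev z (ω (n, q, y (K + φ j)))) - (c : E ⧸ Xp)‖ < ε/16 := h1
      linarith
    have hbig : ∀ k, ε ≤ ‖Xp.mkQ (u k)‖ := by
      intro k
      by_contra hlt
      push Not at hlt
      obtain ⟨m, hm, hm'⟩ := Submodule.Quotient.norm_mk_lt (S := Xp) (Xp.mkQ (u k)) (ε := ε - ‖Xp.mkQ (u k)‖)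
        (by linarith)
      have hd : u k - m ∈ Xp := by
        rw [← Submodule.Quotient.eq]; exact hm.symm
      have := hcon k _ hd
      rw [sub_sub_cancel] at this
      linarith
    have hc : 9/16 * ε ≤ ‖(c : E ⧸ Xp)‖ := by
      have h1 := hnear J le_rfl
      have h2 := norm_sub_norm_le (Xp.mkQ (u (K + φ J))) (c : E ⧸ Xp)
      linarith [hbig (K + φ J)]
    have hsum : ∀ m : ℕ, m * (ε/8) ≤ M := by
      intro m
      have hinj : Set.InjOn (fun j => K + φ (J + j)) (Finset.range m : Set ℕ) := by
        intro a _ b _ hab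
        have : φ (J+a) = φ (J+b) := by simpa using hab
        have := hφ.injective this
        omega
      have h1 := hM ((Finset.range m).image fun j => K + φ (J + j)) (fun _ => 1) (by simp)
      rw [Finset.sum_image hinj] at h1
      simp only [one_smul] at h1
      have h2 := (hmk (∑ j ∈ Finset.range m, u (K + φ (J + j)))).trans h1
      rw [map_sum] at h2
      have h3 : ‖(m : ℝ) • (c : E ⧸ Xp) - ∑ j ∈ Finset.range m, Xp.mkQ (u (K + φ (J+j)))‖
          ≤ m * (7/16 * ε) := by
        have : (m : ℝ) • (c : E ⧸ Xp) = ∑ j ∈ Finset.range m, (c : E ⧸ Xp) := by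
          rw [Finset.sum_const, Finset.card_range, Nat.cast_smul_eq_nsmul]
        rw [this, ← Finset.sum_sub_distrib]
        refine (norm_sum_le_of_le _ (fun j _ => ?_)).trans (b := ∑ j ∈ Finset.range m, (7/16 * ε)) ?_
        · rw [norm_sub_rev]; exact hnear (J+j) (by omega)
        · simp
      have h4 := norm_sub_norm_le ((m : ℝ) • (c : E ⧸ Xp)) (∑ j ∈ Finset.range m, Xp.mkQ (u (K + φ (J+j))))
      have h5 : ‖(m : ℝ) • (c : E ⧸ Xp)‖ = m * ‖(c : E ⧸ Xp)‖ := by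
        rw [norm_smul]; simp
      have h6 : (m : ℝ) * (9/16 * ε) ≤ m * ‖(c : E ⧸ Xp)‖ := by gcongr
      linarith
    obtain ⟨m, hm⟩ := exists_nat_gt (M / (ε/8))
    rw [div_lt_iff₀ (by positivity)] at hm
    linarith [hsum m]

open Filter Topology MeasureTheory TopologicalSpace

/-! ## Core, part B: the Cantor scheme -/

/-- reversed initial segment -/
def cnode (t : CantorSet) : ℕ → List Bool
  | 0 => []
  | n+1 => t n :: cnode t n

theorem cnode_length (t : CantorSet) (n : ℕ) : (cnode t n).length = n := by
  induction n with
  | zero => rfl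
  | succ n ih => simp [cnode, ih]

theorem cnode_continuous (n : ℕ) : Continuous[_, ⊥] (fun t : CantorSet => cnode t n) := by
  let _ : TopologicalSpace (List Bool) := ⊥
  have : DiscreteTopology (List Bool) := ⟨rfl⟩
  induction n with
  | zero => exact continuous_const
  | succ n ih =>
    have h1 : Continuous (fun t : CantorSet => (t n, cnode t n)) := (continuous_apply n).prodMk ih
    have h2 : Continuous (fun p : Bool × List Bool => p.1 :: p.2) := continuous_of_discreteTopology
    exact h2.comp h1

theorem cnode_eq_iff (s t : CantorSet) (n : ℕ) : cnode s n = cnode t n ↔ ∀ i < n, s i = t i := by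
  induction n with
  | zero => simp [cnode]
  | succ n ih =>
    simp only [cnode, List.cons.injEq, ih]
    constructor
    · rintro ⟨h1, h2⟩ i hi
      rcases Nat.lt_succ_iff_lt_or_eq.1 hi with h | rfl
      · exact h2 i h
      · exact h1
    · intro h
      exact ⟨h n (by omega), fun i hi => h i (by omega)⟩

/-- cylinders -/
def cyl (l : List Bool) : Clopens CantorSet :=
  ⟨{t | cnode t l.length = l}, by
    let _ : TopologicalSpace (List Bool) := ⊥
    have : DiscreteTopology (List Bool) := ⟨rfl⟩
    exact (isClopen_discrete ({l} : Set (List Bool))).preimage (cnode_continuous l.length)⟩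

theorem mem_cyl (l : List Bool) (t : CantorSet) : t ∈ cyl l ↔ cnode t l.length = l := Iff.rfl

open Classical in
/-- indicator functions of clopen sets -/
noncomputable def ind (A : Clopens CantorSet) : CantorC :=
  ⟨fun t => if t ∈ A then 1 else 0, by
    have := A.isClopen.continuous_indicator (f := fun _ : CantorSet => (1:ℝ)) continuous_const
    refine this.congr fun t => ?_
    simp [Set.indicator_apply]⟩

open Classical in
theorem ind_apply (A : Clopens CantorSet) (t : CantorSet) : ind A t = if t ∈ A then 1 else 0 := rfl

theorem ind_pos {A : Clopens CantorSet} {t : CantorSet} (h : t ∈ A) : ind A t = 1 := by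
  simp [ind_apply, h]

theorem ind_neg {A : Clopens CantorSet} {t : CantorSet} (h : t ∉ A) : ind A t = 0 := by
  simp [ind_apply, h]

/-- the point coded by a finite sequence -/
def pt (l : List Bool) : CantorSet := fun i => l.reverse.getD i false

theorem cnode_pt_le (l : List Bool) (n : ℕ) (hn : n ≤ l.length) :
    cnode (pt l) n = l.drop (l.length - n) := by
  induction n with
  | zero => simp [cnode]
  | succ n ih =>
    rw [cnode, ih (by omega)]
    have h1 : l.length - (n+1) < l.length := by omega
    rw [List.drop_eq_getElem_cons h1]
    have h2 : l.length - (n+1) + 1 = l.length - n := by omega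
    rw [h2]
    congr 1
    unfold pt
    rw [List.getD_eq_getElem _ _ (by simpa using hn), List.getElem_reverse]
    congr 1
    omega

theorem pt_mem_cyl (l s : List Bool) : pt l ∈ cyl (true :: s) ↔ (true :: s) <:+ l := by
  rw [mem_cyl]
  by_cases h : (true :: s).length ≤ l.length
  · rw [cnode_pt_le _ _ h, List.suffix_iff_eq_drop, eq_comm]
  · constructor
    · intro h'
      exfalso
      rw [List.length_cons, cnode, List.cons.injEq] at h'
      have : pt l s.length = false := by
        unfold pt
        rw [List.getD_eq_default]
        simp at h ⊢; omega
      rw [this] at h'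
      exact absurd h'.1 (by simp)
    · intro h'
      exact absurd h'.length_le h

theorem pt_cons_false (s : List Bool) : pt (false :: s) = pt s := by
  funext i
  unfold pt
  rw [List.reverse_cons]
  by_cases h : i < s.reverse.length
  · rw [List.getD_append _ _ _ _ h]
  · rw [List.getD_append_right _ _ _ _ (by omega)]
    rw [List.getD_eq_default s.reverse _ (by omega)]
    rcases Nat.eq_zero_or_pos (i - s.reverse.length) with h0 | h0
    · rw [h0]; simp
    · rw [List.getD_eq_default]
      simp at h0 ⊢; omega

theorem pt_cnode (t : CantorSet) (n i : ℕ) (hi : i < n) : pt (cnode t n) i = t i := by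
  have h := cnode_pt_le (cnode t n) n (by rw [cnode_length])
  rw [cnode_length, Nat.sub_self, List.drop_zero, cnode_eq_iff] at h
  exact h i hi

/-- The cylinders span a dense subspace. -/
theorem cyl_dense {F : Type*} [NormedAddCommGroup F] [NormedSpace ℝ F] (T : CantorC →L[ℝ] F)
    (V : Submodule ℝ F) (hV : IsClosed (V : Set F)) (h : ∀ l, T (ind (cyl l)) ∈ V) (f : CantorC) :
    T f ∈ V := by
  classical
  -- uniform continuity
  have huc : ∀ ε > 0, ∃ n, ∀ s t : CantorSet, cnode s n = cnode t n → |f s - f t| < ε := by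
    intro ε hε
    by_contra hcon
    push Not at hcon
    let _ : TopologicalSpace (List Bool) := ⊥
    have : DiscreteTopology (List Bool) := ⟨rfl⟩
    have hcl : ∀ n, IsClosed {p : CantorSet × CantorSet | cnode p.1 n = cnode p.2 n ∧
        ε ≤ |f p.1 - f p.2|} := by
      intro n
      refine IsClosed.inter ?_ ?_
      · exact isClosed_eq ((cnode_continuous n).comp continuous_fst)
          ((cnode_continuous n).comp continuous_snd)
      · exact isClosed_le continuous_const
          (by fun_prop : Continuous fun p : CantorSet × CantorSet => |f p.1 - f p.2|)
    obtain ⟨p, hp⟩ := IsCompact.nonempty_iInter_of_sequence_nonempty_isCompact_isClosed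
      (fun n => {p : CantorSet × CantorSet | cnode p.1 n = cnode p.2 n ∧ ε ≤ |f p.1 - f p.2|})
      (by
        rintro n p ⟨h1, h2⟩
        refine ⟨?_, h2⟩
        rw [cnode_eq_iff] at *
        exact fun i hi => h1 i (by omega))
      (by
        intro n
        obtain ⟨s, t, h1, h2⟩ := hcon n
        exact ⟨(s, t), h1, h2⟩) (hcl 0).isCompact hcl
    rw [Set.mem_iInter] at hp
    have heq : p.1 = p.2 := by
      funext i
      exact (cnode_eq_iff _ _ _).1 (hp (i+1)).1 i (by omega)
    have := (hp 0).2
    rw [heq, sub_self, abs_zero] at this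
    linarith
  have hVc : IsClosed {g : CantorC | T g ∈ V} := hV.preimage T.continuous
  have : f ∈ closure {g : CantorC | T g ∈ V} := by
    rw [Metric.mem_closure_iff]
    intro ε hε
    obtain ⟨n, hn⟩ := huc (ε/2) (by positivity)
    let S : Finset (List Bool) := (List.finite_length_eq Bool n).toFinset
    refine ⟨∑ l ∈ S, f (pt l) • ind (cyl l), ?_, ?_⟩
    · show T (∑ l ∈ S, f (pt l) • ind (cyl l)) ∈ V
      rw [map_sum]
      apply Submodule.sum_mem
      intro l _
      rw [map_smul]
      exact Submodule.smul_mem _ _ (h l)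
    · refine lt_of_le_of_lt ?_ (half_lt_self hε)
      rw [ContinuousMap.dist_le (by positivity)]
      intro t
      have hval : (∑ l ∈ S, f (pt l) • ind (cyl l)) t = f (pt (cnode t n)) := by
        rw [ContinuousMap.sum_apply]
        rw [Finset.sum_eq_single (cnode t n)]
        · rw [ContinuousMap.smul_apply, ind_pos, smul_eq_mul, mul_one]
          rw [mem_cyl, cnode_length]
        · intro l hl hne
          rw [ContinuousMap.smul_apply, ind_neg, smul_zero]
          rw [mem_cyl]
          have : l.length = n := by simpa [S] using hl
          rw [this]
          exact fun h => hne h.symm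
        · intro hnot
          exfalso
          apply hnot
          simp [S, cnode_length]
      rw [hval, Real.dist_eq]
      apply le_of_lt
      apply hn
      rw [cnode_eq_iff]
      intro i hi
      exact (pt_cnode t n i hi).symm
  rw [hVc.closure_eq] at this
  exact this

open Filter Topology MeasureTheory TopologicalSpace

/-! ## Core, part C: fixing the operator -/

theorem exists_disjoint_clopens (B : Clopens CantorSet) (hB : B ≠ ⊥) :
    ∃ A : ℕ → Clopens CantorSet, (∀ k, A k ≤ B ∧ A k ≠ ⊥ ∧ B \ A k ≠ ⊥) ∧
      ∀ j k, j ≠ k → Disjoint (A j : Set CantorSet) (A k) := by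
  have hne : ∃ t, t ∈ B := by
    by_contra h
    push Not at h
    apply hB
    ext t
    simpa using h t
  obtain ⟨t, ht⟩ := hne
  -- a cylinder inside `B`
  have hm : ∃ m, ∀ s, cnode s m = cnode t m → s ∈ B := by
    by_contra hcon
    push Not at hcon
    let _ : TopologicalSpace (List Bool) := ⊥
    have : DiscreteTopology (List Bool) := ⟨rfl⟩
    have hcl : ∀ n, IsClosed {s : CantorSet | cnode s n = cnode t n ∧ s ∉ B} := by
      intro n
      refine IsClosed.inter ?_ ?_
      · exact isClosed_eq (cnode_continuous n) continuous_const
      · exact B.isClopen.compl.isClosed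
    obtain ⟨p, hp⟩ := IsCompact.nonempty_iInter_of_sequence_nonempty_isCompact_isClosed
      (fun n => {s : CantorSet | cnode s n = cnode t n ∧ s ∉ B})
      (by
        rintro n p ⟨h1, h2⟩
        refine ⟨?_, h2⟩
        rw [cnode_eq_iff] at *
        exact fun i hi => h1 i (by omega))
      (by
        intro n
        obtain ⟨s, h1, h2⟩ := hcon n
        exact ⟨s, h1, h2⟩) (hcl 0).isCompact hcl
    rw [Set.mem_iInter] at hp
    have heq : p = t := by
      funext i
      exact (cnode_eq_iff _ _ _).1 (hp (i+1)).1 i (by omega)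
    exact (hp 0).2 (heq ▸ ht)
  obtain ⟨m, hm⟩ := hm
  have hmemA : ∀ k s, s ∈ cyl ((!t (m+k)) :: cnode t (m+k)) ↔
      s (m+k) = (!t (m+k)) ∧ ∀ i < m+k, s i = t i := by
    intro k s
    rw [mem_cyl, List.length_cons, cnode_length, cnode, List.cons.injEq, cnode_eq_iff]
  refine ⟨fun k => cyl ((!t (m+k)) :: cnode t (m+k)), fun k => ⟨?_, ?_, ?_⟩, ?_⟩
  · intro s hs
    have h := (hmemA k s).1 hs
    exact hm s ((cnode_eq_iff _ _ _).2 fun i hi => h.2 i (by omega))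
  · intro h0
    have : Function.update t (m+k) (!t (m+k)) ∈ cyl ((!t (m+k)) :: cnode t (m+k)) := by
      rw [hmemA]
      refine ⟨by simp, fun i hi => ?_⟩
      rw [Function.update_of_ne (by omega)]
    dsimp only at h0
    rw [h0] at this
    exact this
  · intro h0
    dsimp only at h0
    have : t ∈ B \ cyl ((!t (m+k)) :: cnode t (m+k)) := by
      refine ⟨ht, fun h => ?_⟩
      have := ((hmemA k t).1 h).1
      simp at this
    rw [h0] at this
    exact this
  · have key : ∀ j k, j < k → Disjoint ((cyl ((!t (m+j)) :: cnode t (m+j)) : Clopens CantorSet) : Set CantorSet)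
        (cyl ((!t (m+k)) :: cnode t (m+k)) : Clopens CantorSet) := by
      intro j k hjk
      rw [Set.disjoint_left]
      intro s h1 h2
      have h1 := ((hmemA j s).1 h1).1
      have h2 := ((hmemA k s).1 h2).2 (m+j) (by omega)
      rw [h1] at h2
      simp at h2
    intro j k hjk
    rcases lt_or_gt_of_ne hjk with h | h
    · exact key j k h
    · exact (key k j h).symm

theorem norm_sum_ind_le (A : ℕ → Clopens CantorSet)
    (hA : ∀ j k, j ≠ k → Disjoint (A j : Set CantorSet) (A k)) (F : Finset ℕ) (s : ℕ → ℝ)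
    (hs : ∀ k, |s k| ≤ 1) : ‖∑ k ∈ F, s k • ind (A k)‖ ≤ 1 := by
  rw [ContinuousMap.norm_le _ zero_le_one]
  intro t
  rw [ContinuousMap.sum_apply]
  by_cases h : ∃ k ∈ F, t ∈ A k
  · obtain ⟨k, hk, ht⟩ := h
    rw [Finset.sum_eq_single k]
    · rw [ContinuousMap.smul_apply, ind_pos ht]
      simpa using hs k
    · intro j _ hj
      rw [ContinuousMap.smul_apply, ind_neg, smul_zero]
      intro hj'
      exact Set.disjoint_left.1 (hA j k hj) hj' ht
    · intro h; exact absurd hk h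
  · push Not at h
    rw [Finset.sum_eq_zero]
    · simp
    · intro k hk
      rw [ContinuousMap.smul_apply, ind_neg (h k hk), smul_zero]

theorem fix_operator {F : Type*} [NormedAddCommGroup F] [NormedSpace ℝ F] [CompleteSpace F]
    (T : CantorC →L[ℝ] F) (c : ℝ) (hc : 0 < c) (hT : ∀ f, c * ‖f‖ ≤ ‖T f‖)
    (V : Submodule ℝ F) (hV : IsClosed (V : Set F))
    (hsplit : ∀ B : Clopens CantorSet, B ≠ ⊥ → ∀ ε > 0, ∃ A, (A ≤ B ∧ A ≠ ⊥ ∧ B \ A ≠ ⊥) ∧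
      ∃ x ∈ V, ‖T (ind A) - x‖ < ε) :
    ∃ (T' : CantorC →L[ℝ] F) (c' : ℝ), 0 < c' ∧ (∀ f, c' * ‖f‖ ≤ ‖T' f‖) ∧ ∀ f, T' f ∈ V := by
  classical
  obtain ⟨ε, hε0, S, hεS, hS⟩ := posSumOfEncodable (ε := c/4) (by positivity) (List Bool)
  choose! A hA x hx using hsplit
  -- the scheme
  let B : List Bool → Clopens CantorSet := fun l => List.rec (A ⊤ (ε []))
    (fun b s Bs => if b then A Bs (ε (true :: s)) else Bs \ A Bs (ε (true :: s))) l
  have Bnil : B [] = A ⊤ (ε []) := rfl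
  have Btrue : ∀ s, B (true :: s) = A (B s) (ε (true :: s)) := fun s => rfl
  have Bfalse : ∀ s, B (false :: s) = B s \ B (true :: s) := fun s => rfl
  have htop : (⊤ : Clopens CantorSet) ≠ ⊥ := by
    intro h
    have : (fun _ => true : CantorSet) ∈ (⊤ : Clopens CantorSet) := trivial
    rw [h] at this
    exact this
  have Bne : ∀ l, B l ≠ ⊥ := by
    intro l
    induction l with
    | nil => exact (hA ⊤ htop _ (hε0 _)).2.1
    | cons b s ih =>
      cases b
      · exact (hA (B s) ih _ (hε0 (true :: s))).2.2
      · exact (hA (B s) ih _ (hε0 _)).2.1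
  have Ble : ∀ s, B (true :: s) ≤ B s := fun s => (hA (B s) (Bne s) _ (hε0 _)).1
  have Bcons : ∀ b s t, t ∈ B (b :: s) → t ∈ B s := by
    intro b s t h
    cases b
    · exact h.1
    · exact Ble s h
  -- the map
  let node : CantorSet → ℕ → List Bool := fun t n =>
    Nat.rec [] (fun _ l => (decide (t ∈ B (true :: l))) :: l) n
  have node0 : ∀ t, node t 0 = [] := fun t => rfl
  have nodeS : ∀ t n, node t (n+1) = (decide (t ∈ B (true :: node t n))) :: node t n := fun t n => rfl
  have hnodec : ∀ n, Continuous[_, ⊥] (fun t => node t n) := by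
    let _ : TopologicalSpace (List Bool) := ⊥
    have : DiscreteTopology (List Bool) := ⟨rfl⟩
    intro n
    induction n with
    | zero => exact continuous_const
    | succ n ih =>
      rw [continuous_discrete_rng] at ih ⊢
      intro l
      have : ((fun t => node t (n+1)) ⁻¹' {l}) = ⋃ l' : List Bool, ((fun t => node t n) ⁻¹' {l'}) ∩
          {t | (decide (t ∈ B (true :: l'))) :: l' = l} := by
        ext t
        simp [nodeS]
      rw [this]
      refine isOpen_iUnion fun l' => (ih l').inter ?_
      have hcl := (B (true :: l')).isClopen
      by_cases h1 : true :: l' = l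
      · have : {t | (decide (t ∈ B (true :: l'))) :: l' = l} = (B (true :: l') : Set CantorSet) := by
          ext t
          simp [← h1]
        rw [this]; exact hcl.isOpen
      · by_cases h2 : false :: l' = l
        · have : {t | (decide (t ∈ B (true :: l'))) :: l' = l} = (B (true :: l') : Set CantorSet)ᶜ := by
            ext t
            simp [← h2]
          rw [this]; exact hcl.compl.isOpen
        · have : {t | (decide (t ∈ B (true :: l'))) :: l' = l} = ∅ := by
            ext t
            by_cases ht : t ∈ B (true :: l') <;> simp [ht, h1, h2]
          rw [this]; exact isOpen_empty
  let r0 : CantorSet → CantorSet := fun t n => decide (t ∈ B (true :: node t n))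
  have hr0 : Continuous r0 := by
    let _ : TopologicalSpace (List Bool) := ⊥
    have : DiscreteTopology (List Bool) := ⟨rfl⟩
    refine continuous_pi fun n => ?_
    have h2 : Continuous (fun l : List Bool => l.headD false) := continuous_of_discreteTopology
    exact h2.comp (hnodec (n+1))
  let r : C(CantorSet, CantorSet) := ⟨r0, hr0⟩
  have hnode : ∀ t n, cnode (r t) n = node t n := by
    intro t n
    induction n with
    | zero => rfl
    | succ n ih => rw [cnode, ih, nodeS]; rfl
  have hnB : ∀ t, t ∈ B [] → ∀ n, t ∈ B (node t n) := by
    intro t ht n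
    induction n with
    | zero => exact ht
    | succ n ih =>
      rw [nodeS]
      by_cases h : t ∈ B (true :: node t n)
      · simp [h]
      · simp only [h, decide_false]
        rw [Bfalse]
        exact ⟨ih, h⟩
  have hBn : ∀ l t, t ∈ B l → t ∈ B [] ∧ node t l.length = l := by
    intro l t
    induction l with
    | nil => intro h; exact ⟨h, rfl⟩
    | cons b s ih =>
      intro h
      obtain ⟨h1, h2⟩ := ih (Bcons b s t h)
      refine ⟨h1, ?_⟩
      rw [List.length_cons, nodeS, h2]
      congr 1
      cases b
      · rw [Bfalse] at h
        simpa using h.2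
      · simpa using h
  have hsurj : ∀ τ : CantorSet, ∃ t ∈ B [], r t = τ := by
    intro τ
    have hne : ∀ n : ℕ, (SetLike.coe (B (cnode τ n))).Nonempty := by
      intro n
      by_contra h
      rw [Set.not_nonempty_iff_eq_empty] at h
      exact Bne (cnode τ n) (SetLike.coe_injective (h.trans rfl))
    obtain ⟨t, ht⟩ := IsCompact.nonempty_iInter_of_sequence_nonempty_isCompact_isClosed
      (fun n : ℕ => (SetLike.coe (B (cnode τ n))))
      (fun n t ht => Bcons (τ n) (cnode τ n) t ht) hne
      (B (cnode τ 0)).isClopen.isClosed.isCompact (fun n => (B (cnode τ n)).isClopen.isClosed)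
    rw [Set.mem_iInter] at ht
    refine ⟨t, (ht 0), ?_⟩
    funext i
    have := (hBn (cnode τ (i+1)) t (ht (i+1))).2
    rw [cnode_length] at this
    have h5 := (hnode t (i+1)).trans this
    exact (cnode_eq_iff _ _ _).1 h5 i (by omega)
  let U : CantorC →L[ℝ] CantorC := LinearMap.mkContinuous
    { toFun := fun f => ind (B []) * f.comp r
      map_add' := by intro f g; ext t; simp [mul_add]
      map_smul' := by intro a f; ext t; simp } 1 (by
        intro f
        rw [one_mul, ContinuousMap.norm_le _ (norm_nonneg f)]
        intro t
        by_cases h : t ∈ B []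
        · simpa [ind_pos h] using f.norm_coe_le_norm (r t)
        · simp [ind_neg h])
  have hUapp : ∀ f t, U f t = ind (B []) t * f (r t) := fun f t => rfl
  have hUn : ∀ f, ‖f‖ ≤ ‖U f‖ := by
    intro f
    rw [ContinuousMap.norm_le _ (norm_nonneg _)]
    intro τ
    obtain ⟨t, ht, rfl⟩ := hsurj τ
    have := (U f).norm_coe_le_norm t
    rwa [hUapp, ind_pos ht, one_mul] at this
  have hUc : ∀ l, U (ind (cyl l)) = ind (B l) := by
    intro l
    ext t
    rw [hUapp]
    by_cases h : t ∈ B l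
    · obtain ⟨h1, h2⟩ := hBn l t h
      rw [ind_pos h, ind_pos h1, ind_pos, one_mul]
      rw [mem_cyl, hnode, h2]
    · rw [ind_neg h]
      by_cases h1 : t ∈ B []
      · have h3 : r t ∉ cyl l := by
          rw [mem_cyl, hnode]
          intro h2
          apply h
          rw [← h2]
          exact hnB t h1 _
        rw [ind_neg h3, mul_zero]
      · rw [ind_neg h1, zero_mul]
  -- corrections
  let d : List Bool → F := fun l => match l with
    | [] => x ⊤ (ε []) - T (ind (B []))
    | true :: s => x (B s) (ε (true :: s)) - T (ind (B (true :: s)))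
    | false :: s => 0
  have hd : ∀ l, ‖d l‖ ≤ ε l := by
    intro l
    match l with
    | [] => 
      show ‖x ⊤ (ε []) - T (ind (B []))‖ ≤ _
      rw [norm_sub_rev]
      exact (hx ⊤ htop _ (hε0 _)).2.le
    | true :: s => 
      show ‖x (B s) (ε (true :: s)) - T (ind (B (true :: s)))‖ ≤ _
      rw [norm_sub_rev]
      exact (hx (B s) (Bne s) _ (hε0 _)).2.le
    | false :: s =>
      show ‖(0:F)‖ ≤ _
      rw [norm_zero]; exact (hε0 _).le
  let κ : List Bool → CantorC →L[ℝ] ℝ := fun l => match l with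
    | [] => ContinuousMap.evalCLM ℝ (pt [])
    | b :: s => ContinuousMap.evalCLM ℝ (pt (b :: s)) - ContinuousMap.evalCLM ℝ (pt s)
  have hκn : ∀ f, κ [] f = f (pt []) := fun f => rfl
  have hκc : ∀ b s f, κ (b :: s) f = f (pt (b :: s)) - f (pt s) := fun b s f => rfl
  have hκ : ∀ l f, ‖κ l f‖ ≤ 2 * ‖f‖ := by
    intro l f
    cases l with
    | nil => rw [hκn]; linarith [f.norm_coe_le_norm (pt []), norm_nonneg f]
    | cons b s =>
      rw [hκc]
      have := norm_sub_le (f (pt (b :: s))) (f (pt s))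
      linarith [f.norm_coe_le_norm (pt (b::s)), f.norm_coe_le_norm (pt s)]
  have hterm : ∀ l f, ‖κ l f • d l‖ ≤ ε l * (2 * ‖f‖) := by
    intro l f
    rw [norm_smul, mul_comm]
    exact mul_le_mul (hd l) (hκ l f) (norm_nonneg _) (hε0 l).le
  have hsumm : ∀ f, Summable fun l => κ l f • d l := fun f =>
    Summable.of_norm_bounded (hεS.mul_right (2 * ‖f‖)).summable (hterm · f)
  let D : CantorC →L[ℝ] F := LinearMap.mkContinuous
    { toFun := fun f => ∑' l, κ l f • d l
      map_add' := by
        intro f g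
        rw [← (hsumm f).tsum_add (hsumm g)]
        simp [add_smul]
      map_smul' := by
        intro a f
        rw [RingHom.id_apply, ← (hsumm f).tsum_const_smul]
        simp [mul_smul] } (c/2) (by
      intro f
      refine (tsum_of_norm_bounded (hεS.mul_right (2 * ‖f‖)) (hterm · f)).trans ?_
      nlinarith [norm_nonneg f])
  have hDapp : ∀ f, D f = ∑' l, κ l f • d l := fun f => rfl
  have hDn : ∀ f, ‖D f‖ ≤ c/2 * ‖f‖ := by
    intro f
    exact LinearMap.mkContinuous_norm_le _ (by positivity) _ |> fun h => (D.le_opNorm f).trans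
      (mul_le_mul_of_nonneg_right h (norm_nonneg f))
  have hcylT : ∀ l, (T.comp U + D) (ind (cyl l)) ∈ V := by
    intro l
    induction l with
    | nil =>
      have h1 : D (ind (cyl [])) = d [] := by
        rw [hDapp, tsum_eq_single []]
        · rw [hκn, ind_pos, one_smul]; rfl
        · intro l hl
          obtain ⟨b, s, rfl⟩ := List.exists_cons_of_ne_nil hl
          rw [hκc, ind_pos (by rfl), ind_pos (by rfl), sub_self, zero_smul]
      rw [add_apply, ContinuousLinearMap.comp_apply, hUc, h1]
      show T (ind (B [])) + (x ⊤ (ε []) - T (ind (B []))) ∈ V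
      rw [add_sub_cancel]
      exact (hx ⊤ htop _ (hε0 _)).1
    | cons b s ih =>
      have htrue : (T.comp U + D) (ind (cyl (true :: s))) ∈ V := by
        have h1 : D (ind (cyl (true :: s))) = d (true :: s) := by
          rw [hDapp, tsum_eq_single (true :: s)]
          · rw [hκc, ind_pos, ind_neg, sub_zero, one_smul]
            · rw [pt_mem_cyl]
              intro h
              have := h.length_le
              simp at this
            · rw [pt_mem_cyl]
          · intro l hl
            cases l with
            | nil =>
              rw [hκn, ind_neg, zero_smul]
              rw [pt_mem_cyl]; simp
            | cons b w =>
              rw [hκc]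
              by_cases hw : (true :: s) <:+ w
              · rw [ind_pos ((pt_mem_cyl _ _).2 hw), ind_pos, sub_self, zero_smul]
                rw [pt_mem_cyl, List.suffix_cons_iff]
                exact Or.inr hw
              · rw [ind_neg (fun h => hw ((pt_mem_cyl _ _).1 h)), ind_neg, sub_self, zero_smul]
                rw [pt_mem_cyl, List.suffix_cons_iff]
                rintro (h | h)
                · exact hl h.symm
                · exact hw h
        rw [add_apply, ContinuousLinearMap.comp_apply, hUc, h1]
        show T (ind (B (true :: s))) + (x (B s) (ε (true :: s)) - T (ind (B (true :: s)))) ∈ V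
        rw [add_sub_cancel]
        exact (hx (B s) (Bne s) _ (hε0 _)).1
      cases b
      · have : ind (cyl (false :: s)) = ind (cyl s) - ind (cyl (true :: s)) := by
          ext t
          rw [ContinuousMap.sub_apply]
          simp only [ind_apply, mem_cyl, List.length_cons, cnode, List.cons.injEq]
          by_cases h1 : cnode t s.length = s
          · cases t s.length <;> simp [h1]
          · simp [h1]
        rw [this, map_sub]
        exact Submodule.sub_mem _ ih htrue
      · exact htrue
  refine ⟨T.comp U + D, c/2, by positivity, fun f => ?_, cyl_dense _ V hV hcylT⟩
  rw [add_apply, ContinuousLinearMap.comp_apply]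
  have h1 := hT (U f)
  have h2 := norm_sub_le_norm_add (T (U f)) (D f)
  have h3 := hDn f
  have h4 := hUn f
  nlinarith

open Filter Topology MeasureTheory TopologicalSpace

/-! ## Core, part D: the limit argument -/

theorem lincomb_range {Y : Type*} [AddCommGroup Y] [Module ℝ Y] (y : ℕ → Y) (c : ℕ →₀ ℝ) (n : ℕ)
    (hn : ∀ i, c i ≠ 0 → i < n) :
    Finsupp.linearCombination ℝ y c = ∑ i ∈ Finset.range n, c i • y i := by
  rw [Finsupp.linearCombination_apply, Finsupp.sum_of_support_subset]
  · intro i hi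
    rw [Finset.mem_range]
    exact hn i (by simpa using hi)
  · simp

theorem finsupp_bound {M : Type*} [Zero M] (c : ℕ →₀ M) : ∃ n, ∀ i, c i ≠ 0 → i < n := by
  refine ⟨c.support.sup id + 1, fun i hi => ?_⟩
  have : id i ≤ c.support.sup id := Finset.le_sup (by simpa using hi)
  simp only [id] at this
  omega

theorem basis_dense {E : Type*} [SeminormedAddCommGroup E] [NormedSpace ℝ E] (e : ℕ → E)
    (he : IsSchauderBasis e) : Dense (Submodule.span ℝ (Set.range e) : Set E) := by
  intro y
  obtain ⟨a, ha, -⟩ := he y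
  refine mem_closure_of_tendsto ha (Eventually.of_forall fun m => ?_)
  exact Submodule.sum_mem _ fun i _ => Submodule.smul_mem _ _ (Submodule.subset_span ⟨i, rfl⟩)

theorem core (e : ℕ → CantorC) (hbasis : IsSchauderBasis e) (hnorm : ∀ n, ‖e n‖ = 1)
    (z : ℕ ⊕ ℕ → CantorC) (N : ℕ → ℕ) (ω : ℕ × ℕ × ((ℕ ⊕ ℕ) →₀ ℚ) → ((ℕ ⊕ ℕ) →₀ ℚ))
    (hω : SkolemP z N ω) (hN : ∀ n, n ≤ N n) (δ : ℝ) (hδ : 0 < δ)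
    (σ : ℕ → ((ℕ ⊕ ℕ) →₀ ℚ)) (hσ : ∀ n, EqU e δ n (fun i => ev z (σ i))) :
    ∃ (k : ℕ) (τ : ℕ → (ℕ →₀ ℚ)), ∀ n,
      EqU e (1 / ((k : ℝ) + 1)) n (fun i => ev (fun j => z (Sum.inl j)) (τ i)) := by
  have hd := basis_dense e hbasis
  have hlow : ∀ c : ℕ →₀ ℝ, δ * ‖Finsupp.linearCombination ℝ e c‖ ≤
      ‖Finsupp.linearCombination ℝ (fun i => ev z (σ i)) c‖ ∧
      ‖Finsupp.linearCombination ℝ (fun i => ev z (σ i)) c‖ ≤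
      δ⁻¹ * ‖Finsupp.linearCombination ℝ e c‖ := by
    intro c
    obtain ⟨n, hn⟩ := finsupp_bound c
    rw [lincomb_range _ c n hn, lincomb_range _ c n hn]
    exact hσ n c
  obtain ⟨T, hT⟩ := extend_clm e (fun i => ev z (σ i)) hd δ⁻¹ (fun c => (hlow c).2)
  have hTlow : ∀ f, δ * ‖f‖ ≤ ‖T f‖ := by
    have hcl : IsClosed {f : CantorC | δ * ‖f‖ ≤ ‖T f‖} :=
      isClosed_le (by fun_prop) (by fun_prop)
    intro f
    have : f ∈ closure {f : CantorC | δ * ‖f‖ ≤ ‖T f‖} := by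
      refine closure_mono ?_ (hd f)
      intro g hg
      rw [← Finsupp.range_linearCombination] at hg
      obtain ⟨c, rfl⟩ := hg
      show δ * ‖_‖ ≤ ‖T _‖
      rw [lincomb_clm]
      simp only [hT]
      exact (hlow c).1
    rwa [hcl.closure_eq] at this
  have hTmem : ∀ f, T f ∈ closure (Set.range (ev z)) := by
    rw [closure_ev_eq]
    have hcl : IsClosed {f : CantorC | T f ∈ ((Submodule.span ℝ (Set.range z)).topologicalClosure)} :=
      (Submodule.isClosed_topologicalClosure _).preimage T.continuous
    intro f
    have : f ∈ closure {f : CantorC | T f ∈ ((Submodule.span ℝ (Set.range z)).topologicalClosure)} := by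
      refine closure_mono ?_ (hd f)
      intro g hg
      show T g ∈ (Submodule.span ℝ (Set.range z)).topologicalClosure
      have h1 : Submodule.span ℝ (Set.range e) ≤
          ((Submodule.span ℝ (Set.range z)).topologicalClosure).comap (T : CantorC →ₗ[ℝ] CantorC) := by
        rw [Submodule.span_le]
        rintro _ ⟨i, rfl⟩
        show T (e i) ∈ (Submodule.span ℝ (Set.range z)).topologicalClosure
        rw [hT]
        exact Submodule.le_topologicalClosure _ (ev_mem_span z _)
      exact h1 hg
    rwa [hcl.closure_eq] at this
  set V := (Submodule.span ℝ (Set.range fun j => z (Sum.inl j))).topologicalClosure with hVdef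
  have hV : IsClosed (V : Set CantorC) := Submodule.isClosed_topologicalClosure _
  obtain ⟨T', c', hc', hlow', hmem'⟩ := fix_operator T δ hδ hTlow V hV (by
    intro B hB ε hε
    obtain ⟨A, hA, hdisj⟩ := exists_disjoint_clopens B hB
    obtain ⟨k, x, hx, hkx⟩ := claimC z N ω hω hN V hV
      (fun j => Submodule.le_topologicalClosure _ (Submodule.subset_span ⟨j, rfl⟩))
      (fun k => T (ind (A k))) (fun k => hTmem _) ‖T‖ (by
        intro F s hs
        have : ∑ k ∈ F, s k • T (ind (A k)) = T (∑ k ∈ F, s k • ind (A k)) := by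
          simp [map_sum]
        rw [this]
        refine (T.le_opNorm _).trans ?_
        have h1 := norm_sum_ind_le A hdisj F s hs
        nlinarith [norm_nonneg T]) ε hε
    exact ⟨A k, hA k, x, hx, hkx⟩)
  obtain ⟨b, hb, hbe⟩ := basis_const e hbasis hnorm
  let η : ℝ := min c' (min 1 (‖T'‖ + 1)⁻¹)
  have hη0 : 0 < η := by
    have : 0 < ‖T'‖ + 1 := by positivity
    simp only [η, lt_min_iff]
    exact ⟨hc', one_pos, by positivity⟩
  have hη1 : η ≤ 1 := (min_le_right _ _).trans (min_le_left _ _)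
  have hηc : η ≤ c' := min_le_left _ _
  have hηT : ‖T'‖ ≤ η⁻¹ := by
    have h1 : η ≤ (‖T'‖ + 1)⁻¹ := (min_le_right _ _).trans (min_le_right _ _)
    have h2 := inv_anti₀ hη0 h1
    rw [inv_inv] at h2
    linarith
  have hEq : ∀ n, EqU e η n (fun i => T' (e i)) := by
    intro n a
    have : ∑ i ∈ Finset.range n, a i • T' (e i) = T' (∑ i ∈ Finset.range n, a i • e i) := by
      simp [map_sum]
    rw [this]
    constructor
    · exact (mul_le_mul_of_nonneg_right hηc (norm_nonneg _)).trans (hlow' _)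
    · exact (T'.le_opNorm _).trans (mul_le_mul_of_nonneg_right hηT (norm_nonneg _))
  have hap : ∀ i : ℕ, ∃ τ : ℕ →₀ ℚ, ‖T' (e i) - ev (fun j => z (Sum.inl j)) τ‖ ≤
      η / (4 * b) * (1/2)^i := by
    intro i
    have h1 : T' (e i) ∈ closure (Set.range (ev fun j => z (Sum.inl j))) := by
      rw [closure_ev_eq]; exact hmem' _
    obtain ⟨_, ⟨y, rfl⟩, hy⟩ := Metric.mem_closure_iff.1 h1 (η / (4 * b) * (1/2)^i) (by positivity)
    exact ⟨y, by rw [← dist_eq_norm]; exact hy.le⟩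
  choose τ hτ using hap
  obtain ⟨k, hk⟩ := exists_nat_one_div_lt (half_pos hη0)
  refine ⟨k, τ, fun n => ?_⟩
  exact (perturb hb hbe hη0 hη1 (hEq n) (fun i _ => hτ i)).mono_δ (by positivity) hk.le

open Filter Topology MeasureTheory TopologicalSpace

/-! ## Coding and boundedness -/

instance polishCC : PolishSpace CantorC := inferInstance

/-- the parameter space -/
abbrev Param : Type :=
  ((ℕ ⊕ ℕ) → CantorC) × (ℕ → ℕ) × (ℕ × ℕ × ((ℕ ⊕ ℕ) →₀ ℚ) → ℕ) × (ℕ × List (ℕ →₀ ℚ) → ℕ)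

instance polishParam : PolishSpace Param := by
  have h1 : PolishSpace ((ℕ ⊕ ℕ) → CantorC) := inferInstance
  have h2 : PolishSpace (ℕ × List (ℕ →₀ ℚ) → ℕ) := inferInstance
  have h3 : PolishSpace (ℕ × ℕ × ((ℕ ⊕ ℕ) →₀ ℚ) → ℕ) := inferInstance
  have h4 : PolishSpace ((ℕ × ℕ × ((ℕ ⊕ ℕ) →₀ ℚ) → ℕ) × (ℕ × List (ℕ →₀ ℚ) → ℕ)) := inferInstance
  have h5 : PolishSpace ((ℕ → ℕ) × (ℕ × ℕ × ((ℕ ⊕ ℕ) →₀ ℚ) → ℕ) × (ℕ × List (ℕ →₀ ℚ) → ℕ)) :=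
    inferInstance
  infer_instance

theorem ev_continuous {ι E : Type*} [SeminormedAddCommGroup E] [NormedSpace ℝ E] (c : ι →₀ ℚ) :
    Continuous (fun z : ι → E => ev z c) := by
  unfold ev Finsupp.sum
  fun_prop

theorem map_ofFn_mem_bt {Λ : Type*} (e : ℕ → CantorC) (δ : ℝ) (φ : Λ → CantorC) (σ : ℕ → Λ) (n : ℕ) :
    (List.ofFn (fun i : Fin n => σ i)).map φ ∈ bourgainTree e δ CantorC ↔
      EqU e δ n (fun i => φ (σ i)) := by
  rw [List.map_ofFn]
  exact ofFn_mem_bt e δ n (fun i => φ (σ i))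

theorem map_bt_isTree {Λ : Type*} (e : ℕ → CantorC) (δ : ℝ) (φ : Λ → CantorC) :
    IsTree {s : List Λ | s.map φ ∈ bourgainTree e δ CantorC} := by
  intro s t hst ht
  exact bt_isTree e δ _ _ (hst.map φ) ht

theorem coded_bound (e : ℕ → CantorC) (hbasis : IsSchauderBasis e) (hnorm : ∀ n, ‖e n‖ = 1)
    (ξ : Ordinal.{0}) (hξ : ξ < omega1) (k : ℕ) :
    ∃ η < omega1, ∀ (z : ℕ ⊕ ℕ → CantorC) (N : ℕ → ℕ)
      (ω : ℕ × ℕ × ((ℕ ⊕ ℕ) →₀ ℚ) → ((ℕ ⊕ ℕ) →₀ ℚ)) (ρ : ℕ × List (ℕ →₀ ℚ) → Ordinal.{0}),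
      SkolemP z N ω → (∀ n, n ≤ N n) → (∀ p, ρ p ≤ ξ) →
      (∀ (k : ℕ) (s : List (ℕ →₀ ℚ)) (t : ℕ →₀ ℚ), (s ++ [t]).map (ev fun j => z (Sum.inl j)) ∈
        bourgainTree e (1 / ((k : ℝ) + 1)) CantorC → ρ (k, s ++ [t]) < ρ (k, s)) →
      ∃ r : List ((ℕ ⊕ ℕ) →₀ ℚ) → Ordinal.{0}, (∀ l, r l < η) ∧ ∀ l x,
        (l ++ [x]).map (ev z) ∈ bourgainTree e (1 / ((k : ℝ) + 1)) CantorC → r (l ++ [x]) < r l := by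
  obtain ⟨R, enc, hR, henc⟩ := exists_enc ξ hξ
  obtain ⟨dec, hdec⟩ := exists_surjective_nat ((ℕ ⊕ ℕ) →₀ ℚ)
  obtain ⟨b, hb, hbe⟩ := basis_const e hbasis hnorm
  let A : Set Param := {p | SkolemP p.1 p.2.1 (fun x => dec (p.2.2.1 x)) ∧ (∀ n, n ≤ p.2.1 n) ∧
    ∀ (k : ℕ) (s : List (ℕ →₀ ℚ)) (t : ℕ →₀ ℚ), (s ++ [t]).map (ev fun j => p.1 (Sum.inl j)) ∈
        bourgainTree e (1 / ((k : ℝ) + 1)) CantorC → R (p.2.2.2 (k, s ++ [t])) (p.2.2.2 (k, s))}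
  obtain ⟨η, hη, H⟩ := bounded_ranks A
    (fun p => {s | s.map (ev p.1) ∈ bourgainTree e (1 / ((k : ℝ) + 1)) CantorC})
    (fun p _ => map_bt_isTree e _ _) (by
    intro p a ha hlim σ hσ
    have l1 : Tendsto (fun m => (a m).1) atTop (𝓝 p.1) := (continuous_fst.tendsto p).comp hlim
    have l2 : ∀ n, ∀ᶠ m in atTop, (a m).2.1 n = p.2.1 n := by
      intro n
      have : Tendsto (fun m => (a m).2.1 n) atTop (𝓝 (p.2.1 n)) :=
        ((by fun_prop : Continuous fun p : Param => p.2.1 n).tendsto p).comp hlim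
      rwa [nhds_discrete, tendsto_pure] at this
    have l3 : ∀ x, ∀ᶠ m in atTop, (a m).2.2.1 x = p.2.2.1 x := by
      intro n
      have : Tendsto (fun m => (a m).2.2.1 n) atTop (𝓝 (p.2.2.1 n)) :=
        ((by fun_prop : Continuous fun p : Param => p.2.2.1 n).tendsto p).comp hlim
      rwa [nhds_discrete, tendsto_pure] at this
    have l4 : ∀ x, ∀ᶠ m in atTop, (a m).2.2.2 x = p.2.2.2 x := by
      intro n
      have : Tendsto (fun m => (a m).2.2.2 n) atTop (𝓝 (p.2.2.2 n)) :=
        ((by fun_prop : Continuous fun p : Param => p.2.2.2 n).tendsto p).comp hlim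
      rwa [nhds_discrete, tendsto_pure] at this
    have lev : ∀ c, Tendsto (fun m => ev (a m).1 c) atTop (𝓝 (ev p.1 c)) := fun c =>
      ((ev_continuous c).tendsto p.1).comp l1
    have levl : ∀ c, Tendsto (fun m => ev (fun j => (a m).1 (Sum.inl j)) c) atTop
        (𝓝 (ev (fun j => p.1 (Sum.inl j)) c)) := fun c => by
      have h1 : Continuous fun z : ℕ ⊕ ℕ → CantorC => (fun j : ℕ => z (Sum.inl j)) := by fun_prop
      exact (((ev_continuous c).comp h1).tendsto p.1).comp l1
    have hN : ∀ n, n ≤ p.2.1 n := by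
      intro n
      obtain ⟨m, hm⟩ := (l2 n).exists
      rw [← hm]
      exact (ha m).2.1 n
    have hS : SkolemP p.1 p.2.1 (fun x => dec (p.2.2.1 x)) := by
      intro n q y
      constructor
      · obtain ⟨m, hm1, hm2⟩ := ((l2 n).and (l3 (n, q, y))).exists
        have := ((ha m).1 n q y).1
        unfold InL at this ⊢
        dsimp only at this ⊢
        rwa [hm1, hm2] at this
      · intro w hw
        refine le_of_tendsto_of_tendsto
          (((lev w).norm).add ((((lev _).norm).sub_const _).const_mul _))
          (((lev (w + y)).norm).max ((lev (w - y)).norm)) ?_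
        filter_upwards [l2 n, l3 (n, q, y)] with m hm1 hm2
        have := ((ha m).1 n q y).2 w (by
          unfold InL at hw ⊢
          rwa [hm1])
        dsimp only at this ⊢
        rwa [hm2] at this
    have hE : ∀ n, EqU e (1 / ((k : ℝ) + 1)) n (fun i => ev p.1 (σ i)) := by
      intro n c
      have hev : ∀ m, n ≤ m → EqU e (1 / ((k : ℝ) + 1)) n (fun i => ev (a m).1 (σ i)) := fun m hm =>
        ((map_ofFn_mem_bt e _ _ σ m).1 (hσ m)).mono_n hm
      have hl : Tendsto (fun m => ‖∑ i ∈ Finset.range n, c i • ev (a m).1 (σ i)‖) atTop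
          (𝓝 ‖∑ i ∈ Finset.range n, c i • ev p.1 (σ i)‖) :=
        (tendsto_finsetSum _ fun i _ => (lev (σ i)).const_smul (c i)).norm
      constructor
      · exact ge_of_tendsto hl ((eventually_ge_atTop n).mono fun m hm => (hev m hm c).1)
      · exact le_of_tendsto hl ((eventually_ge_atTop n).mono fun m hm => (hev m hm c).2)
    obtain ⟨k', τ, hτ⟩ := core e hbasis hnorm p.1 p.2.1 _ hS hN _ (by positivity) σ hE
    have hpos : (0:ℝ) < 1 / ((k' : ℝ) + 1) := by positivity
    have hle1 : 1 / ((k' : ℝ) + 1) ≤ 1 := by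
      rw [div_le_one (by positivity)]
      have : (0:ℝ) ≤ k' := by positivity
      linarith
    have hkk : 1 / ((k' : ℝ) + 1) / 2 = 1 / (((2 * k' + 1 : ℕ) : ℝ) + 1) := by
      push_cast
      field_simp
      ring
    have hdesc : ∀ n, R (p.2.2.2 (2 * k' + 1, List.ofFn fun i : Fin (n+1) => τ i))
        (p.2.2.2 (2 * k' + 1, List.ofFn fun i : Fin n => τ i)) := by
      intro n
      have h1 : ∀ᶠ m in atTop, ∀ i ∈ Finset.range (n+1),
          ‖ev (fun j => p.1 (Sum.inl j)) (τ i) - ev (fun j => (a m).1 (Sum.inl j)) (τ i)‖ ≤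
          1 / ((k' : ℝ) + 1) / (4 * b) * (1/2)^i := by
        rw [Finset.eventually_all]
        intro i _
        have := (levl (τ i)).const_sub (ev (fun j => p.1 (Sum.inl j)) (τ i)) |>.norm
        rw [sub_self, norm_zero] at this
        exact this.eventually_le_const (by positivity)
      obtain ⟨m, hm1, hm2, hm3⟩ := (h1.and ((l4 (2 * k' + 1, List.ofFn fun i : Fin (n+1) => τ i)).and
        (l4 (2 * k' + 1, List.ofFn fun i : Fin n => τ i)))).exists
      rw [← hm2, ← hm3, ofFn_succ_snoc]
      apply (ha m).2.2
      rw [← ofFn_succ_snoc, map_ofFn_mem_bt, ← hkk]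
      exact perturb hb hbe hpos hle1 (hτ (n+1)) (fun i hi => hm1 i (Finset.mem_range.2 hi))
    exact (wellFounded_iff_isEmpty_descending_chain.1 hR).false
      ⟨fun n => p.2.2.2 (2 * k' + 1, List.ofFn fun i : Fin n => τ i), hdesc⟩)
  refine ⟨η, hη, fun z N ω ρ hS hN hρ hρt => ?_⟩
  choose ω' hω' using fun x => hdec (ω x)
  exact H (z, N, ω', fun p => enc (ρ p)) ⟨by simpa [hω'] using hS, hN, fun k s t h =>
    henc _ _ (hρ _) (hρ _) (hρt k s t h)⟩

open Filter Topology MeasureTheory TopologicalSpace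

/-! ## Assembly -/

theorem map_mem_bt {X Z : Type*} [SeminormedAddCommGroup X] [NormedSpace ℝ X]
    [SeminormedAddCommGroup Z] [NormedSpace ℝ Z] (e : ℕ → CantorC) (δ : ℝ) (J : X →ₗᵢ[ℝ] Z)
    (l : List X) : l.map J ∈ bourgainTree e δ Z ↔ l ∈ bourgainTree e δ X := by
  rw [mem_bt, mem_bt, List.length_map, ← EqU.map J]
  have : (fun i => (l.map J).getD i 0) = (fun i => J (l.getD i 0)) := by
    funext i
    rw [← J.map_zero, List.getD_map]
  rw [this]

theorem assembly (e : ℕ → CantorC) (hbasis : IsSchauderBasis e) (hnorm : ∀ n, ‖e n‖ = 1)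
    (construction : ∀ (X : Type) [NormedAddCommGroup X] [NormedSpace ℝ X] [CompleteSpace X]
          [TopologicalSpace.SeparableSpace X], ∃ (x : ℕ → X) (z : ℕ ⊕ ℕ → CantorC) (N : ℕ → ℕ)
      (ω : ℕ × ℕ × ((ℕ ⊕ ℕ) →₀ ℚ) → ((ℕ ⊕ ℕ) →₀ ℚ)) (J : X →ₗᵢ[ℝ] CantorC),
      (∀ n, n ≤ N n) ∧ SkolemP z N ω ∧ (∀ j, J (x j) = z (Sum.inl j)) ∧
      (∀ y, J y ∈ (Submodule.span ℝ (Set.range fun i => z (Sum.inr i))).topologicalClosure) ∧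
      HasSchauderBasis (Submodule.span ℝ (Set.range fun i => z (Sum.inr i))).topologicalClosure) :
    ∃ f : Ordinal.{0} → Ordinal.{0},
      (∀ ξ : Ordinal.{0}, ξ < omega1 → f ξ < omega1) ∧
      ∀ ξ : Ordinal.{0}, ξ < omega1 →
        ∀ (X : Type) [NormedAddCommGroup X] [NormedSpace ℝ X] [CompleteSpace X]
          [TopologicalSpace.SeparableSpace X],
          bourgainIndex e X ≤ ξ →
          ∃ Y : SB, HasSchauderBasis ↥Y.1 ∧ EmbedsIsometrically X ↥Y.1 ∧
            bourgainIndex e ↥Y.1 ≤ f ξ := by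
  have hb' : ∀ ξ : Ordinal.{0}, ∃ η : Ordinal.{0}, ξ < omega1 → η < omega1 ∧
        ∀ (X : Type) [NormedAddCommGroup X] [NormedSpace ℝ X] [CompleteSpace X]
          [TopologicalSpace.SeparableSpace X],
          bourgainIndex e X ≤ ξ →
          ∃ Y : SB, HasSchauderBasis ↥Y.1 ∧ EmbedsIsometrically X ↥Y.1 ∧
            bourgainIndex e ↥Y.1 ≤ η := by
    intro ξ
    by_cases hξ : ξ < omega1
    swap
    · exact ⟨0, fun h => absurd h hξ⟩
    obtain ⟨b, hb, hbe⟩ := basis_const e hbasis hnorm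
    choose ηk hηk H using coded_bound e hbasis hnorm ξ hξ
    obtain ⟨η, hη, hηη⟩ := countable_rank_bound ηk hηk
    refine ⟨η, fun _ => ⟨hη, ?_⟩⟩
    intro X _ _ _ _ hX
    obtain ⟨x, z, N, ω, J, hN, hS, hJ, hJY, hY⟩ := construction X
    set Y := (Submodule.span ℝ (Set.range fun i => z (Sum.inr i))).topologicalClosure with hYdef
    -- the trees of X
    have hill : ¬ ∃ δ ∈ Set.Ioc (0:ℝ) 1, TreeIllFounded (bourgainTree e δ X) := by
      intro h
      unfold bourgainIndex at hX
      rw [if_pos h] at hX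
      exact absurd hX (not_le.2 hξ)
    have hrk : ∀ δ ∈ Set.Ioc (0:ℝ) 1, treeRank (bourgainTree e δ X) ≤ ξ := by
      intro δ hδ
      unfold bourgainIndex at hX
      rw [if_neg hill] at hX
      exact (Ordinal.le_iSup (fun δ : Set.Ioc (0:ℝ) 1 => treeRank (bourgainTree e δ.1 X)) ⟨δ, hδ⟩).trans hX
    have hδk : ∀ k : ℕ, 1 / ((k : ℝ) + 1) ∈ Set.Ioc (0:ℝ) 1 := by
      intro k
      refine ⟨by positivity, ?_⟩
      rw [div_le_one (by positivity)]
      have : (0:ℝ) ≤ k := by positivity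
      linarith
    choose ρ hρ1 hρ2 using fun k : ℕ => exists_rank_le (bourgainTree e (1 / ((k : ℝ) + 1)) X)
      (bt_isTree e _) (fun h => hill ⟨_, hδk k, h⟩) ξ (hrk _ (hδk k))
    have hevJ : ∀ c, ev (fun j => z (Sum.inl j)) c = J (ev x c) := by
      intro c
      have := ev_map x J.toLinearMap c
      simp only [LinearIsometry.coe_toLinearMap, hJ] at this
      exact this.symm
    have HK := fun k => H k z N ω (fun p => ρ p.1 (p.2.map (ev x))) hS hN (fun p => hρ1 _ _) (by
      intro k s t hst
      dsimp only
      rw [List.map_append, List.map_singleton]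
      apply hρ2
      rw [← map_mem_bt e _ J]
      have h1 : (s ++ [t]).map (ev fun j => z (Sum.inl j)) = (s.map (ev x) ++ [ev x t]).map J := by
        simp [hevJ, Function.comp_def]
      rwa [← h1])
    choose r hr1 hr2 using HK
    have hYrank : ∀ δ ∈ Set.Ioc (0:ℝ) 1, ∃ r' : List Y → Ordinal.{0}, (∀ l, r' l < η) ∧
        ∀ l a, l ++ [a] ∈ bourgainTree e δ Y → r' (l ++ [a]) < r' l := by
      intro δ hδ
      have hδ0 : 0 < δ := hδ.1
      have hap : ∀ (i : ℕ) (y : Y), ∃ c, ‖(y : CantorC) - ev z c‖ ≤ δ / (4 * b) * (1/2)^i := by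
        intro i y
        have h1 : (y : CantorC) ∈ closure (Set.range (ev z)) := by
          rw [closure_ev_eq]
          refine Submodule.topologicalClosure_mono (Submodule.span_mono ?_) y.2
          rintro _ ⟨i, rfl⟩
          exact ⟨_, rfl⟩
        obtain ⟨_, ⟨y, rfl⟩, hy⟩ := Metric.mem_closure_iff.1 h1 (δ / (4 * b) * (1/2)^i) (by positivity)
        exact ⟨y, by rw [← dist_eq_norm]; exact hy.le⟩
      choose c hc using hap
      obtain ⟨k, hk⟩ := exists_nat_one_div_lt (half_pos hδ0)
      refine ⟨fun l => r k (l.mapIdx c), fun l => (hr1 k _).trans (hηη k), fun l a hla => ?_⟩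
      have happ : (l ++ [a]).mapIdx c = l.mapIdx c ++ [c l.length a] := by
        simp [List.mapIdx_append]
      dsimp only
      rw [happ]
      apply hr2
      rw [← happ, mem_bt, List.length_map, List.length_mapIdx]
      rw [← map_mem_bt e δ Y.subtypeₗᵢ, mem_bt, List.length_map] at hla
      refine (perturb hb hbe hδ0 hδ.2 hla fun i hi => ?_).mono_δ (by positivity) hk.le
      rw [List.getD_eq_getElem _ _ (by simpa using hi), List.getD_eq_getElem _ _ (by simpa using hi)]
      rw [List.getElem_map, List.getElem_map, List.getElem_mapIdx]
      exact hc i _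
    refine ⟨⟨Y, Submodule.isClosed_topologicalClosure _⟩, hY, ⟨?_⟩, ?_⟩
    · exact { toLinearMap := J.toLinearMap.codRestrict Y hJY
              norm_map' := fun y => J.norm_map y }
    · unfold bourgainIndex
      rw [if_neg]
      · apply Ordinal.iSup_le
        rintro ⟨δ, hδ⟩
        obtain ⟨r', h1, h2⟩ := hYrank δ hδ
        exact treeRank_le_of_rank _ r' h2 η (fun l _ => h1 l)
      · rintro ⟨δ, hδ, h⟩
        obtain ⟨r', h1, h2⟩ := hYrank δ hδ
        exact not_ill_of_rank _ (· < ·) Ordinal.lt_wf r' h2 h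
  choose f hf using hb'
  exact ⟨f, fun ξ hξ => (hf ξ hξ).1, fun ξ hξ => (hf ξ hξ).2⟩

open Filter Topology MeasureTheory TopologicalSpace

/-! ## A criterion for Schauder bases -/

theorem grunblum {E : Type*} [NormedAddCommGroup E] [NormedSpace ℝ E] (v : ℕ → E)
    (hd : Dense (Submodule.span ℝ (Set.range v) : Set E)) (hv : ∀ i, v i ≠ 0) (C : ℝ) (hC : 0 ≤ C)
    (h : ∀ (a : ℕ → ℝ) m m', m ≤ m' → ‖∑ i ∈ Finset.range m, a i • v i‖ ≤
      C * ‖∑ i ∈ Finset.range m', a i • v i‖) : IsSchauderBasis v := by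
  have hP : ∀ (c : ℕ →₀ ℝ) m, ‖∑ i ∈ Finset.range m, c i • v i‖ ≤
      C * ‖Finsupp.linearCombination ℝ v c‖ := by
    intro c m
    obtain ⟨n, hn⟩ := finsupp_bound c
    rw [lincomb_range v c (max n m) (fun i hi => (hn i hi).trans_le (le_max_left _ _))]
    exact h _ _ _ (le_max_right _ _)
  have hco : ∀ i, ∃ φ : E →L[ℝ] ℝ, ∀ j, φ (v j) = if j = i then 1 else 0 := by
    intro i
    refine extend_clm v _ hd (2 * C / ‖v i‖) fun c => ?_
    have hvi : 0 < ‖v i‖ := norm_pos_iff.2 (hv i)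
    have h1 : Finsupp.linearCombination ℝ (fun j => if j = i then (1:ℝ) else 0) c = c i := by
      simp [Finsupp.linearCombination_apply, Finsupp.sum]
      intro h; exact h.symm
    rw [h1, div_mul_eq_mul_div, le_div_iff₀ hvi, ← norm_smul]
    have h2 : c i • v i = ∑ l ∈ Finset.range (i+1), c l • v l - ∑ l ∈ Finset.range i, c l • v l := by
      rw [Finset.sum_range_succ]; abel
    rw [h2]
    refine (norm_sub_le _ _).trans ?_
    linarith [hP c i, hP c (i+1)]
  choose φ hφ using hco
  have hφc : ∀ i (c : ℕ →₀ ℝ), φ i (Finsupp.linearCombination ℝ v c) = c i := by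
    intro i c
    rw [lincomb_clm]
    simp only [hφ]
    simp [Finsupp.linearCombination_apply, Finsupp.sum]
    intro h; exact h.symm
  let P : ℕ → E →L[ℝ] E := fun m => ∑ i ∈ Finset.range m, (φ i).smulRight (v i)
  have hPa : ∀ m y, P m y = ∑ i ∈ Finset.range m, φ i y • v i := by
    intro m y
    simp [P]
  have hPn : ∀ m y, ‖P m y‖ ≤ C * ‖y‖ := by
    intro m y
    have hcl : IsClosed {y : E | ‖P m y‖ ≤ C * ‖y‖} := isClosed_le (by fun_prop) (by fun_prop)
    have : y ∈ closure {y : E | ‖P m y‖ ≤ C * ‖y‖} := by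
      refine closure_mono ?_ (hd y)
      intro g hg
      rw [← Finsupp.range_linearCombination] at hg
      obtain ⟨c, rfl⟩ := hg
      show ‖P m (Finsupp.linearCombination ℝ v c)‖ ≤ C * ‖Finsupp.linearCombination ℝ v c‖
      rw [hPa]
      simp only [hφc]
      exact hP c m
    rwa [hcl.closure_eq] at this
  intro y
  refine ⟨fun i => φ i y, ?_, ?_⟩
  · dsimp only
    rw [Metric.tendsto_atTop]
    intro ε hε
    obtain ⟨y0, hy0, hyy⟩ := Metric.mem_closure_iff.1 (hd y) (ε / (C + 2)) (by positivity)
    rw [← Finsupp.range_linearCombination] at hy0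
    obtain ⟨c, rfl⟩ := hy0
    set y0 := Finsupp.linearCombination ℝ v c with hy0
    obtain ⟨n, hn⟩ := finsupp_bound c
    refine ⟨n, fun m hm => ?_⟩
    have h1 : P m y0 = y0 := by
      rw [hPa]
      simp only [hy0, hφc]
      rw [lincomb_range v c m (fun i hi => (hn i hi).trans_le hm)]
    rw [← hPa, dist_eq_norm]
    have h2 : P m y - y = P m (y - y0) - (y - y0) := by
      rw [map_sub, h1]; abel
    rw [h2]
    rw [dist_eq_norm, lt_div_iff₀ (by positivity)] at hyy
    have h3 := norm_sub_le (P m (y - y0)) (y - y0)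
    have h4 := hPn m (y - y0)
    nlinarith [norm_nonneg (y - y0)]
  · intro a ha
    funext i
    have h1 := ((φ i).continuous.tendsto y).comp ha
    have h2 : Tendsto (fun m => φ i (∑ n ∈ Finset.range m, a n • v n)) atTop (𝓝 (a i)) := by
      refine tendsto_const_nhds.congr' ?_
      filter_upwards [eventually_gt_atTop i] with m hm
      simp [map_sum, hφ, hm]
    exact tendsto_nhds_unique h2 h1

open Filter Topology MeasureTheory TopologicalSpace

/-! ## The inductive construction of the coordinate functionals -/

section Constr
variable {X : Type*} [NormedAddCommGroup X] [NormedSpace ℝ X]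

/-- The scalar sequence `u` is the restriction to `x` of a functional of norm at most `r`. -/
def Bdd (x : ℕ → X) (r : ℝ) (u : ℕ → ℝ) : Prop :=
  ∀ c : ℕ →₀ ℝ, |Finsupp.linearCombination ℝ u c| ≤ r * ‖Finsupp.linearCombination ℝ x c‖

theorem lc_add (u v : ℕ → ℝ) (c : ℕ →₀ ℝ) : Finsupp.linearCombination ℝ (u + v) c =
    Finsupp.linearCombination ℝ u c + Finsupp.linearCombination ℝ v c := by
  simp only [Finsupp.linearCombination_apply, Finsupp.sum, ← Finset.sum_add_distrib]
  exact Finset.sum_congr rfl fun i _ => by simp [mul_add]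

theorem lc_smul (a : ℝ) (u : ℕ → ℝ) (c : ℕ →₀ ℝ) : Finsupp.linearCombination ℝ (a • u) c =
    a * Finsupp.linearCombination ℝ u c := by
  simp only [Finsupp.linearCombination_apply, Finsupp.sum, Finset.mul_sum]
  exact Finset.sum_congr rfl fun i _ => by simp; ring

theorem lc_zero (c : ℕ →₀ ℝ) : Finsupp.linearCombination ℝ (0 : ℕ → ℝ) c = 0 := by
  simp [Finsupp.linearCombination_apply]

variable {x : ℕ → X}

theorem Bdd.mono {r r' : ℝ} {u : ℕ → ℝ} (h : Bdd x r u) (hr : r ≤ r') : Bdd x r' u :=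
  fun c => (h c).trans (by gcongr)

theorem Bdd.add {r r' : ℝ} {u v : ℕ → ℝ} (h : Bdd x r u) (h' : Bdd x r' v) :
    Bdd x (r + r') (u + v) := fun c => by
  rw [lc_add, add_mul]
  exact (abs_add_le _ _).trans (add_le_add (h c) (h' c))

theorem Bdd.smul {r : ℝ} {u : ℕ → ℝ} (h : Bdd x r u) (a : ℝ) : Bdd x (|a| * r) (a • u) := fun c => by
  rw [lc_smul, abs_mul, mul_assoc]
  exact mul_le_mul_of_nonneg_left (h c) (abs_nonneg _)

theorem Bdd.zero {r : ℝ} (hr : 0 ≤ r) : Bdd x r 0 := fun c => by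
  rw [lc_zero, abs_zero]; positivity

theorem Bdd.sub {r r' : ℝ} {u v : ℕ → ℝ} (h : Bdd x r u) (h' : Bdd x r' v) :
    Bdd x (r + r') (u - v) := by
  have := h.add (h'.smul (-1))
  simpa [sub_eq_add_neg] using this

theorem Bdd.coord {r : ℝ} {u : ℕ → ℝ} (h : Bdd x r u) (j : ℕ) : |u j| ≤ r * ‖x j‖ := by
  have := h (Finsupp.single j 1)
  simpa using this

/-- partial sums -/
def ps (f : ℕ → ℕ → ℝ) (m : ℕ) (g : ℕ → ℝ) : ℕ → ℝ := ∑ i ∈ Finset.range m, g i • f i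

theorem ps_congr {f f' : ℕ → ℕ → ℝ} {m : ℕ} {g g' : ℕ → ℝ} (hf : ∀ i < m, f i = f' i)
    (hg : ∀ i < m, g i = g' i) : ps f m g = ps f' m g' :=
  Finset.sum_congr rfl fun i hi => by
    rw [hf i (Finset.mem_range.1 hi), hg i (Finset.mem_range.1 hi)]

theorem ps_add (f : ℕ → ℕ → ℝ) (m : ℕ) (g g' : ℕ → ℝ) : ps f m (g + g') = ps f m g + ps f m g' := by
  simp [ps, add_smul, Finset.sum_add_distrib]

theorem ps_smul (f : ℕ → ℕ → ℝ) (m : ℕ) (a : ℝ) (g : ℕ → ℝ) : ps f m (a • g) = a • ps f m g := by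
  simp [ps, Finset.smul_sum, mul_smul]

theorem ps_zero (f : ℕ → ℕ → ℝ) (m : ℕ) : ps f m 0 = 0 := by simp [ps]

theorem ps_apply (f : ℕ → ℕ → ℝ) (m : ℕ) (g : ℕ → ℝ) (j : ℕ) :
    ps f m g j = ∑ i ∈ Finset.range m, g i * f i j := by
  simp [ps, Finset.sum_apply]

/-- The constraints up to level `n`. -/
structure BB (x : ℕ → X) (f : ℕ → ℕ → ℝ) (N : ℕ → ℕ) (n : ℕ) (u g : ℕ → ℝ) : Prop where
  c1 : Bdd x 1 u
  c2 : ∀ i, |g i| ≤ 2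
  c3 : ∀ n' ≤ n, Bdd x 2 (ps f (N n') g)
  c4 : ∀ m ≤ N n, Bdd x 4 (ps f m g)
  c5 : ∀ k n' j, k ≤ n' → n' ≤ n → j < k → |ps f (N n') g j - u j| ≤ (1 / 2) ^ k
  c6 : ∀ k m j, N k ≤ m → m ≤ N n → k ≤ n → j < k → |ps f m g j - u j| ≤ 2 * (1 / 2) ^ k

theorem BB.congr {f f' : ℕ → ℕ → ℝ} {N N' : ℕ → ℕ} {n : ℕ} {u g : ℕ → ℝ} (h : BB x f N n u g)
    (hN : ∀ k ≤ n, N' k = N k) (hmon : ∀ k ≤ n, N k ≤ N n) (hf : ∀ i < N n, f' i = f i) : BB x f' N' n u g := by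
  have e : ∀ m ≤ N n, ps f' m g = ps f m g := fun m hm =>
    ps_congr (fun i hi => hf i (hi.trans_le hm)) fun i _ => rfl
  refine ⟨h.c1, h.c2, fun n' hn' => ?_, fun m hm => ?_, fun k n' j h1 h2 h3 => ?_, fun k m j h1 h2 h3 h4 => ?_⟩
  · rw [hN n' hn', e _ (hmon _ hn')]; exact h.c3 n' hn'
  · rw [hN n le_rfl] at hm; rw [e _ hm]; exact h.c4 m hm
  · rw [hN n' h2, e _ (hmon _ h2)]; exact h.c5 k n' j h1 h2 h3
  · rw [hN n le_rfl] at h2; rw [hN k h3] at h1; rw [e _ h2]; exact h.c6 k m j h1 h2 h3 h4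

theorem BB.zero (x : ℕ → X) (f : ℕ → ℕ → ℝ) (N : ℕ → ℕ) (n : ℕ) : BB x f N n 0 0 := by
  refine ⟨Bdd.zero (by norm_num), by simp, ?_, ?_, ?_, ?_⟩
  · intro n' _; rw [ps_zero]; exact Bdd.zero (by norm_num)
  · intro n' _; rw [ps_zero]; exact Bdd.zero (by norm_num)
  · intros; rw [ps_zero]; simp
  · intros; rw [ps_zero]; simp

/-- `f i0` is an admissible next correction. -/
def Good (x : ℕ → X) (f : ℕ → ℕ → ℝ) (N : ℕ → ℕ) (n : ℕ) (u g : ℕ → ℝ) (i0 : ℕ) : Prop :=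
  Bdd x (3 / 2) (ps f (N n) g + f i0) ∧
    ∀ j ≤ n, |ps f (N n) g j + f i0 j - u j| ≤ (1 / 2) ^ (n + 2)

theorem Good.congr {f f' : ℕ → ℕ → ℝ} {N N' : ℕ → ℕ} {n : ℕ} {u g g' : ℕ → ℝ} {i0 : ℕ}
    (h : Good x f N n u g i0) (hN : N' n = N n) (hf : ∀ i < N n, f' i = f i) (hfi : f' i0 = f i0)
    (hg : ∀ i < N n, g' i = g i) : Good x f' N' n u g' i0 := by
  unfold Good
  rw [hN, hfi, ps_congr hf hg]
  exact h

/-- Approximate nets. -/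
theorem net_exists (x : ℕ → X) (f : ℕ → ℕ → ℝ) (N : ℕ → ℕ) (n : ℕ) (τ : ℝ) (hτ : 0 < τ) :
    ∃ (q : ℕ) (U G : ℕ → ℕ → ℝ), 0 < q ∧ (∀ p, BB x f N n (U p) (G p)) ∧
      ∀ u g, BB x f N n u g → ∃ p < q, (∀ i < N n, |g i - G p i| ≤ τ) ∧ ∀ j ≤ n, |u j - U p j| ≤ τ := by
  classical
  set M := N n
  let Φ : (ℕ → ℝ) × (ℕ → ℝ) → (Fin M → ℝ) × (Fin (n + 1) → ℝ) :=
    fun z => (fun i => z.2 i, fun j => z.1 j)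
  let S : Set ((ℕ → ℝ) × (ℕ → ℝ)) := {z | BB x f N n z.1 z.2}
  have hb : Bornology.IsBounded (Φ '' S) := by
    rw [isBounded_iff_forall_norm_le]
    refine ⟨max 2 (∑ j ∈ Finset.range (n + 1), ‖x j‖), ?_⟩
    rintro _ ⟨z, hz, rfl⟩
    have hz : BB x f N n z.1 z.2 := hz
    rw [Prod.norm_def]
    refine max_le_max ?_ ?_
    · exact (pi_norm_le_iff_of_nonneg (by norm_num)).2 fun i => hz.c2 i
    · refine (pi_norm_le_iff_of_nonneg (Finset.sum_nonneg fun _ _ => norm_nonneg _)).2 fun j => ?_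
      refine (hz.c1.coord j).trans ?_
      rw [one_mul]
      exact Finset.single_le_sum (f := fun j => ‖x j‖) (fun _ _ => norm_nonneg _) (Finset.mem_range.2 j.2)
  have htb : TotallyBounded (Φ '' S) :=
    (Bornology.IsBounded.isCompact_closure hb).totallyBounded.subset subset_closure
  obtain ⟨t, hts, htf, hcov⟩ := Metric.finite_approx_of_totallyBounded htb τ hτ
  obtain ⟨q, e, he⟩ : ∃ (q : ℕ) (e : Fin q → (Fin M → ℝ) × (Fin (n + 1) → ℝ)), Set.range e = t := by
    obtain ⟨q, e, he⟩ := htf.fin_embedding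
    exact ⟨q, e, he⟩
  have hmem : ∀ p, ∃ z : (ℕ → ℝ) × (ℕ → ℝ), BB x f N n z.1 z.2 ∧ Φ z = e p := fun p => by
    obtain ⟨z, hz, h⟩ := hts (he ▸ Set.mem_range_self p : e p ∈ t)
    exact ⟨z, hz, h⟩
  choose Z hZ hZe using hmem
  have hcov' : ∀ u g, BB x f N n u g → ∃ p : Fin q, (∀ i < N n, |g i - (Z p).2 i| ≤ τ) ∧
      ∀ j ≤ n, |u j - (Z p).1 j| ≤ τ := by
    intro u g h
    obtain ⟨y, hy, hd⟩ := Set.mem_iUnion₂.1 (hcov ⟨(u, g), h, rfl⟩)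
    rw [← he] at hy
    obtain ⟨p, rfl⟩ := hy
    rw [← hZe, Metric.mem_ball, Prod.dist_eq, max_lt_iff] at hd
    refine ⟨p, fun i hi => ?_, fun j hj => ?_⟩
    · exact ((dist_le_pi_dist _ _ (⟨i, hi⟩ : Fin M)).trans hd.1.le)
    · exact ((dist_le_pi_dist _ _ (⟨j, by omega⟩ : Fin (n + 1))).trans hd.2.le)
  obtain ⟨p0, -⟩ := hcov' 0 0 (BB.zero x f N n)
  refine ⟨q, fun p => if h : p < q then (Z ⟨p, h⟩).1 else 0, fun p => if h : p < q then (Z ⟨p, h⟩).2 else 0,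
    p0.pos, fun p => ?_, fun u g h => ?_⟩
  · by_cases h : p < q
    · simp only [h, dif_pos]; exact hZ _
    · simp only [h, dif_neg, not_false_eq_true]; exact BB.zero x f N n
  · obtain ⟨p, h1, h2⟩ := hcov' u g h
    refine ⟨p, p.2, ?_, ?_⟩
    · simpa using h1
    · simpa using h2

/-- The step of the construction. -/
theorem step (x : ℕ → X) (f : ℕ → ℕ → ℝ) (N : ℕ → ℕ) (n : ℕ) (hmon : ∀ k ≤ n, N k ≤ N n)
    (hf : ∀ i, Bdd x 3 (f i)) :
    ∃ (f' : ℕ → ℕ → ℝ) (N' : ℕ → ℕ), (∀ i, Bdd x 3 (f' i)) ∧ (∀ k ≤ n, N' k = N k) ∧ (∀ i < N n, f' i = f i) ∧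
      N n < N' (n + 1) ∧
      (∀ u g, BB x f' N' n u g → ∃ i0, N n ≤ i0 ∧ i0 < N' (n + 1) ∧ Good x f' N' n u g i0) ∧
      (∀ i0, N n ≤ i0 → i0 < N' (n + 1) → ∃ u g, BB x f' N' n u g ∧ Good x f' N' n u g i0) := by
  classical
  set M := N n with hM
  set D := ∑ j ∈ Finset.range (n + 1), ‖x j‖ with hD
  have hD0 : 0 ≤ D := Finset.sum_nonneg fun _ _ => norm_nonneg _
  have hxD : ∀ j ≤ n, ‖x j‖ ≤ D := fun j hj =>
    Finset.single_le_sum (f := fun j => ‖x j‖) (fun _ _ => norm_nonneg _) (Finset.mem_range.2 (by omega))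
  set τ : ℝ := (1 / 2) ^ (n + 2) / (1 + 3 * M + 3 * M * D) with hτd
  have hden : 0 < 1 + 3 * (M:ℝ) + 3 * M * D := by positivity
  have hτ : 0 < τ := by positivity
  have hτe : τ * (1 + 3 * M + 3 * M * D) = (1 / 2) ^ (n + 2) := div_mul_cancel₀ _ hden.ne'
  have hhalf : ((1:ℝ) / 2) ^ (n + 2) ≤ 1 / 2 := by
    calc ((1:ℝ) / 2) ^ (n + 2) ≤ (1 / 2) ^ 1 := pow_le_pow_of_le_one (by norm_num) (by norm_num) (by omega)
      _ = 1 / 2 := by norm_num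
  obtain ⟨q, U, G, hq, hUG, hnet⟩ := net_exists x f N n τ hτ
  let f' : ℕ → ℕ → ℝ := fun i => if i < M then f i else U (i - M) - ps f M (G (i - M))
  let N' : ℕ → ℕ := Function.update N (n + 1) (M + q)
  have hN' : ∀ k ≤ n, N' k = N k := fun k hk => Function.update_of_ne (by omega) _ _
  have hN1 : N' (n + 1) = M + q := Function.update_self _ _ _
  have hf'1 : ∀ i < M, f' i = f i := fun i hi => if_pos hi
  have hf'2 : ∀ p, f' (M + p) = U p - ps f M (G p) := fun p => by
    show (if M + p < M then _ else _) = _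
    rw [if_neg (by omega)]
    simp
  -- the key estimate
  have key : ∀ u g p, BB x f' N' n u g → (∀ i < M, |g i - G p i| ≤ τ) → (∀ j ≤ n, |u j - U p j| ≤ τ) →
      Good x f' N' n u g (M + p) := by
    intro u g p _ h1 h2
    have e : ps f' M g + f' (M + p) = U p + ps f M (g - G p) := by
      rw [hf'2, ps_congr hf'1 (fun i _ => rfl), sub_eq_add_neg g, ps_add]
      have : ps f M (-G p) = - ps f M (G p) := by
        rw [← neg_one_smul ℝ (G p), ps_smul, neg_one_smul]
      rw [this]; abel
    have hps : ∀ m ≤ M, Bdd x (3 * m * τ) (ps f m (g - G p)) := by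
      intro m
      induction m with
      | zero => intro _; simpa [ps] using (Bdd.zero (x := x) (r := 0) le_rfl)
      | succ m ih =>
        intro hm
        have h3 : ps f (m + 1) (g - G p) = ps f m (g - G p) + (g - G p) m • f m := by
          simp [ps, Finset.sum_range_succ]
        rw [h3]
        refine ((ih (by omega)).add ((hf m).smul _)).mono ?_
        have := h1 m (by omega)
        rw [Pi.sub_apply]
        push_cast
        nlinarith
    have hps := hps M le_rfl
    have hMM : N' n = M := hN' n le_rfl
    refine ⟨?_, fun j hj => ?_⟩
    · rw [hMM, e]
      refine ((hUG p).c1.add hps).mono ?_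
      have : 0 ≤ τ * (1 + 3 * M * D) := by positivity
      nlinarith
    · have e' := congrFun e j
      rw [Pi.add_apply, Pi.add_apply] at e'
      rw [hMM, e']
      have h3 := hps.coord j
      have h4 : 3 * M * τ * ‖x j‖ ≤ 3 * M * τ * D := by
        have := hxD j hj
        gcongr
      have h5 := h2 j hj
      have h6 : 0 ≤ τ * (3 * M) := by positivity
      rw [abs_le] at h3 h5 ⊢
      constructor <;> nlinarith
  refine ⟨f', N', ?_, hN', hf'1, by omega, ?_, ?_⟩
  · intro i
    by_cases hi : i < M
    · rw [hf'1 i hi]; exact hf i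
    · obtain ⟨p, rfl⟩ := Nat.exists_eq_add_of_le (not_lt.1 hi)
      rw [hf'2]
      exact ((hUG p).c1.sub ((hUG p).c3 n le_rfl)).mono (by norm_num)
  · intro u g h
    have h0 : BB x f N n u g := by
      refine h.congr (fun k hk => (hN' k hk).symm) (fun k hk => ?_) (fun i hi => ?_)
      · rw [hN' k hk, hN' n le_rfl]; exact hmon k hk
      · rw [hN' n le_rfl] at hi; exact (hf'1 i hi).symm
    obtain ⟨p, hp, h1, h2⟩ := hnet u g h0
    exact ⟨M + p, by omega, by omega, key u g p h h1 h2⟩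
  · intro i0 h1 h2
    obtain ⟨p, rfl⟩ := Nat.exists_eq_add_of_le h1
    have h0 : BB x f' N' n (U p) (G p) := (hUG p).congr hN' hmon hf'1
    exact ⟨U p, G p, h0, key _ _ p h0 (fun i _ => by simp [hτ.le]) (fun i _ => by simp [hτ.le])⟩

/-- The completed construction. -/
theorem construct (x : ℕ → X) : ∃ (f : ℕ → ℕ → ℝ) (N : ℕ → ℕ), N 0 = 0 ∧ StrictMono N ∧
    (∀ n u g, BB x f N n u g → ∃ i0, N n ≤ i0 ∧ i0 < N (n + 1) ∧ Good x f N n u g i0) ∧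
    (∀ n i0, N n ≤ i0 → i0 < N (n + 1) → ∃ u g, BB x f N n u g ∧ Good x f N n u g i0) := by
  classical
  let P : ℕ → (ℕ → ℕ → ℝ) × (ℕ → ℕ) → Prop := fun n s => (∀ i, Bdd x 3 (s.1 i)) ∧ ∀ k ≤ n, s.2 k ≤ s.2 n
  have hstep : ∀ n (s : {s // P n s}), ∃ s' : {s // P (n + 1) s}, (∀ k ≤ n, s'.1.2 k = s.1.2 k) ∧
      (∀ i < s.1.2 n, s'.1.1 i = s.1.1 i) ∧ s.1.2 n < s'.1.2 (n + 1) ∧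
      (∀ u g, BB x s'.1.1 s'.1.2 n u g → ∃ i0, s.1.2 n ≤ i0 ∧ i0 < s'.1.2 (n + 1) ∧ Good x s'.1.1 s'.1.2 n u g i0) ∧
      (∀ i0, s.1.2 n ≤ i0 → i0 < s'.1.2 (n + 1) → ∃ u g, BB x s'.1.1 s'.1.2 n u g ∧ Good x s'.1.1 s'.1.2 n u g i0) := by
    rintro n ⟨⟨f, N⟩, h1, h2⟩
    obtain ⟨f', N', a1, a2, a3, a4, a5, a6⟩ := step x f N n h2 h1
    refine ⟨⟨⟨f', N'⟩, a1, fun k hk => ?_⟩, a2, a3, a4, a5, a6⟩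
    rcases Nat.lt_or_ge k (n + 1) with h | h
    · show N' k ≤ N' (n + 1)
      rw [a2 k (by omega)]
      exact (h2 k (by omega)).trans a4.le
    · rw [le_antisymm hk h]
  choose nx n1 n2 n3 n4 n5 using hstep
  let st : ∀ n, {s // P n s} := fun n => Nat.rec ⟨(0, 0), fun i => Bdd.zero (by norm_num), fun k _ => le_rfl⟩
    (fun n s => nx n s) n
  have hst : ∀ n, st (n + 1) = nx n (st n) := fun n => rfl
  let N : ℕ → ℕ := fun n => (st n).1.2 n
  let f : ℕ → ℕ → ℝ := fun i => (st (i + 1)).1.1 i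
  have hN : ∀ m k, k ≤ m → (st m).1.2 k = N k := by
    intro m
    induction m with
    | zero => intro k hk; rw [Nat.le_zero.1 hk]
    | succ m ih =>
      intro k hk
      rcases Nat.lt_or_ge k (m + 1) with h | h
      · rw [hst, n1 m _ k (by omega)]; exact ih k (by omega)
      · rw [le_antisymm hk h]
  have hmono : StrictMono N := strictMono_nat_of_lt_succ fun n => n3 n (st n)
  have hfst : ∀ m m', m ≤ m' → ∀ i < N m, (st m').1.1 i = (st m).1.1 i := by
    intro m m' h
    induction m', h using Nat.le_induction with
    | base => intros; rfl
    | succ m' h ih =>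
      intro i hi
      rw [hst, n2 m' _ i (hi.trans_le (hmono.monotone h)), ih i hi]
  have hf : ∀ m, ∀ i < N m, f i = (st m).1.1 i := by
    intro m i hi
    show (st (i + 1)).1.1 i = _
    rcases le_total m (i + 1) with h | h
    · exact hfst m _ h i hi
    · exact (hfst _ _ h i ((Nat.lt_succ_self i).trans_le (hmono.le_apply))).symm
  have cb : ∀ n u g, BB x f N n u g ↔ BB x (st (n + 1)).1.1 (st (n + 1)).1.2 n u g := by
    intro n u g
    have hle : N n ≤ N (n + 1) := hmono.monotone n.le_succ
    constructor
    · intro h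
      exact h.congr (fun k hk => hN (n+1) k (by omega)) (fun k hk => hmono.monotone hk)
        (fun i hi => (hf (n + 1) i (by omega)).symm)
    · intro h
      refine h.congr (fun k hk => (hN (n+1) k (by omega)).symm) (fun k hk => ?_) (fun i hi => ?_)
      · rw [hN (n+1) k (by omega), hN (n+1) n (by omega)]; exact hmono.monotone hk
      · rw [hN (n+1) n (by omega)] at hi
        exact hf (n + 1) i (by omega)
  have cg : ∀ n u g i0, i0 < N (n + 1) → Good x (st (n + 1)).1.1 (st (n + 1)).1.2 n u g i0 → Good x f N n u g i0 := by
    intro n u g i0 h0 h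
    have hle : N n ≤ N (n + 1) := hmono.monotone n.le_succ
    refine h.congr (hN (n+1) n (by omega)).symm (fun i hi => ?_) (hf (n+1) _ h0) (fun _ _ => rfl)
    rw [hN (n+1) n (by omega)] at hi
    exact hf (n + 1) i (by omega)
  refine ⟨f, N, rfl, hmono, fun n u g h => ?_, fun n i0 h1 h2 => ?_⟩
  · obtain ⟨i0, a, b, c⟩ := n4 n (st n) u g ((cb n u g).1 h)
    exact ⟨i0, a, b, cg n u g i0 b c⟩
  · obtain ⟨u, g, a, b⟩ := n5 n (st n) i0 h1 h2
    exact ⟨u, g, (cb n u g).2 a, cg n u g i0 h2 b⟩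

end Constr

open Filter Topology MeasureTheory TopologicalSpace

section Constr2
variable {X : Type*} [NormedAddCommGroup X] [NormedSpace ℝ X] {x : ℕ → X}
  {f : ℕ → ℕ → ℝ} {N : ℕ → ℕ}

/-- All constraints. -/
structure KK (x : ℕ → X) (f : ℕ → ℕ → ℝ) (N : ℕ → ℕ) (u g : ℕ → ℝ) : Prop where
  c1 : Bdd x 1 u
  c2 : ∀ i, |g i| ≤ 2
  c3 : ∀ n', Bdd x 2 (ps f (N n') g)
  c4 : ∀ m, Bdd x 4 (ps f m g)
  c5 : ∀ k n' j, k ≤ n' → j < k → |ps f (N n') g j - u j| ≤ (1 / 2) ^ k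
  c6 : ∀ k m j, N k ≤ m → j < k → |ps f m g j - u j| ≤ 2 * (1 / 2) ^ k

theorem KK.bb {u g : ℕ → ℝ} (h : KK x f N u g) (n : ℕ) : BB x f N n u g :=
  ⟨h.c1, h.c2, fun n' _ => h.c3 n', fun m _ => h.c4 m, fun k n' j a _ b => h.c5 k n' j a b,
    fun k m j a _ _ b => h.c6 k m j a b⟩

theorem KK.zero (x : ℕ → X) (f : ℕ → ℕ → ℝ) (N : ℕ → ℕ) : KK x f N 0 0 := by
  refine ⟨Bdd.zero (by norm_num), by simp, ?_, ?_, ?_, ?_⟩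
  · intro n'; rw [ps_zero]; exact Bdd.zero (by norm_num)
  · intro n'; rw [ps_zero]; exact Bdd.zero (by norm_num)
  · intros; rw [ps_zero]; simp
  · intros; rw [ps_zero]; simp

theorem BB.congr_g {n : ℕ} {u g g' : ℕ → ℝ} (h : BB x f N n u g) (hN : StrictMono N)
    (hg : ∀ i < N n, g' i = g i) (h2 : ∀ i, |g' i| ≤ 2) : BB x f N n u g' := by
  have e : ∀ m ≤ N n, ps f m g' = ps f m g := fun m hm =>
    ps_congr (fun _ _ => rfl) fun i hi => hg i (hi.trans_le hm)
  refine ⟨h.c1, h2, fun n' hn' => ?_, fun m hm => ?_, fun k n' j a b c => ?_, fun k m j a b c d => ?_⟩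
  · rw [e _ (hN.monotone hn')]; exact h.c3 n' hn'
  · rw [e _ hm]; exact h.c4 m hm
  · rw [e _ (hN.monotone b)]; exact h.c5 k n' j a b c
  · rw [e _ b]; exact h.c6 k m j a b c d

/-- On the `n`-th block `g` is the indicator of `i0`. -/
def Pat (N : ℕ → ℕ) (n : ℕ) (g : ℕ → ℝ) (i0 : ℕ) : Prop :=
  N n ≤ i0 ∧ i0 < N (n + 1) ∧ ∀ i, N n ≤ i → i < N (n + 1) → g i = if i = i0 then 1 else 0

theorem Pat.blk {n : ℕ} {g : ℕ → ℝ} {i0 : ℕ} (h : Pat N n g i0) (m : ℕ) (h1 : N n ≤ m) (h2 : m ≤ N (n + 1)) :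
    ps f m g = ps f (N n) g + if i0 < m then f i0 else 0 := by
  induction m, h1 using Nat.le_induction with
  | base => rw [if_neg (by have := h.1; omega), add_zero]
  | succ m hm ih =>
    have e : ps f (m + 1) g = ps f m g + g m • f m := by simp [ps, Finset.sum_range_succ]
    rw [e, ih (by omega), h.2.2 m hm (by omega)]
    rcases lt_trichotomy i0 m with a | a | a
    · rw [if_pos a, if_neg (by omega), if_pos (by omega)]; simp
    · rw [if_neg (by omega), if_pos a.symm, if_pos (by omega), a]; simp
    · rw [if_neg (by omega), if_neg (by omega), if_neg (by omega)]; simp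

theorem half_pow_le {k m : ℕ} (h : k ≤ m) : ((1:ℝ) / 2) ^ m ≤ (1 / 2) ^ k :=
  pow_le_pow_of_le_one (by norm_num) (by norm_num) h

theorem BB.succ {n : ℕ} {u g : ℕ → ℝ} {i0 : ℕ} (h : BB x f N n u g) (hN : StrictMono N) (hp : Pat N n g i0)
    (hg : Good x f N n u g i0) : BB x f N (n + 1) u g := by
  have hNn : N n < N (n + 1) := hN n.lt_succ_self
  have e1 : ps f (N (n + 1)) g = ps f (N n) g + f i0 := by
    rw [hp.blk _ hNn.le le_rfl, if_pos hp.2.1]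
  refine ⟨h.c1, h.c2, fun n' hn' => ?_, fun m hm => ?_, fun k n' j a b c => ?_, fun k m j a b c d => ?_⟩
  · rcases Nat.lt_or_ge n' (n + 1) with b | b
    · exact h.c3 n' (by omega)
    · rw [le_antisymm hn' b, e1]; exact hg.1.mono (by norm_num)
  · rcases le_total m (N n) with b | b
    · exact h.c4 m b
    · rw [hp.blk m b hm]
      split_ifs
      · exact hg.1.mono (by norm_num)
      · rw [add_zero]; exact (h.c3 n le_rfl).mono (by norm_num)
  · rcases Nat.lt_or_ge n' (n + 1) with b' | b'
    · exact h.c5 k n' j a (by omega) c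
    · rw [le_antisymm b b', e1]
      exact (hg.2 j (by omega)).trans (half_pow_le (by omega))
  · have hpos : (0:ℝ) < (1 / 2) ^ k := by positivity
    rcases le_or_gt m (N n) with b' | b'
    · exact h.c6 k m j a b' (hN.le_iff_le.1 (a.trans b')) d
    · rw [hp.blk m b'.le b]
      split_ifs with hi
      · have h3 : ((1:ℝ) / 2) ^ (n + 2) ≤ (1 / 2) ^ k := half_pow_le (by omega)
        have := hg.2 j (by omega)
        rw [Pi.add_apply]
        linarith
      · rw [add_zero]
        have hk : k ≤ n := by
          have : N k < N (n + 1) := by have := hp.2.1; omega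
          have := hN.lt_iff_lt.1 this
          omega
        have := h.c5 k n j hk le_rfl d
        linarith

theorem ext_exists (hN : StrictMono N)
    (hE : ∀ n u g, BB x f N n u g → ∃ i0, N n ≤ i0 ∧ i0 < N (n + 1) ∧ Good x f N n u g i0)
    {n0 : ℕ} {u g : ℕ → ℝ} (h : BB x f N n0 u g) :
    ∃ g' : ℕ → ℝ, (∀ i < N n0, g' i = g i) ∧ ∀ n, n0 ≤ n → BB x f N n u g' ∧
      ∃ i0, Pat N n g' i0 ∧ Good x f N n u g' i0 := by
  classical
  have hstep : ∀ k (g : {g // BB x f N (n0 + k) u g}), ∃ g' : {g // BB x f N (n0 + (k + 1)) u g},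
      (∀ i < N (n0 + k), g'.1 i = g.1 i) ∧ ∃ i0, Pat N (n0 + k) g'.1 i0 ∧ Good x f N (n0 + k) u g'.1 i0 := by
    rintro k ⟨g, hg⟩
    obtain ⟨i0, a, b, c⟩ := hE _ _ _ hg
    let g' : ℕ → ℝ := fun i => if i < N (n0 + k) then g i else if i = i0 then 1 else 0
    have h1 : ∀ i < N (n0 + k), g' i = g i := fun i hi => if_pos hi
    have h2 : ∀ i, |g' i| ≤ 2 := fun i => by
      by_cases hi : i < N (n0 + k)
      · rw [h1 i hi]; exact hg.c2 i
      · show |if i < N (n0 + k) then g i else if i = i0 then 1 else 0| ≤ 2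
        rw [if_neg hi]; split_ifs <;> norm_num
    have hp : Pat N (n0 + k) g' i0 := ⟨a, b, fun i hi _ => if_neg (not_lt.2 hi)⟩
    have hG : Good x f N (n0 + k) u g' i0 := c.congr rfl (fun _ _ => rfl) rfl h1
    exact ⟨⟨g', (hg.congr_g hN h1 h2).succ hN hp hG⟩, h1, i0, hp, hG⟩
  choose nx n1 n2 using hstep
  let gs : ∀ k, {g // BB x f N (n0 + k) u g} := fun k => Nat.rec ⟨g, h⟩ (fun k g => nx k g) k
  have hgs : ∀ k, gs (k + 1) = nx k (gs k) := fun k => rfl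
  have hag : ∀ k k', k ≤ k' → ∀ i < N (n0 + k), (gs k').1 i = (gs k).1 i := by
    intro k k' hk
    induction k', hk using Nat.le_induction with
    | base => intros; rfl
    | succ k' hk ih =>
      intro i hi
      rw [hgs, n1 k' _ i (hi.trans_le (hN.monotone (by omega))), ih i hi]
  let g' : ℕ → ℝ := fun i => (gs (i + 1)).1 i
  have hg' : ∀ k, ∀ i < N (n0 + k), g' i = (gs k).1 i := by
    intro k i hi
    show (gs (i + 1)).1 i = _
    rcases le_total k (i + 1) with h | h
    · exact hag k _ h i hi
    · refine (hag _ _ h i ?_).symm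
      have : n0 + (i + 1) ≤ N (n0 + (i + 1)) := hN.le_apply
      omega
  refine ⟨g', hg' 0, fun n hn => ?_⟩
  obtain ⟨k, rfl⟩ := Nat.exists_eq_add_of_le hn
  refine ⟨(gs k).2.congr_g hN (hg' k) fun i => (gs (i + 1)).2.c2 i, ?_⟩
  obtain ⟨i0, hp, hG⟩ := n2 k (gs k)
  rw [← hgs] at hp hG
  have hlt : N (n0 + k) < N (n0 + k + 1) := hN (Nat.lt_succ_self _)
  refine ⟨i0, ⟨hp.1, hp.2.1, fun i a b => ?_⟩, hG.congr rfl (fun _ _ => rfl) rfl fun i hi => ?_⟩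
  · rw [hg' (k + 1) i b]; exact hp.2.2 i a b
  · exact hg' (k + 1) i (hi.trans hlt)

theorem exists_block (hN : StrictMono N) {n0 : ℕ} (i : ℕ) (hi : N n0 ≤ i) :
    ∃ n, n0 ≤ n ∧ N n ≤ i ∧ i < N (n + 1) := by
  induction i, hi using Nat.le_induction with
  | base => exact ⟨n0, le_rfl, le_rfl, hN n0.lt_succ_self⟩
  | succ i hi ih =>
    obtain ⟨n, a, b, c⟩ := ih
    rcases Nat.lt_or_ge (i + 1) (N (n + 1)) with h | h
    · exact ⟨n, a, by omega, h⟩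
    · have : N (n + 1) < N (n + 1 + 1) := hN (Nat.lt_succ_self (n + 1))
      exact ⟨n + 1, by omega, by omega, by omega⟩

theorem pert (hN : StrictMono N) {n0 : ℕ} {u g h : ℕ → ℝ} {a : ℝ}
    (hE : ∀ n, n0 ≤ n → BB x f N n u g ∧ ∃ i0, Pat N n g i0 ∧ Good x f N n u g i0)
    (hh : KK x f N 0 h) (h0 : ∀ i < N n0, h i = 0) (ha : |a| ≤ 1 / 4) : KK x f N u (g + a • h) := by
  have hB := (hE n0 le_rfl).1
  have e0 : ∀ m ≤ N n0, ps f m (g + a • h) = ps f m g := fun m hm =>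
    ps_congr (fun _ _ => rfl) fun i hi => by simp [h0 i (hi.trans_le hm)]
  have e1 : ∀ m, ps f m (g + a • h) = ps f m g + a • ps f m h := fun m => by rw [ps_add, ps_smul]
  have ha0 := abs_nonneg a
  have t3 : ∀ n', n0 < n' → Bdd x (3 / 2) (ps f (N n') g) ∧ ∀ j < n', |ps f (N n') g j - u j| ≤ (1 / 2) ^ (n' + 1) := by
    intro n' hn'
    obtain ⟨n, rfl⟩ : ∃ n, n' = n + 1 := ⟨n' - 1, by omega⟩
    obtain ⟨-, i0, hp, hG⟩ := hE n (by omega)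
    rw [hp.blk _ (hN.monotone n.le_succ) le_rfl, if_pos hp.2.1]
    exact ⟨hG.1, fun j hj => hG.2 j (by omega)⟩
  have t4 : ∀ m, N n0 < m → ∃ n n', n0 ≤ n ∧ N n ≤ m ∧ m < N (n + 1) ∧ n ≤ n' ∧ n0 ≤ n' ∧ ps f m g = ps f (N n') g := by
    intro m hm
    obtain ⟨n, b1, b2, b3⟩ := exists_block hN m hm.le
    obtain ⟨-, i0, hp, hG⟩ := hE n b1
    by_cases hi : i0 < m
    · refine ⟨n, n + 1, b1, b2, b3, by omega, by omega, ?_⟩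
      rw [hp.blk _ b2 b3.le, if_pos hi, hp.blk _ (hN.monotone n.le_succ) le_rfl, if_pos hp.2.1]
    · refine ⟨n, n, b1, b2, b3, by omega, by omega, ?_⟩
      rw [hp.blk _ b2 b3.le, if_neg hi, add_zero]
  refine ⟨hB.c1, fun i => ?_, fun n' => ?_, fun m => ?_, fun k n' j b1 b2 => ?_, fun k m j b1 b2 => ?_⟩
  · rcases Nat.lt_or_ge i (N n0) with hi | hi
    · simpa [h0 i hi] using hB.c2 i
    · obtain ⟨n, b1, b2, b3⟩ := exists_block hN i hi
      obtain ⟨-, i0, hp, hG⟩ := hE n b1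
      have e : |g i| ≤ 1 := by
        rw [hp.2.2 i b2 b3]; split_ifs <;> norm_num
      calc |(g + a • h) i| = |g i + a * h i| := by simp
        _ ≤ |g i| + |a| * |h i| := by rw [← abs_mul]; exact abs_add_le _ _
        _ ≤ 1 + 1 / 4 * 2 := by
          have := hh.c2 i
          gcongr
        _ ≤ 2 := by norm_num
  · rcases Nat.lt_or_ge n0 n' with hn | hn
    · rw [e1]
      refine ((t3 n' hn).1.add ((hh.c3 n').smul a)).mono ?_
      linarith
    · rw [e0 _ (hN.monotone hn)]; exact hB.c3 n' hn
  · rcases Nat.lt_or_ge (N n0) m with hn | hn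
    · obtain ⟨n, n', -, -, -, -, c1, c2⟩ := t4 m hn
      rw [e1, c2]
      refine (((hE n' c1).1.c3 n' le_rfl).add ((hh.c4 m).smul a)).mono ?_
      linarith
    · rw [e0 _ hn]; exact hB.c4 m hn
  · rcases Nat.lt_or_ge n0 n' with hn | hn
    · rw [e1]
      have q1 := (t3 n' hn).2 j (by omega)
      have q2 := hh.c5 k n' j b1 b2
      have q3 : ((1:ℝ) / 2) ^ (n' + 1) ≤ (1 / 2) ^ (k + 1) := half_pow_le (by omega)
      have q4 : (0:ℝ) < (1 / 2) ^ k := by positivity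
      rw [pow_succ _ k] at q3
      rw [Pi.zero_apply, sub_zero] at q2
      have q5 : |a * ps f (N n') h j| ≤ 1 / 4 * (1 / 2) ^ k := by
        rw [abs_mul]; gcongr
      rw [Pi.add_apply, Pi.smul_apply, smul_eq_mul]
      rw [abs_le] at q1 q5 ⊢
      constructor <;> linarith
    · rw [e0 _ (hN.monotone hn)]; exact hB.c5 k n' j b1 hn b2
  · rcases Nat.lt_or_ge (N n0) m with hn | hn
    · obtain ⟨n, n', c0, c1, c2, c3, c4, c5⟩ := t4 m hn
      have hk : k ≤ n := by
        have := hN.lt_iff_lt.1 (b1.trans_lt c2)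
        omega
      have q1 := (hE n' c4).1.c5 k n' j (hk.trans c3) le_rfl b2
      have q2 := hh.c6 k m j b1 b2
      have q4 : (0:ℝ) < (1 / 2) ^ k := by positivity
      rw [Pi.zero_apply, sub_zero] at q2
      have q5 : |a * ps f m h j| ≤ 1 / 4 * (2 * (1 / 2) ^ k) := by
        rw [abs_mul]; gcongr
      rw [e1, c5, Pi.add_apply, Pi.smul_apply, smul_eq_mul]
      rw [abs_le] at q1 q5 ⊢
      constructor <;> linarith
    · rw [e0 _ hn]; exact hB.c6 k m j b1 hn (hN.le_iff_le.1 (b1.trans hn)) b2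

theorem trunc {u g : ℕ → ℝ} (h : KK x f N u g) (hN : StrictMono N) (m : ℕ) :
    KK x f N ((1 / 8 : ℝ) • ps f m g) (fun i => if i < m then (1 / 8) * g i else 0) := by
  have e : ∀ m', ps f m' (fun i => if i < m then (1 / 8) * g i else 0) = (1 / 8 : ℝ) • ps f (min m m') g := by
    intro m'
    induction m' with
    | zero => simp [ps]
    | succ m' ih =>
      have e1 : ∀ g : ℕ → ℝ, ps f (m' + 1) g = ps f m' g + g m' • f m' := fun g => by
        simp [ps, Finset.sum_range_succ]
      rw [e1, ih]
      by_cases hm : m' < m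
      · rw [if_pos hm, min_eq_right hm.le, min_eq_right hm, e1, smul_add, smul_smul]
      · rw [if_neg hm, min_eq_left (by omega), min_eq_left (by omega)]; simp
  have a8 : |(1 / 8 : ℝ)| = 1 / 8 := by norm_num
  refine ⟨?_, fun i => ?_, fun n' => ?_, fun m' => ?_, fun k n' j b1 b2 => ?_, fun k m' j b1 b2 => ?_⟩
  · refine ((h.c4 m).smul _).mono (by rw [a8]; norm_num)
  · show |if i < m then (1 / 8) * g i else 0| ≤ 2
    split_ifs
    · rw [abs_mul, a8]; linarith [h.c2 i]
    · norm_num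
  · rw [e]; exact ((h.c4 _).smul _).mono (by rw [a8]; norm_num)
  · rw [e]; exact ((h.c4 _).smul _).mono (by rw [a8]; norm_num)
  · have q4 : (0:ℝ) < (1 / 2) ^ k := by positivity
    rw [e]
    rcases le_total m (N n') with hm | hm
    · rw [min_eq_left hm, sub_self, abs_zero]; positivity
    · rw [min_eq_right hm, Pi.smul_apply, Pi.smul_apply, smul_eq_mul, smul_eq_mul]
      have q1 := h.c5 k n' j b1 b2
      have q2 := h.c6 k m j ((hN.monotone b1).trans hm) b2
      rw [abs_le] at q1 q2 ⊢
      constructor <;> linarith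
  · have q4 : (0:ℝ) < (1 / 2) ^ k := by positivity
    rw [e]
    rcases le_total m m' with hm | hm
    · rw [min_eq_left hm, sub_self, abs_zero]; positivity
    · rw [min_eq_right hm, Pi.smul_apply, Pi.smul_apply, smul_eq_mul, smul_eq_mul]
      have q1 := h.c6 k m' j b1 b2
      have q2 := h.c6 k m j (b1.trans hm) b2
      rw [abs_le] at q1 q2 ⊢
      constructor <;> linarith

/-- The points of `K`: extension and perturbation combined. -/
theorem KK_of_ext (hN : StrictMono N) {n0 : ℕ} {u g : ℕ → ℝ}
    (hE : ∀ n, n0 ≤ n → BB x f N n u g ∧ ∃ i0, Pat N n g i0 ∧ Good x f N n u g i0) : KK x f N u g := by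
  have := pert (a := 0) hN hE (KK.zero x f N) (fun _ _ => rfl) (by norm_num)
  simpa using this

end Constr2

open Filter Topology MeasureTheory TopologicalSpace

section Real1
variable {X : Type*} [NormedAddCommGroup X] [NormedSpace ℝ X]

theorem continuous_lc {α : Type*} [TopologicalSpace α] {u : α → ℕ → ℝ} (hu : Continuous u) (c : ℕ →₀ ℝ) :
    Continuous fun p => Finsupp.linearCombination ℝ (u p) c := by
  simp only [Finsupp.linearCombination_apply, Finsupp.sum]
  exact continuous_finsetSum _ fun i _ => ((continuous_apply i).comp hu).const_smul (c i)

theorem continuous_ps (f : ℕ → ℕ → ℝ) (m : ℕ) : Continuous fun g : ℕ → ℝ => ps f m g := by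
  unfold ps
  exact continuous_finsetSum _ fun i _ => (continuous_apply i).smul continuous_const

theorem isClosed_Bdd {α : Type*} [TopologicalSpace α] (x : ℕ → X) (r : ℝ) {u : α → ℕ → ℝ} (hu : Continuous u) :
    IsClosed {p | Bdd x r (u p)} := by
  have : {p | Bdd x r (u p)} = ⋂ c : ℕ →₀ ℝ,
      {p | |Finsupp.linearCombination ℝ (u p) c| ≤ r * ‖Finsupp.linearCombination ℝ x c‖} := by
    ext p; simp [Bdd]
  rw [this]
  exact isClosed_iInter fun c => isClosed_le (continuous_lc hu c).abs continuous_const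

theorem isCompact_KK (x : ℕ → X) (f : ℕ → ℕ → ℝ) (N : ℕ → ℕ) :
    IsCompact {p : (ℕ → ℝ) × (ℕ → ℝ) | KK x f N p.1 p.2} := by
  have hc : IsClosed {p : (ℕ → ℝ) × (ℕ → ℝ) | KK x f N p.1 p.2} := by
    have : {p : (ℕ → ℝ) × (ℕ → ℝ) | KK x f N p.1 p.2} =
        {p | Bdd x 1 p.1} ∩ (⋂ i, {p | |p.2 i| ≤ 2}) ∩ (⋂ n', {p | Bdd x 2 (ps f (N n') p.2)}) ∩
        (⋂ m, {p | Bdd x 4 (ps f m p.2)}) ∩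
        (⋂ k, ⋂ n', ⋂ j, ⋂ _ : k ≤ n', ⋂ _ : j < k, {p | |ps f (N n') p.2 j - p.1 j| ≤ (1 / 2) ^ k}) ∩
        (⋂ k, ⋂ m, ⋂ j, ⋂ _ : N k ≤ m, ⋂ _ : j < k, {p | |ps f m p.2 j - p.1 j| ≤ 2 * (1 / 2) ^ k}) := by
      ext p
      simp only [Set.mem_inter_iff, Set.mem_iInter, Set.mem_ofPred_eq]
      constructor
      · rintro ⟨h1, h2, h3, h4, h5, h6⟩
        exact ⟨⟨⟨⟨⟨h1, h2⟩, h3⟩, h4⟩, h5⟩, h6⟩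
      · rintro ⟨⟨⟨⟨⟨h1, h2⟩, h3⟩, h4⟩, h5⟩, h6⟩
        exact ⟨h1, h2, h3, h4, h5, h6⟩
    have hps : ∀ m, Continuous fun p : (ℕ → ℝ) × (ℕ → ℝ) => ps f m p.2 := fun m =>
      (continuous_ps f m).comp continuous_snd
    have hpd : ∀ m j, Continuous fun p : (ℕ → ℝ) × (ℕ → ℝ) => |ps f m p.2 j - p.1 j| := fun m j =>
      (((continuous_apply j).comp (hps m)).sub ((continuous_apply j).comp continuous_fst)).abs
    rw [this]
    refine ((((IsClosed.inter ?_ ?_).inter ?_).inter ?_).inter ?_).inter ?_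
    · exact isClosed_Bdd x 1 continuous_fst
    · exact isClosed_iInter fun i =>
        isClosed_le ((continuous_apply i).comp continuous_snd).abs continuous_const
    · exact isClosed_iInter fun i => isClosed_Bdd x 2 (hps _)
    · exact isClosed_iInter fun i => isClosed_Bdd x 4 (hps _)
    · exact isClosed_iInter fun k => isClosed_iInter fun n => isClosed_iInter fun j => isClosed_iInter fun _ =>
        isClosed_iInter fun _ => isClosed_le (hpd _ _) continuous_const
    · exact isClosed_iInter fun k => isClosed_iInter fun n => isClosed_iInter fun j => isClosed_iInter fun _ =>
        isClosed_iInter fun _ => isClosed_le (hpd _ _) continuous_const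
  have hbig : IsCompact ((Set.pi Set.univ fun j : ℕ => Set.Icc (-‖x j‖) ‖x j‖) ×ˢ
      (Set.pi Set.univ fun _ : ℕ => Set.Icc (-2 : ℝ) 2)) :=
    (isCompact_univ_pi fun _ => isCompact_Icc).prod (isCompact_univ_pi fun _ => isCompact_Icc)
  refine hbig.of_isClosed_subset hc fun p hp => ?_
  have hp : KK x f N p.1 p.2 := hp
  refine ⟨fun j _ => ?_, fun i _ => ?_⟩
  · have := hp.c1.coord j
    rw [one_mul] at this
    exact abs_le.1 this
  · exact abs_le.1 (hp.c2 i)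

/-- Realization of the coordinate functions in `C(2^ℕ)`. -/
theorem realize (x : ℕ → X) (f : ℕ → ℕ → ℝ) (N : ℕ → ℕ) : ∃ a v : ℕ → CantorC,
    (∀ t, KK x f N (fun j => a j t) (fun i => v i t)) ∧
    ∀ u g, KK x f N u g → ∃ t, (∀ j, a j t = u j) ∧ ∀ i, v i t = g i := by
  let K : Set ((ℕ → ℝ) × (ℕ → ℝ)) := {p | KK x f N p.1 p.2}
  have hK : IsCompact K := isCompact_KK x f N
  have : CompactSpace K := isCompact_iff_compactSpace.1 hK
  have : Nonempty K := ⟨⟨(0, 0), KK.zero x f N⟩⟩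
  let _ : MetricSpace K := metrizableSpaceMetric K
  obtain ⟨π, hπ, hs⟩ := exists_nat_bool_continuous_surjective_of_compact K
  have hπ' : Continuous fun t => (π t).1 := continuous_subtype_val.comp hπ
  refine ⟨fun j => ⟨fun t => (π t).1.1 j, (continuous_apply j).comp (continuous_fst.comp hπ')⟩,
    fun i => ⟨fun t => (π t).1.2 i, (continuous_apply i).comp (continuous_snd.comp hπ')⟩,
    fun t => (π t).2, fun u g h => ?_⟩
  obtain ⟨t, ht⟩ := hs ⟨(u, g), h⟩
  exact ⟨t, fun j => by simp [ht], fun i => by simp [ht]⟩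

variable {x : ℕ → X} {f : ℕ → ℕ → ℝ} {N : ℕ → ℕ}

theorem ps_clm (T : CantorC →L[ℝ] ℝ) (v : ℕ → CantorC) (m : ℕ) :
    ps f m (fun i => T (v i)) = fun j => T (∑ i ∈ Finset.range m, f i j • v i) := by
  funext j
  rw [ps_apply, map_sum]
  exact Finset.sum_congr rfl fun i _ => by rw [map_smul, smul_eq_mul, mul_comm]

theorem dual_bound (h : CantorC →L[ℝ] ℝ) (hh : ‖h‖ ≤ 1) (F : CantorC) (C : ℝ) (hF : ∀ t, |F t| ≤ C) : |h F| ≤ C := by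
  have : ‖F‖ ≤ C := (ContinuousMap.norm_le_of_nonempty F).2 hF
  calc |h F| = ‖h F‖ := rfl
    _ ≤ ‖h‖ * ‖F‖ := h.le_opNorm F
    _ ≤ 1 * C := by gcongr
    _ = C := one_mul C

theorem dualpt (a v : ℕ → CantorC) (hpt : ∀ t, KK x f N (fun j => a j t) (fun i => v i t))
    (h : CantorC →L[ℝ] ℝ) (hh : ‖h‖ ≤ 1) : KK x f N (fun j => h (a j)) (fun i => h (v i)) := by
  let E : CantorSet → CantorC →L[ℝ] ℝ := fun t => ContinuousMap.evalCLM ℝ t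
  have hE : ∀ t F, E t F = F t := fun t F => rfl
  have hpt : ∀ t, KK x f N (fun j => E t (a j)) (fun i => E t (v i)) := hpt
  have hb : ∀ (r : ℝ) (b : ℕ → CantorC), (∀ t, Bdd x r (fun j => E t (b j))) → Bdd x r (fun j => h (b j)) := by
    intro r b hb c
    rw [← lincomb_clm]
    refine dual_bound h hh _ _ fun t => ?_
    have := hb t c
    rwa [← lincomb_clm] at this
  refine ⟨hb 1 a fun t => (hpt t).c1, fun i => dual_bound h hh _ _ fun t => (hpt t).c2 i, fun n' => ?_, fun m => ?_,
    fun k n' j h1 h2 => ?_, fun k m j h1 h2 => ?_⟩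
  · rw [ps_clm]
    refine hb _ _ fun t => ?_
    have := (hpt t).c3 n'
    rwa [ps_clm] at this
  · rw [ps_clm]
    refine hb _ _ fun t => ?_
    have := (hpt t).c4 m
    rwa [ps_clm] at this
  · rw [ps_clm]
    dsimp only
    rw [← map_sub]
    refine dual_bound h hh _ _ fun t => ?_
    have := (hpt t).c5 k n' j h1 h2
    rw [ps_clm] at this
    dsimp only at this
    rwa [← map_sub] at this
  · rw [ps_clm]
    dsimp only
    rw [← map_sub]
    refine dual_bound h hh _ _ fun t => ?_
    have := (hpt t).c6 k m j h1 h2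
    rw [ps_clm] at this
    dsimp only at this
    rwa [← map_sub] at this

end Real1

open Filter Topology MeasureTheory TopologicalSpace

section Real2
variable {X : Type*} [NormedAddCommGroup X] [NormedSpace ℝ X]

theorem construction_skolem {x : ℕ → X} {f : ℕ → ℕ → ℝ} {N : ℕ → ℕ} (hN : StrictMono N)
    (hE : ∀ n u g, BB x f N n u g → ∃ i0, N n ≤ i0 ∧ i0 < N (n + 1) ∧ Good x f N n u g i0)
    (a v : ℕ → CantorC)
    (hpt : ∀ t, KK x f N (fun j => a j t) (fun i => v i t))
    (hpts : ∀ u g, KK x f N u g → ∃ t, (∀ j, a j t = u j) ∧ ∀ i, v i t = g i) (n q : ℕ) (y : (ℕ ⊕ ℕ) →₀ ℚ) :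
    ∃ d, InL N n d ∧ ∀ w, InL N n w →
      ‖ev (Sum.elim a v) w‖ + 1/4 * (‖ev (Sum.elim a v) (y - d)‖ - (1/2 : ℝ)^q) ≤
        max ‖ev (Sum.elim a v) (w + y)‖ ‖ev (Sum.elim a v) (w - y)‖ := by
  classical
  set z : ℕ ⊕ ℕ → CantorC := Sum.elim a v with hz
  let z' : ℕ ⊕ ℕ → CantorC := Sum.elim a (fun i => if i < N n then v i else 0)
  let M : Submodule ℝ CantorC := Submodule.span ℝ (Set.range z')
  have hMa : ∀ j, a j ∈ M := fun j => Submodule.subset_span ⟨Sum.inl j, rfl⟩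
  have hMv : ∀ i < N n, v i ∈ M := fun i hi => Submodule.subset_span ⟨Sum.inr i, by simp [z', hi]⟩
  have hMw : ∀ w, InL N n w → ev z w ∈ M := by
    intro w hw
    unfold ev Finsupp.sum
    refine Submodule.sum_mem _ fun s _ => ?_
    rcases s with j | i
    · exact Submodule.smul_mem _ _ (hMa j)
    · by_cases hi : i < N n
      · exact Submodule.smul_mem _ _ (hMv i hi)
      · rw [hw i (not_lt.1 hi)]; simp
  have hMd : ∀ c, ∃ d, InL N n d ∧ ev z d = ev z' c := by
    intro c
    induction c using Finsupp.induction_linear with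
    | zero => exact ⟨0, fun _ _ => rfl, by rw [ev_zero, ev_zero]⟩
    | add c c' h h' =>
      obtain ⟨d, h1, h2⟩ := h
      obtain ⟨d', h1', h2'⟩ := h'
      exact ⟨d + d', fun i hi => by simp [h1 i hi, h1' i hi], by rw [ev_add, ev_add, h2, h2']⟩
    | single s r =>
      rcases s with j | i
      · exact ⟨Finsupp.single (Sum.inl j) r, fun i hi => by simp, by
          rw [ev_single, ev_single]; rfl⟩
      · by_cases hi : i < N n
        · refine ⟨Finsupp.single (Sum.inr i) r, fun i' hi' => ?_, ?_⟩
          · rw [Finsupp.single_apply, if_neg]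
            intro h
            have := Sum.inr_injective h
            omega
          · rw [ev_single, ev_single]; simp [z, z', hi]
        · refine ⟨0, fun _ _ => rfl, ?_⟩
          rw [ev_single, ev_zero]; simp [z', hi]
  set Y : CantorC := ev z y with hY
  let Mc : Submodule ℝ CantorC := M.topologicalClosure
  have hcl : IsClosed (Mc : Set CantorC) := M.isClosed_topologicalClosure
  have hMMc : M ≤ Mc := M.le_topologicalClosure
  set D : ℝ := ‖(Submodule.Quotient.mk Y : CantorC ⧸ Mc)‖ with hD
  -- the dual functional
  obtain ⟨h, hh1, hhM, hhY⟩ : ∃ h : CantorC →L[ℝ] ℝ, ‖h‖ ≤ 1 ∧ (∀ w ∈ M, h w = 0) ∧ h Y = D := by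
    obtain ⟨φ, hφ1, hφ2⟩ := exists_dual_vector'' ℝ (Submodule.Quotient.mk Y : CantorC ⧸ Mc)
    refine ⟨LinearMap.mkContinuous (φ.toLinearMap.comp Mc.mkQ) 1 (fun F => ?_), ?_, fun w hw => ?_, ?_⟩
    · have h1 := φ.le_opNorm (Submodule.Quotient.mk F : CantorC ⧸ Mc)
      have h2 := Submodule.Quotient.norm_mk_le Mc F
      calc _ ≤ ‖φ‖ * ‖(Submodule.Quotient.mk F : CantorC ⧸ Mc)‖ := h1
        _ ≤ 1 * ‖F‖ := by gcongr
    · exact LinearMap.mkContinuous_norm_le _ zero_le_one _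
    · show φ (Submodule.Quotient.mk w : CantorC ⧸ Mc) = 0
      rw [(Submodule.Quotient.mk_eq_zero Mc).2 (hMMc hw), map_zero]
    · exact hφ2
  obtain ⟨d, hd1, hd2⟩ : ∃ d, InL N n d ∧ ‖Y - ev z d‖ ≤ D + (1 / 2) ^ q := by
    have hε : (0:ℝ) < (1 / 2) ^ q / 2 := by positivity
    obtain ⟨m, hm1, hm2⟩ := Submodule.Quotient.norm_mk_lt (Submodule.Quotient.mk Y : CantorC ⧸ Mc) hε
    have hm3 : Y - m ∈ (Mc : Set CantorC) := (Submodule.Quotient.eq Mc).1 hm1.symm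
    rw [← closure_ev_eq] at hm3
    obtain ⟨_, ⟨c, rfl⟩, hc⟩ := Metric.mem_closure_iff.1 hm3 _ hε
    obtain ⟨d, h1, h2⟩ := hMd c
    refine ⟨d, h1, ?_⟩
    rw [h2]
    rw [dist_eq_norm] at hc
    calc ‖Y - ev z' c‖ = ‖(Y - m - ev z' c) + m‖ := by congr 1; abel
      _ ≤ ‖Y - m - ev z' c‖ + ‖m‖ := norm_add_le _ _
      _ ≤ D + (1 / 2) ^ q := by linarith
  refine ⟨d, hd1, fun w hw => ?_⟩
  rw [ev_sub, ev_add, ev_sub, ← hY]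
  set W := ev z w with hW
  have hWM : W ∈ M := hMw w hw
  have hhK : KK x f N 0 (fun i => h (v i)) := by
    have := dualpt a v hpt h hh1
    have e : (fun j => h (a j)) = 0 := funext fun j => hhM _ (hMa j)
    rwa [e] at this
  have hh0 : ∀ i < N n, h (v i) = 0 := fun i hi => hhM _ (hMv i hi)
  have hmain : ‖W‖ ≤ max ‖W + Y‖ ‖W - Y‖ - 1 / 4 * D := by
    refine (ContinuousMap.norm_le_of_nonempty W).2 fun t => ?_
    obtain ⟨g, hg1, hg2⟩ := ext_exists hN hE ((hpt t).bb n)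
    obtain ⟨t0, ha0, hv0⟩ := hpts _ _ (KK_of_ext hN hg2)
    have hper : ∀ r : ℝ, |r| ≤ 1 / 4 → ∃ t', W t' = W t ∧ Y t' = Y t0 + r * D := by
      intro r hr
      obtain ⟨t', ha', hv'⟩ := hpts _ _ (pert hN hg2 hhK hh0 hr)
      have h1 : ∀ F ∈ Submodule.span ℝ (Set.range z), F t' = F t0 + r * h F := by
        intro F hF
        induction hF using Submodule.span_induction with
        | mem F hF =>
          obtain ⟨s, rfl⟩ := hF
          rcases s with j | i
          · show a j t' = a j t0 + r * h (a j)
            rw [ha', ha0, hhM _ (hMa j)]; simp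
          · show v i t' = v i t0 + r * h (v i)
            rw [hv', hv0]; simp
        | zero => simp
        | add F G _ _ hF hG => rw [ContinuousMap.add_apply, ContinuousMap.add_apply, hF, hG, map_add]; ring
        | smul c F _ hF =>
          rw [ContinuousMap.smul_apply, ContinuousMap.smul_apply, hF, map_smul, smul_eq_mul, smul_eq_mul, smul_eq_mul]
          ring
      have h2 : ∀ F ∈ M, F t0 = F t := by
        intro F hF
        induction hF using Submodule.span_induction with
        | mem F hF =>
          obtain ⟨s, rfl⟩ := hF
          rcases s with j | i
          · exact ha0 j
          · by_cases hi : i < N n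
            · simp only [z', Sum.elim_inr, if_pos hi]
              rw [hv0, hg1 i hi]
            · simp [z', hi]
        | zero => simp
        | add F G _ _ hF hG => rw [ContinuousMap.add_apply, ContinuousMap.add_apply, hF, hG]
        | smul c F _ hF => rw [ContinuousMap.smul_apply, ContinuousMap.smul_apply, hF]
      refine ⟨t', ?_, ?_⟩
      · rw [h1 W (ev_mem_span _ _), hhM W hWM, h2 W hWM]; ring
      · rw [h1 Y (ev_mem_span _ _), hhY]
    obtain ⟨p, hp1, hp2⟩ := hper (1 / 4) (by norm_num [abs_of_pos])
    obtain ⟨m, hm1, hm2⟩ := hper (-(1 / 4)) (by rw [abs_neg]; norm_num [abs_of_pos])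
    have nb : ∀ (F : CantorC) s, |F s| ≤ ‖F‖ := fun F s => F.norm_coe_le_norm s
    have q1 := abs_le.1 (nb (W + Y) p)
    have q2 := abs_le.1 (nb (W + Y) m)
    have q3 := abs_le.1 (nb (W - Y) p)
    have q4 := abs_le.1 (nb (W - Y) m)
    rw [ContinuousMap.add_apply] at q1 q2
    rw [ContinuousMap.sub_apply] at q3 q4
    rw [hp1, hp2] at q1 q3
    rw [hm1, hm2] at q2 q4
    have r1 := le_max_left ‖W + Y‖ ‖W - Y‖
    have r2 := le_max_right ‖W + Y‖ ‖W - Y‖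
    rw [Real.norm_eq_abs, abs_le]
    rcases le_total 0 (W t) with s1 | s1 <;> rcases le_total 0 (Y t0) with s2 | s2 <;> constructor <;> linarith [norm_nonneg (Submodule.Quotient.mk Y : CantorC ⧸ Mc)]
  linarith

/-- The basic sequence `v` is a Schauder basis of its closed linear span. -/
theorem construction_basis {x : ℕ → X} {f : ℕ → ℕ → ℝ} {N : ℕ → ℕ} (hN0 : N 0 = 0) (hN : StrictMono N)
    (hE : ∀ n u g, BB x f N n u g → ∃ i0, N n ≤ i0 ∧ i0 < N (n + 1) ∧ Good x f N n u g i0)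
    (hE' : ∀ n i0, N n ≤ i0 → i0 < N (n + 1) → ∃ u g, BB x f N n u g ∧ Good x f N n u g i0)
    (a v : ℕ → CantorC)
    (hpt : ∀ t, KK x f N (fun j => a j t) (fun i => v i t))
    (hpts : ∀ u g, KK x f N u g → ∃ t, (∀ j, a j t = u j) ∧ ∀ i, v i t = g i) :
    HasSchauderBasis (Submodule.span ℝ (Set.range v)).topologicalClosure := by
  classical
  have hmem : ∀ i, v i ∈ (Submodule.span ℝ (Set.range v)).topologicalClosure := fun i =>
    Submodule.le_topologicalClosure _ (Submodule.subset_span ⟨i, rfl⟩)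
  let v' : ℕ → (Submodule.span ℝ (Set.range v)).topologicalClosure := fun i => ⟨v i, hmem i⟩
  have hcoe : ∀ (s : Finset ℕ) (c : ℕ → ℝ), ((∑ i ∈ s, c i • v' i : (Submodule.span ℝ (Set.range v)).topologicalClosure) : CantorC) =
      ∑ i ∈ s, c i • v i := fun s c => by
    simp [v']
  refine ⟨v', grunblum v' ?_ ?_ 8 (by norm_num) ?_⟩
  · intro y
    rw [Metric.mem_closure_iff]
    intro ε hε
    have hy : (y : CantorC) ∈ closure (Submodule.span ℝ (Set.range v) : Set CantorC) := y.2
    obtain ⟨w, hw, hd⟩ := Metric.mem_closure_iff.1 hy ε hε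
    have hw' : w ∈ Submodule.span ℝ (Set.range v) := hw
    rw [← Finsupp.range_linearCombination] at hw'
    obtain ⟨c, rfl⟩ := hw'
    refine ⟨Finsupp.linearCombination ℝ v' c, ?_, ?_⟩
    · have := LinearMap.mem_range_self (Finsupp.linearCombination ℝ v') c
      rwa [Finsupp.range_linearCombination ℝ (v := v')] at this
    · rw [Subtype.dist_eq, Finsupp.linearCombination_apply, Finsupp.sum, hcoe]
      rwa [Finsupp.linearCombination_apply, Finsupp.sum] at hd
  · intro i hi
    have hvi : v i = 0 := congrArg Subtype.val hi
    obtain ⟨n, -, b2, b3⟩ := exists_block hN (n0 := 0) i (by omega)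
    obtain ⟨u, g, hB, hG⟩ := hE' n i b2 b3
    let g' : ℕ → ℝ := fun k => if k < N n then g k else if k = i then 1 else 0
    have h1 : ∀ k < N n, g' k = g k := fun k hk => if_pos hk
    have h2 : ∀ k, |g' k| ≤ 2 := fun k => by
      by_cases hk : k < N n
      · rw [h1 k hk]; exact hB.c2 k
      · show |if k < N n then g k else if k = i then 1 else 0| ≤ 2
        rw [if_neg hk]; split_ifs <;> norm_num
    have hp : Pat N n g' i := ⟨b2, b3, fun k hk _ => if_neg (not_lt.2 hk)⟩
    have hB' := (hB.congr_g hN h1 h2).succ hN hp (hG.congr rfl (fun _ _ => rfl) rfl h1)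
    obtain ⟨g2, c1, c2⟩ := ext_exists hN hE hB'
    obtain ⟨t, -, ht⟩ := hpts _ _ (KK_of_ext hN c2)
    have := ht i
    rw [hvi, c1 i b3, hp.2.2 i b2 b3, if_pos rfl] at this
    simp at this
  · intro c m m' hm
    have e : ∀ m, ‖∑ i ∈ Finset.range m, c i • v' i‖ = ‖∑ i ∈ Finset.range m, c i • v i‖ := fun m => by
      rw [← hcoe]; rfl
    rw [e, e]
    refine (ContinuousMap.norm_le_of_nonempty _).2 fun t => ?_
    obtain ⟨t', -, ht'⟩ := hpts _ _ (trunc (hpt t) hN m)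
    have h1 := (∑ i ∈ Finset.range m', c i • v i).norm_coe_le_norm t'
    have h2 : (∑ i ∈ Finset.range m', c i • v i) t' = 1 / 8 * (∑ i ∈ Finset.range m, c i • v i) t := by
      simp only [ContinuousMap.sum_apply, ContinuousMap.smul_apply, ht', smul_eq_mul]
      rw [Finset.mul_sum, ← Finset.sum_subset (Finset.range_mono hm)]
      · refine Finset.sum_congr rfl fun i hi => ?_
        rw [if_pos (Finset.mem_range.1 hi)]; ring
      · intro i _ hi
        rw [if_neg (by simpa using hi), mul_zero]
    rw [h2, norm_mul] at h1
    have h3 : ‖(1 / 8 : ℝ)‖ = 1 / 8 := by norm_num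
    rw [h3] at h1
    linarith

end Real2

theorem construction (X : Type) [NormedAddCommGroup X] [NormedSpace ℝ X] [CompleteSpace X]
    [TopologicalSpace.SeparableSpace X] :
    ∃ (x : ℕ → X) (z : ℕ ⊕ ℕ → CantorC) (N : ℕ → ℕ) (ω : ℕ × ℕ × ((ℕ ⊕ ℕ) →₀ ℚ) → ((ℕ ⊕ ℕ) →₀ ℚ))
      (J : X →ₗᵢ[ℝ] CantorC),
    (∀ n, n ≤ N n) ∧ SkolemP z N ω ∧ (∀ j, J (x j) = z (Sum.inl j)) ∧
    (∀ y, J y ∈ (Submodule.span ℝ (Set.range fun i => z (Sum.inr i))).topologicalClosure) ∧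
    HasSchauderBasis (Submodule.span ℝ (Set.range fun i => z (Sum.inr i))).topologicalClosure := by
  classical
  let x : ℕ → X := denseSeq X
  have hx : DenseRange x := denseRange_denseSeq X
  obtain ⟨f, N, hN0, hN, hE, hE'⟩ := construct x
  obtain ⟨a, v, hpt, hpts⟩ := realize x f N
  have hsk := construction_skolem hN hE a v hpt hpts
  choose ω hω1 hω2 using hsk
  have hda : Dense (Submodule.span ℝ (Set.range x) : Set X) := hx.mono Submodule.subset_span
  have hle : ∀ c : ℕ →₀ ℝ, ‖Finsupp.linearCombination ℝ a c‖ ≤ 1 * ‖Finsupp.linearCombination ℝ x c‖ := by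
    intro c
    refine (ContinuousMap.norm_le_of_nonempty _).2 fun t => ?_
    have h1 := (hpt t).c1 c
    have h2 := lincomb_clm (ContinuousMap.evalCLM ℝ t : CantorC →L[ℝ] ℝ) a c
    have h3 : Finsupp.linearCombination ℝ (fun j => a j t) c = Finsupp.linearCombination ℝ a c t := h2.symm
    rw [h3] at h1
    exact h1
  obtain ⟨T, hT⟩ := extend_clm x a hda 1 hle
  have hnorm : ∀ j, ‖a j‖ = ‖x j‖ := by
    intro j
    apply le_antisymm
    · have := hle (Finsupp.single j 1)
      simpa using this
    · obtain ⟨φ, hφ1, hφ2⟩ := exists_dual_vector'' ℝ (x j)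
      have hB : BB x f N 0 (fun i => φ (x i)) 0 := by
        refine ⟨fun c => ?_, by simp, fun n' _ => ?_, fun m _ => ?_, fun k n' j h1 h2 h3 => by omega,
          fun k m j h1 h2 h3 h4 => by omega⟩
        · rw [← lincomb_clm]
          refine (φ.le_opNorm _).trans ?_
          gcongr
        · rw [ps_zero]; exact Bdd.zero (by norm_num)
        · rw [ps_zero]; exact Bdd.zero (by norm_num)
      obtain ⟨g, -, hg⟩ := ext_exists hN hE hB
      obtain ⟨t, ht, -⟩ := hpts _ _ (KK_of_ext hN hg)
      have h1 := (a j).norm_coe_le_norm t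
      rw [ht j, hφ2] at h1
      simpa using h1
  have hTn : ∀ y, ‖T y‖ = ‖y‖ := by
    have hc : IsClosed {y | ‖T y‖ = ‖y‖} := isClosed_eq T.continuous.norm continuous_norm
    intro y
    have : closure (Set.range x) ⊆ {y | ‖T y‖ = ‖y‖} := by
      refine closure_minimal ?_ hc
      rintro _ ⟨j, rfl⟩
      show ‖T (x j)‖ = ‖x j‖
      rw [hT, hnorm]
    exact this (hx y)
  have hamem : ∀ j, a j ∈ (Submodule.span ℝ (Set.range v)).topologicalClosure := by
    intro j
    show a j ∈ closure (Submodule.span ℝ (Set.range v) : Set CantorC)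
    rw [Metric.mem_closure_iff]
    intro ε hε
    obtain ⟨n, hn⟩ := exists_pow_lt_of_lt_one hε (show (1 / 2 : ℝ) < 1 by norm_num)
    let n' := max n (j + 1)
    refine ⟨∑ i ∈ Finset.range (N n'), f i j • v i, ?_, ?_⟩
    · exact Submodule.sum_mem _ fun i _ => Submodule.smul_mem _ _ (Submodule.subset_span ⟨i, rfl⟩)
    · rw [dist_eq_norm]
      refine lt_of_le_of_lt ?_ hn
      refine (ContinuousMap.norm_le_of_nonempty _).2 fun t => ?_
      have h1 := (hpt t).c5 n' n' j le_rfl (lt_of_lt_of_le (Nat.lt_succ_self j) (le_max_right _ _))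
      have h2 : ((1:ℝ) / 2) ^ n' ≤ (1 / 2) ^ n := half_pow_le (le_max_left _ _)
      have h3 : (∑ i ∈ Finset.range (N n'), f i j • v i) t = ps f (N n') (fun i => v i t) j := by
        rw [ps_apply]
        simp [ContinuousMap.sum_apply, mul_comm]
      rw [ContinuousMap.sub_apply, h3, Real.norm_eq_abs, abs_sub_comm]
      exact h1.trans h2
  refine ⟨x, Sum.elim a v, N, fun p => ω p.1 p.2.1 p.2.2, ⟨T.toLinearMap, hTn⟩, fun n => hN.le_apply,
    fun n q y => ⟨hω1 n q y, hω2 n q y⟩, fun j => hT j, fun y => ?_, ?_⟩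
  · show T y ∈ (Submodule.span ℝ (Set.range v)).topologicalClosure
    have hc : IsClosed {y | T y ∈ (Submodule.span ℝ (Set.range v)).topologicalClosure} :=
      (Submodule.isClosed_topologicalClosure _).preimage T.continuous
    have : closure (Set.range x) ⊆ {y | T y ∈ (Submodule.span ℝ (Set.range v)).topologicalClosure} := by
      refine closure_minimal ?_ hc
      rintro _ ⟨j, rfl⟩
      show T (x j) ∈ (Submodule.span ℝ (Set.range v)).topologicalClosure
      rw [hT]
      exact hamem j
    exact this (hx y)
  · exact construction_basis hN0 hN hE hE' a v hpt hpts

/-- **Corollary.** There is a map `f : ω₁ → ω₁` such that for every `ξ < ω₁`, every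
separable Banach space `X` with `φ_NU(X) ≤ ξ` embeds isometrically into a Banach
space `Y` with a Schauder basis satisfying `φ_NU(Y) ≤ f(ξ)`. -/
theorem phiNU_uniform_basis_embedding
    (e : ℕ → CantorC) (hbasis : IsSchauderBasis e) (hnorm : ∀ n, ‖e n‖ = 1) :
    ∃ f : Ordinal.{0} → Ordinal.{0},
      (∀ ξ : Ordinal.{0}, ξ < omega1 → f ξ < omega1) ∧
      ∀ ξ : Ordinal.{0}, ξ < omega1 →
        ∀ (X : Type) [NormedAddCommGroup X] [NormedSpace ℝ X] [CompleteSpace X]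
          [TopologicalSpace.SeparableSpace X],
          bourgainIndex e X ≤ ξ →
          ∃ Y : SB, HasSchauderBasis ↥Y.1 ∧ EmbedsIsometrically X ↥Y.1 ∧
            bourgainIndex e ↥Y.1 ≤ f ξ :=
  assembly e hbasis hnorm (fun X => construction X)
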